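/- Every nonzero function f ∈ H¹(Γ) admits a factorization f = φ g with φ Royden inner and g outer, and the factors are unique up to multiplication by an invertible inner function. -/

import Mathlib

open MeasureTheory Metric Complex Filter Set
open scoped ENNReal Topology

noncomputable section

/-- `u` is harmonic (real-valued) on an open set `U ⊆ ℂ`: locally the real part of a
holomorphic function. -/
def IsHarmonicOn (u : ℂ → ℝ) (U : Set ℂ) : Prop :=
  ∀ z ∈ U, ∃ r > 0, ball z r ⊆ U ∧ ∃ g : ℂ → ℂ,
    DifferentiableOn ℂ g (ball z r) ∧ ∀ w ∈ ball z r, u w = (g w).re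

/-- An analytic boundary curve: the image of an injective analytic immersion of the
unit circle. -/
def IsAnalyticCurve (C : Set ℂ) : Prop :=
  ∃ γ : ℂ → ℂ, AnalyticOnNhd ℂ γ (sphere (0:ℂ) 1) ∧ Set.InjOn γ (sphere (0:ℂ) 1) ∧
    γ '' (sphere (0:ℂ) 1) = C ∧ ∀ z ∈ sphere (0:ℂ) 1, deriv γ z ≠ 0

/-- Nontangential limit `L` of `g` at a boundary point `ζ` of `Ω`: convergence within
every cone-like approach region of aperture `a > 1`. -/
def NTLim (Ω : Set ℂ) (g : ℂ → ℂ) (ζ : ℂ) (L : ℂ) : Prop :=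
  ∀ a : ℝ, 1 < a →
    Tendsto g (𝓝[{z ∈ Ω | ‖z - ζ‖ < a * infDist z Ωᶜ}] ζ) (𝓝 L)

/-- A bounded finitely connected planar domain `Ω` with analytic boundary components
`Γ 0, …, Γ n` (`Γ 0` the outer one), a base point `w₀ ∈ Ω`, and the family of harmonic
measures `ωm w` (probability measures on the boundary reproducing functions harmonic on
`Ω` and continuous on its closure). -/
structure MCDomain (n : ℕ) where
  Ω : Set ℂ
  Γ : Fin (n+1) → Set ℂ
  w₀ : ℂ
  ωm : ℂ → Measure ℂ
  isOpen : IsOpen Ω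
  conn : IsConnected Ω
  bdd : Bornology.IsBounded Ω
  base_mem : w₀ ∈ Ω
  frontier_eq : frontier Ω = ⋃ j, Γ j
  disj : ∀ j k, j ≠ k → Disjoint (Γ j) (Γ k)
  curve : ∀ j, IsAnalyticCurve (Γ j)
  outer_comp : ∀ j, j ≠ 0 → ∀ ζ ∈ Γ j, ζ ∈ closure (interior (closure (Ω ∪ Γ 0)))
  prob : ∀ w ∈ Ω, IsProbabilityMeasure (ωm w)
  supp : ∀ w ∈ Ω, ωm w (frontier Ω)ᶜ = 0
  dirichlet : ∀ u : ℂ → ℝ, ContinuousOn u (closure Ω) → IsHarmonicOn u Ω →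
    ∀ w ∈ Ω, u w = ∫ ζ, u ζ ∂(ωm w)

variable {n : ℕ}

/-- Harmonic measure at the base point. -/
def MCDomain.ω (D : MCDomain n) : Measure ℂ := D.ωm D.w₀

/-- `H^∞(Γ)`: boundary functions (via nontangential limits a.e.) of bounded analytic
functions on `Ω`. -/
def MCDomain.Hinf (D : MCDomain n) : Set (ℂ → ℂ) :=
  {ψ | ∃ g : ℂ → ℂ, DifferentiableOn ℂ g D.Ω ∧ (∃ C : ℝ, ∀ z ∈ D.Ω, ‖g z‖ ≤ C) ∧
    ∀ᵐ ζ ∂D.ω, NTLim D.Ω g ζ (ψ ζ)}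

/-- `H²(Γ)`: boundary functions of analytic functions on `Ω` such that `|g|²` has a
harmonic majorant. -/
def MCDomain.H2 (D : MCDomain n) : Set (ℂ → ℂ) :=
  {ψ | ∃ g : ℂ → ℂ, DifferentiableOn ℂ g D.Ω ∧
    (∃ h : ℂ → ℝ, IsHarmonicOn h D.Ω ∧ ∀ z ∈ D.Ω, ‖g z‖ ^ 2 ≤ h z) ∧
    ∀ᵐ ζ ∂D.ω, NTLim D.Ω g ζ (ψ ζ)}

/-- `H¹(Γ)`: boundary functions of analytic functions on `Ω` such that `|g|` has a
harmonic majorant. -/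
def MCDomain.H1 (D : MCDomain n) : Set (ℂ → ℂ) :=
  {ψ | ∃ g : ℂ → ℂ, DifferentiableOn ℂ g D.Ω ∧
    (∃ h : ℂ → ℝ, IsHarmonicOn h D.Ω ∧ ∀ z ∈ D.Ω, ‖g z‖ ≤ h z) ∧
    ∀ᵐ ζ ∂D.ω, NTLim D.Ω g ζ (ψ ζ)}

/-- `ψ` is (the boundary function of) an outer function on `Ω` in Royden's sense:
`log|g(w)| = ∫_Γ log|ψ| dω_w` for all `w ∈ Ω`. -/
def MCDomain.IsOuter (D : MCDomain n) (ψ : ℂ → ℂ) : Prop :=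
  ∃ g : ℂ → ℂ, DifferentiableOn ℂ g D.Ω ∧ (∀ᵐ ζ ∂D.ω, NTLim D.Ω g ζ (ψ ζ)) ∧
    ∀ w ∈ D.Ω, Real.log ‖g w‖ = ∫ ζ, Real.log ‖ψ ζ‖ ∂(D.ωm w)

/-- Royden inner function (boundary form): a member of `H^∞(Γ)` whose modulus is
a.e. constant on each boundary component. -/
def MCDomain.IsInner (D : MCDomain n) (φ : ℂ → ℂ) : Prop :=
  φ ∈ D.Hinf ∧ ∀ j, ∃ c : ℝ, ∀ᵐ ζ ∂D.ω, ζ ∈ D.Γ j → ‖φ ζ‖ = c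

section

/-- A continuous function on a circle bounded by `m` whose average is at least `m` takes the value
`m` at the rightmost point. -/
theorem circleAverage_eq_bound {u : ℂ → ℝ} {z : ℂ} {r m : ℝ} (hr : 0 < r)
    (hc : ContinuousOn u (sphere z r)) (hle : ∀ w ∈ sphere z r, u w ≤ m)
    (havg : m ≤ Real.circleAverage u z r) : u (z + r) = m := by
  by_contra hne
  have hmem : z + r ∈ sphere z r := by simp [abs_of_pos hr]
  have hlt : u (z + r) < m := lt_of_le_of_ne (hle _ hmem) hne
  have hcm : ∀ θ : ℝ, circleMap z r θ ∈ sphere z r := fun θ => circleMap_mem_sphere z hr.le θ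
  have hcont : Continuous fun θ : ℝ => u (circleMap z r θ) :=
    hc.comp_continuous (continuous_circleMap z r) hcm
  have h := intervalIntegral.integral_lt_integral_of_continuousOn_of_le_of_exists_lt
    (a := 0) (b := 2 * Real.pi) (by positivity) hcont.continuousOn
    (continuousOn_const (c := m)) (fun θ _ => hle _ (hcm θ))
    ⟨0, by constructor <;> positivity, by simpa [circleMap] using hlt⟩
  rw [Real.circleAverage, smul_eq_mul] at havg
  simp only [intervalIntegral.integral_const, sub_zero, smul_eq_mul] at h
  have hpi : 0 < 2 * Real.pi := by positivity
  have : (2 * Real.pi)⁻¹ * ∫ θ in (0:ℝ)..2 * Real.pi, u (circleMap z r θ) <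
      (2 * Real.pi)⁻¹ * (2 * Real.pi * m) := by gcongr
  rw [inv_mul_cancel_left₀ hpi.ne'] at this
  linarith

/-- Local sub-mean value property at a point. -/
def SubMeanAt (u : ℂ → ℝ) (z : ℂ) : Prop :=
  ∃ ρ > 0, ∀ r, 0 < r → r < ρ → u z ≤ Real.circleAverage u z r

/-- Maximum principle for continuous functions with the local sub-mean value property. -/
theorem exists_isMax_diff {K U : Set ℂ} (hK : IsCompact K) (hU : IsOpen U) (hUK : U ⊆ K)
    (hne : K.Nonempty) {u : ℂ → ℝ} (hc : ContinuousOn u K) (hsub : ∀ z ∈ U, SubMeanAt u z) :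
    ∃ z ∈ K \ U, ∀ w ∈ K, u w ≤ u z := by
  obtain ⟨z₀, hz₀, hmax⟩ := hK.exists_isMaxOn hne hc
  have hScl : IsClosed (K ∩ u ⁻¹' {u z₀}) := hc.preimage_isClosed_of_isClosed hK.isClosed
    isClosed_singleton
  have hS : IsCompact (K ∩ u ⁻¹' {u z₀}) := hK.of_isClosed_subset hScl inter_subset_left
  obtain ⟨z₁, ⟨hz₁K, hz₁⟩, hre⟩ := hS.exists_isMaxOn ⟨z₀, hz₀, rfl⟩ Complex.continuous_re.continuousOn
  rw [mem_preimage, mem_singleton_iff] at hz₁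
  have hm : ∀ w ∈ K, u w ≤ u z₁ := fun w hw => hz₁ ▸ hmax hw
  refine ⟨z₁, ⟨hz₁K, fun hzU => ?_⟩, hm⟩
  obtain ⟨ρ, hρ, hsm⟩ := hsub z₁ hzU
  obtain ⟨ε, hε, hball⟩ := Metric.isOpen_iff.1 hU z₁ hzU
  set r := min ρ ε / 2 with hr
  have hr0 : 0 < r := by positivity
  have hrρ : r < ρ := by have := min_le_left ρ ε; linarith
  have hrε : r < ε := by have := min_le_right ρ ε; linarith
  have hsph : sphere z₁ r ⊆ K := fun w hw => hUK (hball (by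
    rw [mem_sphere] at hw; rw [mem_ball, hw]; exact hrε))
  have := circleAverage_eq_bound hr0 (hc.mono hsph) (fun w hw => hm w (hsph hw)) (hsm r hr0 hrρ)
  have hmem : z₁ + r ∈ K := hsph (by simp [abs_of_pos hr0])
  have h2 := hre (show z₁ + r ∈ K ∩ u ⁻¹' {u z₀} from ⟨hmem, by simp [this, hz₁]⟩)
  simp at h2
  linarith

/-- If a continuous function with local sub-mean value property is bounded by `m` off `U`, it is
bounded by `m`. -/
theorem le_of_le_diff {K U : Set ℂ} (hK : IsCompact K) (hU : IsOpen U) (hUK : U ⊆ K)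
    {u : ℂ → ℝ} (hc : ContinuousOn u K) (hsub : ∀ z ∈ U, SubMeanAt u z) {m : ℝ}
    (hm : ∀ z ∈ K \ U, u z ≤ m) : ∀ z ∈ K, u z ≤ m := by
  intro z hz
  obtain ⟨w, hw, hmax⟩ := exists_isMax_diff hK hU hUK ⟨z, hz⟩ hc hsub
  exact (hmax z hz).trans (hm w hw)

theorem IsHarmonicOn.mono {u : ℂ → ℝ} {U V : Set ℂ} (h : IsHarmonicOn u V) (hU : IsOpen U)
    (hUV : U ⊆ V) : IsHarmonicOn u U := by
  intro z hz
  obtain ⟨r, hr, -, g, hg, hu⟩ := h z (hUV hz)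
  obtain ⟨ε, hε, hball⟩ := Metric.isOpen_iff.1 hU z hz
  have h1 : ball z (min r ε) ⊆ ball z r := ball_subset_ball (min_le_left _ _)
  exact ⟨min r ε, by positivity, (ball_subset_ball (min_le_right _ _)).trans hball, g, hg.mono h1,
    fun w hw => hu w (h1 hw)⟩

theorem isHarmonicOn_re {g : ℂ → ℂ} {U : Set ℂ} (hU : IsOpen U) (hg : DifferentiableOn ℂ g U) :
    IsHarmonicOn (fun z => (g z).re) U := by
  intro z hz
  obtain ⟨ε, hε, hball⟩ := Metric.isOpen_iff.1 hU z hz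
  exact ⟨ε, hε, hball, g, hg.mono hball, fun _ _ => rfl⟩

theorem IsHarmonicOn.congr {u v : ℂ → ℝ} {U : Set ℂ} (h : IsHarmonicOn u U)
    (huv : ∀ z ∈ U, v z = u z) : IsHarmonicOn v U := by
  intro z hz
  obtain ⟨r, hr, hb, g, hg, hu⟩ := h z hz
  exact ⟨r, hr, hb, g, hg, fun w hw => by rw [huv w (hb hw), hu w hw]⟩

theorem IsHarmonicOn.add {u v : ℂ → ℝ} {U : Set ℂ} (hu : IsHarmonicOn u U)
    (hv : IsHarmonicOn v U) : IsHarmonicOn (fun z => u z + v z) U := by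
  intro z hz
  obtain ⟨r, hr, hb, g, hg, hu⟩ := hu z hz
  obtain ⟨r', hr', hb', g', hg', hv⟩ := hv z hz
  have h1 : ball z (min r r') ⊆ ball z r := ball_subset_ball (min_le_left _ _)
  have h2 : ball z (min r r') ⊆ ball z r' := ball_subset_ball (min_le_right _ _)
  exact ⟨min r r', by positivity, h1.trans hb, fun w => g w + g' w, (hg.mono h1).add (hg'.mono h2),
    fun w hw => by simp [hu w (h1 hw), hv w (h2 hw)]⟩

theorem IsHarmonicOn.const_mul {u : ℂ → ℝ} {U : Set ℂ} (hu : IsHarmonicOn u U) (c : ℝ) :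
    IsHarmonicOn (fun z => c * u z) U := by
  intro z hz
  obtain ⟨r, hr, hb, g, hg, hu⟩ := hu z hz
  exact ⟨r, hr, hb, fun w => c * g w, hg.const_mul _, fun w hw => by simp [hu w hw]⟩

theorem IsHarmonicOn.neg {u : ℂ → ℝ} {U : Set ℂ} (hu : IsHarmonicOn u U) :
    IsHarmonicOn (fun z => -u z) U := (hu.const_mul (-1)).congr fun z _ => by ring

theorem IsHarmonicOn.sub {u v : ℂ → ℝ} {U : Set ℂ} (hu : IsHarmonicOn u U)
    (hv : IsHarmonicOn v U) : IsHarmonicOn (fun z => u z - v z) U :=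
  (hu.add hv.neg).congr fun z _ => by ring

theorem isHarmonicOn_const {U : Set ℂ} (hU : IsOpen U) (c : ℝ) : IsHarmonicOn (fun _ => c) U :=
  (isHarmonicOn_re hU (differentiableOn_const (c : ℂ))).congr fun z _ => by simp

theorem IsHarmonicOn.sum {ι : Type*} {U : Set ℂ} (hU : IsOpen U) (s : Finset ι) {u : ι → ℂ → ℝ}
    (hu : ∀ i ∈ s, IsHarmonicOn (u i) U) : IsHarmonicOn (fun z => ∑ i ∈ s, u i z) U := by
  classical
  induction s using Finset.induction_on with
  | empty => simpa using isHarmonicOn_const hU 0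
  | insert a s ha ih =>
    simp only [Finset.sum_insert ha]
    exact (hu a (by simp)).add (ih fun i hi => hu i (by simp [hi]))

theorem IsHarmonicOn.harmonicOnNhd {u : ℂ → ℝ} {U : Set ℂ} (hu : IsHarmonicOn u U) :
    InnerProductSpace.HarmonicOnNhd u U := by
  intro z hz
  obtain ⟨r, hr, hb, g, hg, hu⟩ := hu z hz
  have ha : AnalyticAt ℂ g z := hg.analyticAt (ball_mem_nhds z hr)
  have h := ha.harmonicAt_re
  refine (InnerProductSpace.harmonicAt_congr_nhds ?_).1 h
  filter_upwards [ball_mem_nhds z hr] with w hw using (hu w hw).symm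

theorem IsHarmonicOn.continuousOn {u : ℂ → ℝ} {U : Set ℂ} (hu : IsHarmonicOn u U) :
    ContinuousOn u U := by
  intro z hz
  obtain ⟨r, hr, hb, g, hg, hu⟩ := hu z hz
  have : ContinuousAt (fun w => (g w).re) z :=
    Complex.continuous_re.continuousAt.comp (hg.continuousOn.continuousAt (ball_mem_nhds z hr))
  refine (this.congr ?_).continuousWithinAt
  filter_upwards [ball_mem_nhds z hr] with w hw using (hu w hw).symm

theorem IsHarmonicOn.exists_ball {u : ℂ → ℝ} {z : ℂ} {r : ℝ} (hu : IsHarmonicOn u (ball z r)) :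
    ∃ g : ℂ → ℂ, DifferentiableOn ℂ g (ball z r) ∧ ∀ w ∈ ball z r, u w = (g w).re := by
  obtain ⟨g, hg, h⟩ := hu.harmonicOnNhd.exists_analyticOnNhd_ball_re_eq
  exact ⟨g, hg.differentiableOn, fun w hw => (h hw).symm⟩

theorem IsHarmonicOn.circleAverage_eq {u : ℂ → ℝ} {U : Set ℂ} (hu : IsHarmonicOn u U) {z : ℂ}
    {r : ℝ} (hr : 0 < r) (h : closedBall z r ⊆ U) : Real.circleAverage u z r = u z :=
  InnerProductSpace.HarmonicOnNhd.circleAverage_eq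
    (fun w hw => hu.harmonicOnNhd w (h (by rwa [abs_of_pos hr] at hw)))

theorem IsHarmonicOn.subMeanAt {u : ℂ → ℝ} {U : Set ℂ} (hU : IsOpen U) (hu : IsHarmonicOn u U)
    {z : ℂ} (hz : z ∈ U) : SubMeanAt u z := by
  obtain ⟨ε, hε, hball⟩ := Metric.isOpen_iff.1 hU z hz
  exact ⟨ε, hε, fun r hr hrε => (hu.circleAverage_eq hr
    ((closedBall_subset_ball hrε).trans hball)).ge⟩

end

section

/-- Normalized arc length on the unit circle, as a measure on `ℂ`. -/
def circ : Measure ℂ :=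
  ((ENNReal.ofReal (2 * Real.pi))⁻¹ • volume.restrict (Ioc 0 (2 * Real.pi))).map (circleMap 0 1)

instance : IsProbabilityMeasure circ := by
  have : IsProbabilityMeasure
      ((ENNReal.ofReal (2 * Real.pi))⁻¹ • volume.restrict (Ioc (0:ℝ) (2 * Real.pi))) := by
    constructor
    have h : ENNReal.ofReal (2 * Real.pi) ≠ 0 := by
      simp [Real.pi_pos]
    rw [Measure.smul_apply, Measure.restrict_apply_univ, Real.volume_Ioc, sub_zero, smul_eq_mul,
      ENNReal.inv_mul_cancel h ENNReal.ofReal_ne_top]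
  exact Measure.isProbabilityMeasure_map (continuous_circleMap 0 1).measurable.aemeasurable

theorem circ_sphere : ∀ᵐ ζ ∂circ, ζ ∈ sphere (0:ℂ) 1 := by
  refine (ae_map_iff (continuous_circleMap 0 1).measurable.aemeasurable
    isClosed_sphere.measurableSet).2 ?_
  exact Eventually.of_forall fun θ => circleMap_mem_sphere 0 zero_le_one θ

theorem integral_circ {E : Type*} [NormedAddCommGroup E] [NormedSpace ℝ E] {k : ℂ → E}
    (hk : AEStronglyMeasurable k circ) : ∫ ζ, k ζ ∂circ = Real.circleAverage k 0 1 := by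
  rw [circ, integral_map (continuous_circleMap 0 1).measurable.aemeasurable hk,
    integral_smul_measure, Real.circleAverage, intervalIntegral.integral_of_le (by positivity)]
  congr 1
  rw [ENNReal.toReal_inv, ENNReal.toReal_ofReal (by positivity)]

theorem integrable_circ_iff {E : Type*} [NormedAddCommGroup E] [NormedSpace ℝ E] {k : ℂ → E}
    (hk : AEStronglyMeasurable k circ) : Integrable k circ ↔ CircleIntegrable k 0 1 := by
  have h0 : (ENNReal.ofReal (2 * Real.pi))⁻¹ ≠ 0 := ENNReal.inv_ne_zero.2 ENNReal.ofReal_ne_top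
  have h1 : (ENNReal.ofReal (2 * Real.pi))⁻¹ ≠ ∞ := by simp [Real.pi_pos]
  have := integrable_map_measure hk (continuous_circleMap 0 1).measurable.aemeasurable
  rw [← circ] at this
  rw [this, integrable_smul_measure h0 h1, CircleIntegrable,
    intervalIntegrable_iff_integrableOn_Ioc_of_le (by positivity)]
  rfl

theorem integrable_circ_of_continuousOn {E : Type*} [NormedAddCommGroup E] [NormedSpace ℝ E]
    [SecondCountableTopology E]
    {k : ℂ → E} (hk : ContinuousOn k (sphere 0 1)) : Integrable k circ := by
  have hr : circ.restrict (sphere 0 1) = circ := Measure.restrict_eq_self_of_ae_mem circ_sphere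
  rw [← hr]
  exact hk.integrableOn_compact (isCompact_sphere 0 1)

theorem poissonKernel_zero {t ζ : ℂ} (hζ : ζ ∈ sphere (0:ℂ) 1) :
    poissonKernel 0 t ζ = (1 - ‖t‖ ^ 2) / ‖ζ - t‖ ^ 2 := by
  simp [poissonKernel_def, mem_sphere_zero_iff_norm.1 hζ]

theorem poissonKernel_le {t ζ : ℂ} (hζ : ζ ∈ sphere (0:ℂ) 1) (ht : t ∈ ball (0:ℂ) 1) :
    poissonKernel 0 t ζ ≤ (1 + ‖t‖) / (1 - ‖t‖) := by
  rw [poissonKernel_eq_re_herglotzRieszKernel]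
  simpa [herglotzRieszKernel_def] using re_herglotzRieszKernel_le hζ ht

theorem le_poissonKernel {t ζ : ℂ} (hζ : ζ ∈ sphere (0:ℂ) 1) (ht : t ∈ ball (0:ℂ) 1) :
    (1 - ‖t‖) / (1 + ‖t‖) ≤ poissonKernel 0 t ζ := by
  rw [poissonKernel_eq_re_herglotzRieszKernel]
  simpa [herglotzRieszKernel_def] using le_re_herglotzRieszKernel hζ ht

theorem poissonKernel_nonneg {t ζ : ℂ} (hζ : ζ ∈ sphere (0:ℂ) 1) (ht : t ∈ ball (0:ℂ) 1) :
    0 ≤ poissonKernel 0 t ζ := by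
  rw [mem_ball_zero_iff] at ht
  refine le_trans ?_ (le_poissonKernel hζ (by simpa using ht))
  have := norm_nonneg t
  apply div_nonneg <;> linarith

theorem measurable_poissonKernel (t : ℂ) : Measurable (poissonKernel 0 t) := by
  unfold poissonKernel
  fun_prop

/-- The Poisson integral on the unit disc. -/
def pint (k : ℂ → ℝ) (t : ℂ) : ℝ := ∫ ζ, poissonKernel 0 t ζ * k ζ ∂circ

theorem integrable_poissonKernel_mul {k : ℂ → ℝ} (hk : Integrable k circ) {t : ℂ}
    (ht : t ∈ ball (0:ℂ) 1) : Integrable (fun ζ => poissonKernel 0 t ζ * k ζ) circ := by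
  refine hk.bdd_mul (c := (1 + ‖t‖) / (1 - ‖t‖)) (measurable_poissonKernel t).aestronglyMeasurable ?_
  filter_upwards [circ_sphere] with ζ hζ
  rw [Real.norm_of_nonneg (poissonKernel_nonneg hζ ht)]
  exact poissonKernel_le hζ ht

theorem isHarmonicOn_pint {k : ℂ → ℝ} (hk : Integrable k circ) :
    IsHarmonicOn (pint k) (ball 0 1) := by
  have hci := (integrable_circ_iff hk.aestronglyMeasurable).1 hk
  have hcc : CircleIntegrable (fun ζ => (k ζ : ℂ)) 0 1 :=
    (integrable_circ_iff hk.ofReal.aestronglyMeasurable).1 hk.ofReal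
  refine (isHarmonicOn_re isOpen_ball
    (differentiableOn_circleAverage_herglotzRieszKernel_smul hcc)).congr fun t ht => ?_
  rw [re_circleAverage_herglotzRieszKernel_smul hci ht, pint,
    integral_circ (integrable_poissonKernel_mul hk ht).aestronglyMeasurable,
    poissonKernel_eq_re_herglotzRieszKernel]
  rfl

theorem pint_const (c : ℝ) {t : ℂ} (ht : t ∈ ball (0:ℂ) 1) : pint (fun _ => c) t = c := by
  have h : InnerProductSpace.HarmonicOnNhd (fun _ : ℂ => c) (closedBall (0:ℂ) 1) :=
    ((isHarmonicOn_const isOpen_univ c).harmonicOnNhd).mono (subset_univ _)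
  rw [pint, integral_circ (integrable_poissonKernel_mul (integrable_const c) ht).aestronglyMeasurable]
  exact h.circleAverage_poissonKernel_smul ht

theorem pint_mono {k l : ℂ → ℝ} (hk : Integrable k circ) (hl : Integrable l circ)
    (hkl : ∀ᵐ ζ ∂circ, k ζ ≤ l ζ) {t : ℂ} (ht : t ∈ ball (0:ℂ) 1) : pint k t ≤ pint l t := by
  refine integral_mono_ae (integrable_poissonKernel_mul hk ht) (integrable_poissonKernel_mul hl ht) ?_
  filter_upwards [hkl, circ_sphere] with ζ h hζ
  exact mul_le_mul_of_nonneg_left h (poissonKernel_nonneg hζ ht)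

theorem pint_sub {k l : ℂ → ℝ} (hk : Integrable k circ) (hl : Integrable l circ)
    {t : ℂ} (ht : t ∈ ball (0:ℂ) 1) : pint (fun ζ => k ζ - l ζ) t = pint k t - pint l t := by
  simp only [pint, mul_sub]
  exact integral_sub (integrable_poissonKernel_mul hk ht) (integrable_poissonKernel_mul hl ht)

theorem pint_add {k l : ℂ → ℝ} (hk : Integrable k circ) (hl : Integrable l circ)
    {t : ℂ} (ht : t ∈ ball (0:ℂ) 1) : pint (fun ζ => k ζ + l ζ) t = pint k t + pint l t := by
  simp only [pint, mul_add]
  exact integral_add (integrable_poissonKernel_mul hk ht) (integrable_poissonKernel_mul hl ht)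

theorem pint_const_mul (c : ℝ) (k : ℂ → ℝ) (t : ℂ) :
    pint (fun ζ => c * k ζ) t = c * pint k t := by
  simp only [pint, ← integral_const_mul]
  congr 1; ext ζ; ring

theorem pint_le {k : ℂ → ℝ} (hk : Integrable k circ) (h0 : ∀ᵐ ζ ∂circ, 0 ≤ k ζ) {t : ℂ}
    (ht : t ∈ ball (0:ℂ) 1) : pint k t ≤ (1 + ‖t‖) / (1 - ‖t‖) * ∫ ζ, k ζ ∂circ := by
  rw [← integral_const_mul]
  refine integral_mono_ae (integrable_poissonKernel_mul hk ht) (hk.const_mul _) ?_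
  filter_upwards [h0, circ_sphere] with ζ h hζ
  exact mul_le_mul_of_nonneg_right (poissonKernel_le hζ ht) h

theorem abs_pint_le {k : ℂ → ℝ} (hk : Integrable k circ) {t : ℂ}
    (ht : t ∈ ball (0:ℂ) 1) : |pint k t| ≤ pint (fun ζ => |k ζ|) t := by
  refine (abs_integral_le_integral_abs).trans (integral_mono_ae
    (integrable_poissonKernel_mul hk ht).abs (integrable_poissonKernel_mul hk.abs ht) ?_)
  filter_upwards [circ_sphere] with ζ hζ
  rw [abs_mul, abs_of_nonneg (poissonKernel_nonneg hζ ht)]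

/-- A function small on the circle near `ζ₀` has small Poisson integral near `ζ₀`. -/
theorem tendsto_pint {k : ℂ → ℝ} (hk : Integrable k circ) {ζ₀ : ℂ} (hζ₀ : ζ₀ ∈ sphere (0:ℂ) 1)
    (hc : ContinuousWithinAt k (sphere 0 1) ζ₀) :
    Tendsto (pint k) (𝓝[ball 0 1] ζ₀) (𝓝 (k ζ₀)) := by
  rw [Metric.tendsto_nhds]
  intro ε hε
  obtain ⟨δ, hδ, hkδ⟩ := Metric.continuousWithinAt_iff.1 hc (ε / 2) (by positivity)
  set I := ∫ ζ, |k ζ - k ζ₀| ∂circ with hI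
  have hki : Integrable (fun ζ => k ζ - k ζ₀) circ := hk.sub (integrable_const _)
  have hI0 : 0 ≤ I := integral_nonneg fun _ => abs_nonneg _
  have hnorm : ‖ζ₀‖ = 1 := by simpa using hζ₀
  have hlim : Tendsto (fun t : ℂ => ε / 2 + (1 - ‖t‖ ^ 2) * (4 / δ ^ 2) * I) (𝓝[ball 0 1] ζ₀)
      (𝓝 (ε / 2 + (1 - ‖ζ₀‖ ^ 2) * (4 / δ ^ 2) * I)) := by
    refine Tendsto.mono_left ?_ nhdsWithin_le_nhds
    exact Continuous.tendsto (by fun_prop) ζ₀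
  rw [hnorm] at hlim
  have hev := hlim.eventually (gt_mem_nhds (show ε / 2 + (1 - 1 ^ 2) * (4 / δ ^ 2) * I < ε by
    norm_num; exact hε))
  filter_upwards [hev, self_mem_nhdsWithin, mem_nhdsWithin_of_mem_nhds
    (ball_mem_nhds ζ₀ (half_pos hδ))] with t h1 ht htδ
  have ht1 : ‖t‖ < 1 := by simpa using ht
  have hnn : 0 ≤ 1 - ‖t‖ ^ 2 := by nlinarith [norm_nonneg t]
  refine lt_of_le_of_lt ?_ h1
  have e1 : pint k t - k ζ₀ = pint (fun ζ => k ζ - k ζ₀) t := by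
    rw [pint_sub hk (integrable_const _) ht, pint_const _ ht]
  rw [Real.dist_eq, e1]
  refine (abs_pint_le hki ht).trans ?_
  have e2 : pint (fun ζ => ε / 2 + (1 - ‖t‖ ^ 2) * (4 / δ ^ 2) * 0) t = ε / 2 := by
    rw [pint_const _ ht]; ring
  have hi2 : Integrable (fun ζ => poissonKernel 0 t ζ * (ε / 2) +
      (1 - ‖t‖ ^ 2) * (4 / δ ^ 2) * |k ζ - k ζ₀|) circ :=
    (integrable_poissonKernel_mul (integrable_const _) ht).add (hki.abs.const_mul _)
  have e3 : ∫ ζ, (poissonKernel 0 t ζ * (ε / 2) +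
      (1 - ‖t‖ ^ 2) * (4 / δ ^ 2) * |k ζ - k ζ₀|) ∂circ
      = ε / 2 + (1 - ‖t‖ ^ 2) * (4 / δ ^ 2) * I := by
    rw [integral_add (integrable_poissonKernel_mul (integrable_const _) ht)
      (hki.abs.const_mul _), integral_const_mul]
    congr 1
    exact pint_const _ ht
  rw [← e3]
  refine integral_mono_ae (integrable_poissonKernel_mul hki.abs ht) hi2 ?_
  filter_upwards [circ_sphere] with ζ hζ
  have hP := poissonKernel_nonneg hζ ht
  rcases lt_or_ge (dist ζ ζ₀) δ with h | h
  · have := (hkδ hζ h).le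
    rw [Real.dist_eq] at this
    have h3 : 0 ≤ (1 - ‖t‖ ^ 2) * (4 / δ ^ 2) * |k ζ - k ζ₀| := by positivity
    nlinarith [mul_le_mul_of_nonneg_left this hP]
  · have h4 : δ / 2 ≤ ‖ζ - t‖ := by
      have := dist_triangle ζ t ζ₀
      rw [mem_ball] at htδ
      rw [← dist_eq_norm]; linarith
    have h5 : poissonKernel 0 t ζ ≤ (1 - ‖t‖ ^ 2) * (4 / δ ^ 2) := by
      rw [poissonKernel_zero hζ, div_eq_mul_inv]
      refine mul_le_mul_of_nonneg_left ?_ hnn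
      have : 0 < ‖ζ - t‖ := by linarith
      rw [inv_eq_one_div, div_le_div_iff₀ (by positivity) (by positivity)]
      nlinarith
    have h6 := mul_le_mul_of_nonneg_right h5 (abs_nonneg (k ζ - k ζ₀))
    nlinarith [mul_nonneg hP hε.le]

/-- Solution of the Dirichlet problem on the unit disc. -/
def dirSol (k : ℂ → ℝ) (t : ℂ) : ℝ := open Classical in if t ∈ ball (0:ℂ) 1 then pint k t else k t

theorem dirSol_of_mem {k : ℂ → ℝ} {t : ℂ} (ht : t ∈ ball (0:ℂ) 1) : dirSol k t = pint k t :=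
  if_pos ht

theorem dirSol_of_notMem {k : ℂ → ℝ} {t : ℂ} (ht : t ∉ ball (0:ℂ) 1) : dirSol k t = k t :=
  if_neg ht

theorem isHarmonicOn_dirSol {k : ℂ → ℝ} (hk : Integrable k circ) :
    IsHarmonicOn (dirSol k) (ball 0 1) :=
  (isHarmonicOn_pint hk).congr fun _ ht => dirSol_of_mem ht

theorem continuousOn_dirSol {k : ℂ → ℝ} (hk : ContinuousOn k (sphere 0 1)) :
    ContinuousOn (dirSol k) (closedBall 0 1) := by
  have hki := integrable_circ_of_continuousOn hk
  intro t ht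
  by_cases htb : t ∈ ball (0:ℂ) 1
  · exact ((isHarmonicOn_dirSol hki).continuousOn.continuousAt
      (isOpen_ball.mem_nhds htb)).continuousWithinAt
  · have hts : t ∈ sphere (0:ℂ) 1 := by
      rw [← closedBall_sdiff_ball]; exact ⟨ht, htb⟩
    rw [← ball_union_sphere]
    refine ContinuousWithinAt.union ?_ ?_
    · rw [ContinuousWithinAt, dirSol_of_notMem htb]
      refine (tendsto_pint hki hts (hk t hts)).congr' ?_
      filter_upwards [self_mem_nhdsWithin] with s hs using (dirSol_of_mem hs).symm
    · refine (hk t hts).congr (fun s hs => dirSol_of_notMem ?_) (dirSol_of_notMem htb)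
      rw [← closedBall_sdiff_ball] at hs; exact hs.2

end

section

theorem IsHarmonicOn.comp {u : ℂ → ℝ} {U V : Set ℂ} {g : ℂ → ℂ} (hu : IsHarmonicOn u V)
    (hU : IsOpen U) (hg : DifferentiableOn ℂ g U) (hmaps : MapsTo g U V) :
    IsHarmonicOn (fun z => u (g z)) U := by
  intro z hz
  obtain ⟨r, hr, hb, f, hf, hu⟩ := hu (g z) (hmaps hz)
  have hopen : IsOpen (U ∩ g ⁻¹' ball (g z) r) := hg.continuousOn.isOpen_inter_preimage hU isOpen_ball
  obtain ⟨ε, hε, hball⟩ := Metric.isOpen_iff.1 hopen z ⟨hz, mem_ball_self hr⟩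
  exact ⟨ε, hε, hball.trans inter_subset_left, fun w => f (g w),
    hf.comp (hg.mono (hball.trans inter_subset_left)) (fun w hw => (hball hw).2),
    fun w hw => hu _ (hball hw).2⟩

theorem exists_closedBall_subset {U : Set ℂ} (hU : IsOpen U) {z : ℂ} (hz : z ∈ U) :
    ∃ R > 0, closedBall z R ⊆ U := by
  obtain ⟨ε, hε, hball⟩ := Metric.isOpen_iff.1 hU z hz
  exact ⟨ε / 2, by positivity, (closedBall_subset_ball (by linarith)).trans hball⟩

theorem circleIntegrable_of_closedBall {u : ℂ → ℝ} {U : Set ℂ} (hu : ContinuousOn u U) {z : ℂ}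
    {R r : ℝ} (hR : closedBall z R ⊆ U) (hr : 0 < r) (hrR : r ≤ R) : CircleIntegrable u z r :=
  (hu.mono fun _ hw => hR (closedBall_subset_closedBall hrR (sphere_subset_closedBall hw))).circleIntegrable hr.le

theorem SubMeanAt.add {u v : ℂ → ℝ} {U : Set ℂ} (hU : IsOpen U) {z : ℂ} (hz : z ∈ U)
    (hcu : ContinuousOn u U) (hcv : ContinuousOn v U) (hu : SubMeanAt u z) (hv : SubMeanAt v z) :
    SubMeanAt (fun w => u w + v w) z := by
  obtain ⟨ρ, hρ, hu⟩ := hu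
  obtain ⟨ρ', hρ', hv⟩ := hv
  obtain ⟨R, hR, hb⟩ := exists_closedBall_subset hU hz
  refine ⟨min R (min ρ ρ'), by positivity, fun r hr h => ?_⟩
  have h1 : r < R := h.trans_le (min_le_left _ _)
  have h2 : r < ρ := h.trans_le ((min_le_right _ _).trans (min_le_left _ _))
  have h3 : r < ρ' := h.trans_le ((min_le_right _ _).trans (min_le_right _ _))
  have := Real.circleAverage_add (circleIntegrable_of_closedBall hcu hb hr h1.le)
    (circleIntegrable_of_closedBall hcv hb hr h1.le)
  have e : (fun w => u w + v w) = u + v := rfl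
  rw [e, this]
  exact add_le_add (hu r hr h2) (hv r hr h3)

theorem SubMeanAt.sub_harmonic {u v : ℂ → ℝ} {U : Set ℂ} (hU : IsOpen U) {z : ℂ} (hz : z ∈ U)
    (hcu : ContinuousOn u U) (hu : SubMeanAt u z) (hv : IsHarmonicOn v U) :
    SubMeanAt (fun w => u w - v w) z := by
  simpa only [sub_eq_add_neg] using
    hu.add hU hz hcu hv.neg.continuousOn (hv.neg.subMeanAt hU hz)

theorem SubMeanAt.congr {u v : ℂ → ℝ} {U : Set ℂ} (hU : IsOpen U) {z : ℂ} (hz : z ∈ U)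
    (huv : ∀ w ∈ U, v w = u w) (hu : SubMeanAt u z) : SubMeanAt v z := by
  obtain ⟨ρ, hρ, hu⟩ := hu
  obtain ⟨R, hR, hb⟩ := exists_closedBall_subset hU hz
  refine ⟨min R ρ, by positivity, fun r hr h => ?_⟩
  have h1 : r < R := h.trans_le (min_le_left _ _)
  have h2 : r < ρ := h.trans_le (min_le_right _ _)
  rw [huv z hz, Real.circleAverage_congr_sphere (f₂ := u)]
  · exact hu r hr h2
  · intro w hw
    rw [abs_of_pos hr] at hw
    exact huv w (hb (closedBall_subset_closedBall h1.le (sphere_subset_closedBall hw)))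

/-- Comparison with a harmonic function on a compact set. -/
theorem le_of_subMean_of_harmonic {K U : Set ℂ} (hK : IsCompact K) (hU : IsOpen U) (hUK : U ⊆ K)
    {u v : ℂ → ℝ} (hu : ContinuousOn u K) (hsub : ∀ z ∈ U, SubMeanAt u z)
    (hv : ContinuousOn v K) (hvh : IsHarmonicOn v U) (hle : ∀ z ∈ K \ U, u z ≤ v z) :
    ∀ z ∈ K, u z ≤ v z := by
  intro z hz
  have := le_of_le_diff hK hU hUK (hu.sub hv)
    (fun w hw => (hsub w hw).sub_harmonic hU hw (hu.mono hUK) hvh) (m := 0)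
    (fun w hw => sub_nonpos.2 (hle w hw)) z hz
  exact sub_nonpos.1 this

/-- Dirichlet problem on a disc. -/
theorem exists_dirichlet_ball {c : ℂ} {R : ℝ} (hR : 0 < R) {k : ℂ → ℝ}
    (hk : ContinuousOn k (sphere c R)) : ∃ v : ℂ → ℝ, ContinuousOn v (closedBall c R) ∧
      IsHarmonicOn v (ball c R) ∧ ∀ z ∈ sphere c R, v z = k z := by
  have hRc : (R : ℂ) ≠ 0 := by exact_mod_cast hR.ne'
  have hmap : ∀ z, ‖(z - c) / R‖ = dist z c / R := fun z => by
    rw [norm_div, dist_eq_norm, Complex.norm_real, Real.norm_of_nonneg hR.le]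
  have hk' : ContinuousOn (fun t : ℂ => k (c + R * t)) (sphere 0 1) := by
    refine hk.comp (by fun_prop) fun t ht => ?_
    have : ‖t‖ = 1 := by simpa using ht
    simp [this, abs_of_pos hR]
  have hcont := continuousOn_dirSol hk'
  have hharm := isHarmonicOn_dirSol (integrable_circ_of_continuousOn hk')
  refine ⟨fun z => dirSol (fun t : ℂ => k (c + R * t)) ((z - c) / R), ?_, ?_, ?_⟩
  · refine hcont.comp (by fun_prop) fun z hz => ?_
    rw [mem_closedBall_zero_iff, hmap]
    exact div_le_one_of_le₀ hz hR.le
  · refine hharm.comp isOpen_ball (by fun_prop) fun z hz => ?_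
    rw [mem_ball_zero_iff, hmap]
    exact (div_lt_one hR).2 hz
  · intro z hz
    have : (z - c) / R ∉ ball (0:ℂ) 1 := by
      rw [mem_ball_zero_iff, hmap, mem_sphere.1 hz, div_self hR.ne']; simp
    change dirSol (fun t : ℂ => k (c + R * t)) ((z - c) / R) = k z
    rw [dirSol_of_notMem this]
    congr 1
    field_simp
    ring

/-- Local mean value property at a point. -/
def MeanAt (u : ℂ → ℝ) (z : ℂ) : Prop :=
  ∃ ρ > 0, ∀ r, 0 < r → r < ρ → Real.circleAverage u z r = u z

theorem MeanAt.subMeanAt {u : ℂ → ℝ} {z : ℂ} (h : MeanAt u z) : SubMeanAt u z :=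
  ⟨h.choose, h.choose_spec.1, fun r hr hr' => (h.choose_spec.2 r hr hr').ge⟩

theorem MeanAt.neg {u : ℂ → ℝ} {z : ℂ} (h : MeanAt u z) : MeanAt (fun w => -u w) z := by
  obtain ⟨ρ, hρ, h⟩ := h
  refine ⟨ρ, hρ, fun r hr hr' => ?_⟩
  have := Real.circleAverage_fun_smul (a := (-1:ℝ)) (f := u) (c := z) (R := r)
  simpa [h r hr hr'] using this

/-- A continuous function with the mean value property is harmonic. -/
theorem isHarmonicOn_of_meanAt {u : ℂ → ℝ} {U : Set ℂ} (hU : IsOpen U) (hc : ContinuousOn u U)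
    (hm : ∀ z ∈ U, MeanAt u z) : IsHarmonicOn u U := by
  intro z hz
  obtain ⟨R, hR, hb⟩ := exists_closedBall_subset hU hz
  obtain ⟨v, hvc, hvh, hv⟩ := exists_dirichlet_ball hR
    (hc.mono (sphere_subset_closedBall.trans hb))
  have hs : ∀ w ∈ closedBall z R \ ball z R, v w = u w := fun w hw => by
    rw [closedBall_sdiff_ball] at hw; exact hv w hw
  have h1 := le_of_subMean_of_harmonic (isCompact_closedBall z R) isOpen_ball
    ball_subset_closedBall (hc.mono hb)
    (fun w hw => (hm w (hb (ball_subset_closedBall hw))).subMeanAt) hvc hvh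
    (fun w hw => (hs w hw).ge)
  have h2 := le_of_subMean_of_harmonic (isCompact_closedBall z R) isOpen_ball
    ball_subset_closedBall (hc.mono hb).neg
    (fun w hw => (hm w (hb (ball_subset_closedBall hw))).neg.subMeanAt) hvc.neg hvh.neg
    (fun w hw => neg_le_neg (hs w hw).le)
  have : IsHarmonicOn u (ball z R) := hvh.congr fun w hw => by
    have a := h1 w (ball_subset_closedBall hw)
    have b := h2 w (ball_subset_closedBall hw)
    exact le_antisymm a (neg_le_neg_iff.1 b)
  obtain ⟨g, hg, h⟩ := this.exists_ball
  exact ⟨R, hR, ball_subset_closedBall.trans hb, g, hg, h⟩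

/-- Locally uniform limits of harmonic functions are harmonic. -/
theorem isHarmonicOn_of_approx {u : ℂ → ℝ} {U : Set ℂ} (hU : IsOpen U)
    (h : ∀ K ⊆ U, IsCompact K → ∀ ε > 0, ∃ v, IsHarmonicOn v U ∧ ∀ z ∈ K, |u z - v z| ≤ ε) :
    IsHarmonicOn u U := by
  have hcK : ∀ K ⊆ U, IsCompact K → ContinuousOn u K := by
    intro K hKU hK
    refine continuousOn_of_uniform_approx_of_continuousOn fun V hV => ?_
    obtain ⟨ε, hε, hεV⟩ := Metric.mem_uniformity_dist.1 hV
    obtain ⟨v, hv, hvu⟩ := h K hKU hK (ε / 2) (by positivity)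
    refine ⟨v, hv.continuousOn.mono hKU, fun z hz => hεV ?_⟩
    rw [Real.dist_eq]
    linarith [hvu z hz]
  have hc : ContinuousOn u U := fun z hz => by
    obtain ⟨R, hR, hb⟩ := exists_closedBall_subset hU hz
    exact ((hcK _ hb (isCompact_closedBall z R)).continuousAt
      (closedBall_mem_nhds z hR)).continuousWithinAt
  refine isHarmonicOn_of_meanAt hU hc fun z hz => ?_
  obtain ⟨R, hR, hb⟩ := exists_closedBall_subset hU hz
  refine ⟨R, hR, fun r hr hrR => ?_⟩
  have hb' : closedBall z r ⊆ U := (closedBall_subset_closedBall hrR.le).trans hb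
  refine eq_of_abs_sub_le_all fun ε hε => ?_
  obtain ⟨v, hv, hvu⟩ := h _ hb' (isCompact_closedBall z r) (ε / 2) (by positivity)
  have h1 : |Real.circleAverage (u - v) z r| ≤ ε / 2 := by
    have hcs := (circleIntegrable_of_closedBall hc hb hr hrR.le).sub
      (circleIntegrable_of_closedBall hv.continuousOn hb hr hrR.le)
    refine Real.abs_circleAverage_le_circleAverage_abs.trans
      (Real.circleAverage_mono_on_of_le_circle hcs.abs ?_)
    intro w hw
    rw [abs_of_pos hr] at hw
    exact hvu w (sphere_subset_closedBall hw)
  rw [Real.circleAverage_sub (circleIntegrable_of_closedBall hc hb hr hrR.le)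
    (circleIntegrable_of_closedBall hv.continuousOn hb hr hrR.le),
    hv.circleAverage_eq hr hb'] at h1
  have h2 := hvu z (mem_closedBall_self hr.le)
  rw [abs_le] at *
  constructor <;> linarith [h1.1, h1.2, h2.1, h2.2]

/-- Local Harnack inequality. -/
theorem harnack_ball {u : ℂ → ℝ} {z : ℂ} {R : ℝ} (hu : IsHarmonicOn u (ball z R))
    (h0 : ∀ w ∈ ball z R, 0 ≤ u w) {w : ℂ} (hw : w ∈ ball z (R / 4)) :
    u w ≤ 3 * u z ∧ u z ≤ 3 * u w := by
  have hR : 0 < R := by have := pos_of_mem_ball hw; linarith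
  have hsub : closedBall z (R / 2) ⊆ ball z R := closedBall_subset_ball (by linarith)
  have hwb : w ∈ ball z (R / 2) := ball_subset_ball (by linarith) hw
  have hwn : ‖w - z‖ < R / 4 := by rwa [← dist_eq_norm]
  have hP := (hu.harmonicOnNhd.mono hsub).circleAverage_re_herglotzRieszKernel_smul hwb
  have hM : Real.circleAverage u z (R / 2) = u z := hu.circleAverage_eq (by positivity) hsub
  have hci : CircleIntegrable u z (R / 2) :=
    circleIntegrable_of_closedBall hu.continuousOn hsub (by positivity) le_rfl
  have hker : ContinuousOn (fun ζ => (herglotzRieszKernel z w ζ).re * u ζ) (sphere z (R / 2)) := by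
    refine ContinuousOn.mul ?_ (hu.continuousOn.mono (sphere_subset_closedBall.trans hsub))
    refine Complex.continuous_re.comp_continuousOn ?_
    rw [herglotzRieszKernel_fun_def]
    refine ContinuousOn.div (by fun_prop) (by fun_prop) fun ζ hζ h => ?_
    have : ζ = w := by linear_combination h
    rw [this, mem_sphere] at hζ
    rw [mem_ball] at hwb
    linarith
  have hki : CircleIntegrable (fun ζ => (herglotzRieszKernel z w ζ).re * u ζ) z (R / 2) :=
    hker.circleIntegrable (by positivity)
  have e : ((re ∘ herglotzRieszKernel z w) • u) = fun ζ => (herglotzRieszKernel z w ζ).re * u ζ := rfl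
  rw [e] at hP
  have hnn := norm_nonneg (w - z)
  have hup : ∀ ζ ∈ sphere z |R / 2|, (herglotzRieszKernel z w ζ).re * u ζ ≤ 3 * u ζ := by
    intro ζ hζ
    rw [abs_of_pos (by positivity)] at hζ
    have h2 := h0 ζ (hsub (sphere_subset_closedBall hζ))
    have h1 := re_herglotzRieszKernel_le hζ hwb
    refine mul_le_mul_of_nonneg_right (h1.trans ?_) h2
    rw [div_le_iff₀ (by linarith)]; linarith
  have hlo : ∀ ζ ∈ sphere z |R / 2|, u ζ ≤ 3 * ((herglotzRieszKernel z w ζ).re * u ζ) := by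
    intro ζ hζ
    rw [abs_of_pos (by positivity)] at hζ
    have h2 := h0 ζ (hsub (sphere_subset_closedBall hζ))
    have h1 := le_re_herglotzRieszKernel hζ hwb
    have h3 : 1 / 3 ≤ (herglotzRieszKernel z w ζ).re := by
      refine le_trans ?_ h1
      rw [le_div_iff₀ (by linarith)]; linarith
    nlinarith
  constructor
  · have := Real.circleAverage_mono hki (hci.const_smul (a := (3:ℝ))) hup
    have e3 := Real.circleAverage_fun_smul (a := (3:ℝ)) (f := u) (c := z) (R := R / 2)
    simp only [smul_eq_mul] at e3
    rw [hP] at this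
    calc u w ≤ _ := this
      _ = 3 * u z := by rw [← hM]; exact e3
  · have := Real.circleAverage_mono hci (hki.const_smul (a := (3:ℝ))) hlo
    have e3 := Real.circleAverage_fun_smul (a := (3:ℝ))
      (f := fun ζ => (herglotzRieszKernel z w ζ).re * u ζ) (c := z) (R := R / 2)
    simp only [smul_eq_mul] at e3
    rw [hM] at this
    calc u z ≤ _ := this
      _ = 3 * u w := by rw [← hP]; exact e3

/-- Harnack's inequality on compact subsets of a connected open set. -/
theorem harnack {U : Set ℂ} (hU : IsOpen U) (hconn : IsPreconnected U) {K : Set ℂ} (hKU : K ⊆ U)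
    (hK : IsCompact K) {w : ℂ} (hw : w ∈ U) : ∃ C : ℝ, 0 < C ∧ ∀ u : ℂ → ℝ, IsHarmonicOn u U →
      (∀ z ∈ U, 0 ≤ u z) → ∀ z ∈ K, u z ≤ C * u w := by
  have hloc : ∀ z ∈ U, ∃ ε > 0, ball z ε ⊆ U ∧ ∀ u : ℂ → ℝ, IsHarmonicOn u U →
      (∀ z ∈ U, 0 ≤ u z) → ∀ y ∈ ball z ε, u y ≤ 3 * u z ∧ u z ≤ 3 * u y := by
    intro z hz
    obtain ⟨R, hR, hb⟩ := Metric.isOpen_iff.1 hU z hz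
    exact ⟨R / 4, by positivity, (ball_subset_ball (by linarith)).trans hb, fun u hu h0 y hy =>
      harnack_ball (hu.mono isOpen_ball hb) (fun x hx => h0 x (hb hx)) hy⟩
  set S : Set ℂ := {z | z ∈ U ∧ ∃ C : ℝ, 0 < C ∧ ∀ u : ℂ → ℝ, IsHarmonicOn u U →
      (∀ z ∈ U, 0 ≤ u z) → u z ≤ C * u w} with hS
  have hSU : ∀ z ∈ U, z ∈ S := by
    have h1 : IsOpen S := by
      rw [Metric.isOpen_iff]
      rintro z ⟨hz, C, hC, h⟩
      obtain ⟨ε, hε, hb, hl⟩ := hloc z hz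
      exact ⟨ε, hε, fun y hy => ⟨hb hy, 3 * C, by positivity, fun u hu h0 => by
        have := (hl u hu h0 y hy).1
        have := h u hu h0
        linarith⟩⟩
    have h2 : IsOpen (U \ S) := by
      rw [Metric.isOpen_iff]
      rintro z ⟨hz, hzS⟩
      obtain ⟨ε, hε, hb, hl⟩ := hloc z hz
      refine ⟨ε, hε, fun y hy => ⟨hb hy, fun hyS => hzS ⟨hz, ?_⟩⟩⟩
      obtain ⟨-, C, hC, h⟩ := hyS
      exact ⟨3 * C, by positivity, fun u hu h0 => by
        have := (hl u hu h0 y hy).2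
        have := h u hu h0
        linarith⟩
    intro z hz
    by_contra hzS
    obtain ⟨x, -, hx1, hx2⟩ := hconn S (U \ S) h1 h2 (fun y hy => by
      by_cases hyS : y ∈ S
      · exact Or.inl hyS
      · exact Or.inr ⟨hy, hyS⟩) ⟨w, hw, hw, 1, one_pos, fun u _ _ => by simp⟩ ⟨z, hz, hz, hzS⟩
    exact hx2.2 hx1
  refine hK.induction_on (p := fun K => ∃ C : ℝ, 0 < C ∧ ∀ u : ℂ → ℝ, IsHarmonicOn u U →
      (∀ z ∈ U, 0 ≤ u z) → ∀ z ∈ K, u z ≤ C * u w) ⟨1, one_pos, by simp⟩ ?_ ?_ ?_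
  · rintro s t hst ⟨C, hC, h⟩
    exact ⟨C, hC, fun u hu h0 z hz => h u hu h0 z (hst hz)⟩
  · rintro s t ⟨C, hC, h⟩ ⟨C', hC', h'⟩
    refine ⟨C + C', by positivity, fun u hu h0 z hz => ?_⟩
    have hpos := h0 w hw
    rcases hz with hz | hz
    · nlinarith [h u hu h0 z hz]
    · nlinarith [h' u hu h0 z hz]
  · intro z hz
    obtain ⟨-, C, hC, h⟩ := hSU z (hKU hz)
    obtain ⟨ε, hε, hb, hl⟩ := hloc z (hKU hz)
    refine ⟨ball z ε, mem_nhdsWithin_of_mem_nhds (ball_mem_nhds z hε), 3 * C, by positivity,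
      fun u hu h0 y hy => ?_⟩
    have := (hl u hu h0 y hy).1
    have := h u hu h0
    linarith

end

section

theorem isHarmonicOn_of_harmonicOnNhd {u : ℂ → ℝ} {U : Set ℂ} (hU : IsOpen U)
    (hu : InnerProductSpace.HarmonicOnNhd u U) : IsHarmonicOn u U := by
  intro z hz
  obtain ⟨ε, hε, hb⟩ := Metric.isOpen_iff.1 hU z hz
  obtain ⟨g, hg, h⟩ := (hu.mono hb).exists_analyticOnNhd_ball_re_eq
  exact ⟨ε, hε, hb, g, hg.differentiableOn, fun w hw => (h hw).symm⟩

theorem isHarmonicOn_log_norm {g : ℂ → ℂ} {U : Set ℂ} (hU : IsOpen U)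
    (hg : DifferentiableOn ℂ g U) (h0 : ∀ z ∈ U, g z ≠ 0) :
    IsHarmonicOn (fun z => Real.log ‖g z‖) U :=
  isHarmonicOn_of_harmonicOnNhd hU fun z hz =>
    (hg.analyticAt (hU.mem_nhds hz)).harmonicAt_log_norm (h0 z hz)

/-- Open annulus centred at the origin. -/
def annulus (r R : ℝ) : Set ℂ := {t | r < ‖t‖ ∧ ‖t‖ < R}

/-- Closed annulus centred at the origin. -/
def cannulus (r R : ℝ) : Set ℂ := {t | r ≤ ‖t‖ ∧ ‖t‖ ≤ R}

theorem isOpen_annulus (r R : ℝ) : IsOpen (annulus r R) :=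
  (isOpen_lt continuous_const continuous_norm).inter (isOpen_lt continuous_norm continuous_const)

theorem isCompact_cannulus (r R : ℝ) : IsCompact (cannulus r R) := by
  refine (isCompact_closedBall (0:ℂ) R).of_isClosed_subset
    ((isClosed_le continuous_const continuous_norm).inter
      (isClosed_le continuous_norm continuous_const)) fun t ht => ?_
  simpa using ht.2

theorem annulus_subset_cannulus (r R : ℝ) : annulus r R ⊆ cannulus r R :=
  fun _ h => ⟨h.1.le, h.2.le⟩

theorem mem_cannulus_diff {r R : ℝ} {t : ℂ} (h : t ∈ cannulus r R \ annulus r R) :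
    ‖t‖ = r ∨ ‖t‖ = R := by
  by_contra hcon
  push Not at hcon
  exact h.2 ⟨lt_of_le_of_ne h.1.1 (Ne.symm hcon.1), lt_of_le_of_ne h.1.2 hcon.2⟩

theorem log_div_log_nonneg {r R s : ℝ} (hr : 0 < r) (hrs : r ≤ s) (hsR : s ≤ R) :
    0 ≤ Real.log (s / R) / Real.log (r / R) := by
  have hs : 0 < s := by linarith
  have hR : 0 < R := by linarith
  refine div_nonneg_of_nonpos (Real.log_nonpos (by positivity) (div_le_one_of_le₀ hsR hR.le))
    (Real.log_nonpos (by positivity) (div_le_one_of_le₀ (hrs.trans hsR) hR.le))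

/-- Two-constants bound on an annulus. -/
theorem annulus_le {r R M : ℝ} (hr : 0 < r) (hrR : r < R) {v : ℂ → ℝ}
    (hc : ContinuousOn v (cannulus r R)) (hs : ∀ t ∈ annulus r R, SubMeanAt v t)
    (hR : ∀ t, ‖t‖ = R → v t ≤ 0) (hM : ∀ t, ‖t‖ = r → v t ≤ M) :
    ∀ t ∈ cannulus r R, v t ≤ M * (Real.log (‖t‖ / R) / Real.log (r / R)) := by
  have hR0 : 0 < R := hr.trans hrR
  have hlog : Real.log (r / R) < 0 := Real.log_neg (by positivity) ((div_lt_one hR0).2 hrR)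
  have hpos : ∀ t ∈ cannulus r R, (t / (R:ℂ)) ≠ 0 := fun t ht => by
    have : t ≠ 0 := norm_pos_iff.1 (hr.trans_le ht.1)
    have hR' : (R:ℂ) ≠ 0 := by exact_mod_cast hR0.ne'
    exact div_ne_zero this hR'
  have e : ∀ t : ℂ, ‖t / (R:ℂ)‖ = ‖t‖ / R := fun t => by simp [abs_of_pos hR0]
  have hh : IsHarmonicOn (fun t : ℂ => M * (Real.log (‖t‖ / R) / Real.log (r / R)))
      (annulus r R) := by
    refine ((isHarmonicOn_log_norm (g := fun t => t / (R:ℂ)) (isOpen_annulus r R) (by fun_prop)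
      fun t ht => hpos t (annulus_subset_cannulus _ _ ht)).const_mul
        (M / Real.log (r / R))).congr fun t _ => ?_
    rw [e]; ring
  refine le_of_subMean_of_harmonic (isCompact_cannulus r R) (isOpen_annulus r R)
    (annulus_subset_cannulus r R) hc hs ?_ hh ?_
  · refine ContinuousOn.mul continuousOn_const (ContinuousOn.div_const ?_ _)
    refine ContinuousOn.log (by fun_prop) fun t ht => ?_
    rw [← e]; exact norm_ne_zero_iff.2 (hpos t ht)
  · intro t ht
    rcases mem_cannulus_diff ht with h | h
    · rw [h, div_self hlog.ne, mul_one]; exact hM t h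
    · rw [h, div_self hR0.ne', Real.log_one]; simpa using hR t h

theorem circleAverage_zero_norm (v : ℂ → ℝ) (t : ℂ) :
    Real.circleAverage v 0 ‖t‖ =
      (2 * Real.pi)⁻¹ * ∫ θ in (0:ℝ)..2 * Real.pi, v (t * exp (θ * I)) := by
  rw [Real.circleAverage_eq_integral_add (arg t), smul_eq_mul]
  congr 2
  ext θ
  congr 1
  conv_rhs => rw [← norm_mul_exp_arg_mul_I t]
  rw [circleMap, mul_assoc, ← Complex.exp_add]
  push_cast
  ring_nf

/-- The circular mean of a harmonic function on an annulus is harmonic. -/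
theorem isHarmonicOn_circularMean {r R : ℝ} (hr : 0 < r) {v : ℂ → ℝ}
    (hv : IsHarmonicOn v (annulus r R)) :
    IsHarmonicOn (fun t => Real.circleAverage v 0 ‖t‖) (annulus r R) := by
  have hA := isOpen_annulus r R
  have hrot : ∀ (θ : ℝ), ∀ t ∈ annulus r R, t * exp (θ * I) ∈ annulus r R := fun θ t ht => by
    simpa [annulus, norm_exp_ofReal_mul_I] using ht
  refine isHarmonicOn_of_meanAt hA ?_ fun z hz => ?_
  · have h1 : ContinuousOn (Real.circleAverage v 0) (Ioo r R) := by
      refine Real.ContinuousOn.circleAverage (by simpa [annulus] using hv.continuousOn) ?_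
      intro s hs; linarith [hs.1]
    exact h1.comp continuous_norm.continuousOn fun t ht => ht
  · obtain ⟨ρ, hρ, hb⟩ := exists_closedBall_subset hA hz
    refine ⟨ρ, hρ, fun s hs hsρ => ?_⟩
    have hb' : closedBall z s ⊆ annulus r R := (closedBall_subset_closedBall hsρ.le).trans hb
    simp only [circleAverage_zero_norm]
    rw [Real.circleAverage, smul_eq_mul, intervalIntegral.integral_const_mul,
      intervalIntegral_intervalIntegral_swap]
    · congr 1
      rw [← intervalIntegral.integral_const_mul]
      congr 1
      ext θ
      have := (hv.comp (g := fun t => t * exp (θ * I)) hA (by fun_prop) (hrot θ)).circleAverage_eq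
        hs hb'
      rw [Real.circleAverage, smul_eq_mul] at this
      exact this
    · have hcont : Continuous (Function.uncurry fun φ θ : ℝ => v (circleMap z s φ * exp (θ * I))) := by
        refine hv.continuousOn.comp_continuous (by fun_prop) fun p => hrot _ _ (hb' ?_)
        exact sphere_subset_closedBall (circleMap_mem_sphere z hs.le _)
      exact (hcont.continuousOn.integrableOn_compact
        (isCompact_uIcc.prod isCompact_uIcc)).mono_set (prod_mono uIoc_subset_uIcc uIoc_subset_uIcc)

/-- Circular means of a nonnegative harmonic function control the means over larger circles. -/
theorem circleAverage_outer_le {r s R : ℝ} (hr : 0 < r) (hrs : r < s) (hsR : s < R) {v : ℂ → ℝ}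
    (hv : IsHarmonicOn v (annulus r R)) (hc : ContinuousOn v (cannulus r R))
    (h0 : ∀ t, ‖t‖ = r → 0 ≤ v t) :
    (1 - Real.log (s / R) / Real.log (r / R)) * Real.circleAverage v 0 R ≤
      Real.circleAverage v 0 s := by
  have hh := isHarmonicOn_circularMean hr hv
  have hcm : ContinuousOn (fun t : ℂ => Real.circleAverage v 0 ‖t‖) (cannulus r R) := by
    have h1 : ContinuousOn (Real.circleAverage v 0) (Icc r R) := by
      refine Real.ContinuousOn.circleAverage (by simpa [cannulus] using hc) ?_
      intro s hs; linarith [hs.1]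
    exact h1.comp continuous_norm.continuousOn fun t ht => ht
  have hr0 : 0 ≤ Real.circleAverage v 0 r := Real.circleAverage_nonneg_of_nonneg (fun t ht => by
    rw [abs_of_pos hr] at ht; exact h0 t (by simpa using ht))
  have := annulus_le (M := Real.circleAverage v 0 R) hr (hrs.trans hsR)
    (v := fun t : ℂ => Real.circleAverage v 0 R - Real.circleAverage v 0 ‖t‖)
    (continuousOn_const.sub hcm)
    (fun t ht => ((isHarmonicOn_const (isOpen_annulus r R) _).sub hh).subMeanAt
      (isOpen_annulus r R) ht) (fun t ht => by simp [ht]) (fun t ht => by simp [ht, hr0]) (s : ℂ)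
      (by simp [cannulus, abs_of_pos (hr.trans hrs), hrs.le, hsR.le])
  simp only [Complex.norm_real, Real.norm_of_nonneg (hr.trans hrs).le] at this
  linarith

end

section

theorem ae_circ_of_ae {p : ℂ → Prop} (h : ∀ᵐ θ : ℝ, p (circleMap 0 1 θ)) : ∀ᵐ ζ ∂circ, p ζ := by
  set N := toMeasurable volume {θ : ℝ | ¬ p (circleMap 0 1 θ)} with hN
  have hN0 : volume N = 0 := by rw [hN, measure_toMeasurable]; exact h
  have hNm : MeasurableSet N := measurableSet_toMeasurable _ _
  have hinj : InjOn (circleMap 0 1) (Ioc 0 (2 * Real.pi)) := by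
    have := injOn_circleMap_of_abs_sub_le (a := 0) (b := 2 * Real.pi) (c := 0) one_ne_zero
      (by simp [abs_of_pos Real.pi_pos])
    rwa [uIoc_of_le (by positivity)] at this
  set S := circleMap 0 1 '' (N ∩ Ioc 0 (2 * Real.pi)) with hS
  have hSm : MeasurableSet S := (hNm.inter measurableSet_Ioc).image_of_measurable_injOn
    (continuous_circleMap 0 1).measurable (hinj.mono inter_subset_right)
  have hS0 : circ S = 0 := by
    rw [circ, Measure.map_apply (continuous_circleMap 0 1).measurable hSm, Measure.smul_apply,
      Measure.restrict_apply ((continuous_circleMap 0 1).measurable hSm)]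
    have : circleMap 0 1 ⁻¹' S ∩ Ioc 0 (2 * Real.pi) ⊆ N := by
      rintro θ ⟨⟨φ, ⟨hφN, hφ⟩, he⟩, hθ⟩
      rwa [← hinj hφ hθ he]
    rw [measure_mono_null this hN0, smul_zero]
  have hnot : ∀ᵐ ζ ∂circ, ζ ∉ S := measure_eq_zero_iff_ae_notMem.1 hS0
  filter_upwards [hnot, circ_sphere] with ζ hζS hζ
  by_contra hp
  refine hζS ?_
  have hr := range_circleMap 0 1
  have h2 : ζ ∈ circleMap 0 1 '' Ioc 0 (2 * Real.pi) := by
    rw [image_circleMap_Ioc, abs_one]; exact hζ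
  obtain ⟨θ, hθ, rfl⟩ := h2
  exact ⟨θ, ⟨subset_toMeasurable _ _ hp, hθ⟩, rfl⟩

theorem norm_circleMap_sub_ge {θ θ₀ : ℝ} (h : |θ - θ₀| ≤ Real.pi) :
    2 / Real.pi * |θ - θ₀| ≤ ‖circleMap 0 1 θ - circleMap 0 1 θ₀‖ := by
  have e : circleMap 0 1 θ - circleMap 0 1 θ₀ =
      exp (θ₀ * I) * (exp (I * ((θ - θ₀ : ℝ) : ℂ)) - 1) := by
    rw [mul_sub, ← Complex.exp_add]
    simp only [circleMap, ofReal_one, one_mul, zero_add]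
    push_cast
    ring_nf
  rw [e, norm_mul, norm_exp_ofReal_mul_I, one_mul, norm_exp_I_mul_ofReal_sub_one, norm_mul,
    Real.norm_eq_abs, Real.norm_eq_abs, abs_two]
  have := Real.mul_abs_le_abs_sin (x := (θ - θ₀) / 2) (by
    rw [abs_div, abs_two]; linarith)
  rw [abs_div, abs_two] at this
  linarith

/-- The Fejér-type kernel dominating the Poisson kernel in a Stolz angle. -/
def stolzKer (δ x : ℝ) : ℝ := δ / (max δ |x|) ^ 2

theorem stolzKer_nonneg {δ : ℝ} (hδ : 0 < δ) (x : ℝ) : 0 ≤ stolzKer δ x := by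
  unfold stolzKer; positivity

theorem stolzKer_le {δ s x : ℝ} (hδ : 0 < δ) (hs : 0 < s) (hx : s ≤ max δ |x|) :
    stolzKer δ x ≤ δ / s ^ 2 := by
  unfold stolzKer
  gcongr

theorem continuous_stolzKer {δ : ℝ} (hδ : 0 < δ) : Continuous (stolzKer δ) := by
  unfold stolzKer
  refine Continuous.div (by fun_prop) (by fun_prop) fun x => ?_
  have : 0 < max δ |x| := lt_max_of_lt_left hδ
  positivity

theorem integrableOn_stolzKer_mul {q : ℝ → ℝ} (hq : LocallyIntegrable q) {δ : ℝ} (hδ : 0 < δ)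
    (θ₀ s : ℝ) : IntegrableOn (fun θ => stolzKer δ (θ - θ₀) * q θ) (closedBall θ₀ s) := by
  refine (hq.integrableOn_isCompact (isCompact_closedBall θ₀ s)).bdd_mul (c := δ / δ ^ 2)
    ((continuous_stolzKer hδ).comp (by fun_prop)).aestronglyMeasurable ?_
  refine Eventually.of_forall fun θ => ?_
  rw [Real.norm_of_nonneg (stolzKer_nonneg hδ _)]
  exact stolzKer_le hδ hδ (le_max_left _ _)

theorem integral_stolzKer_dyadic {q : ℝ → ℝ} (hq : LocallyIntegrable q) (hq0 : ∀ θ, 0 ≤ q θ)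
    {δ ε η θ₀ : ℝ} (hδ : 0 < δ)
    (hav : ∀ s, 0 < s → s ≤ η → ∫ θ in closedBall θ₀ s, q θ ≤ ε * s) (N : ℕ)
    (hN : 2 ^ N * δ ≤ η) :
    ∫ θ in closedBall θ₀ (2 ^ N * δ), stolzKer δ (θ - θ₀) * q θ ≤ ε * (5 - 4 / 2 ^ N) := by
  induction N with
  | zero =>
    simp only [pow_zero, one_mul] at hN ⊢
    have h1 : ∫ θ in closedBall θ₀ δ, stolzKer δ (θ - θ₀) * q θ ≤
        ∫ θ in closedBall θ₀ δ, δ / δ ^ 2 * q θ := by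
      refine setIntegral_mono_on (integrableOn_stolzKer_mul hq hδ θ₀ δ)
        ((hq.integrableOn_isCompact (isCompact_closedBall θ₀ δ)).const_mul _)
        measurableSet_closedBall fun θ _ => ?_
      exact mul_le_mul_of_nonneg_right (stolzKer_le hδ hδ (le_max_left _ _)) (hq0 θ)
    rw [integral_const_mul] at h1
    have h2 := mul_le_mul_of_nonneg_left (hav δ hδ hN) (show 0 ≤ δ / δ ^ 2 by positivity)
    have h3 : δ / δ ^ 2 * (ε * δ) = ε := by field_simp
    linarith
  | succ N ih =>
    set s := 2 ^ N * δ with hs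
    have hs0 : 0 < s := by positivity
    have e2 : 2 ^ (N + 1) * δ = 2 * s := by rw [hs]; ring
    rw [e2] at hN ⊢
    have ih' := ih (by linarith)
    have hsub : closedBall θ₀ s ⊆ closedBall θ₀ (2 * s) := closedBall_subset_closedBall (by linarith)
    have hI := integrableOn_stolzKer_mul hq hδ θ₀ (2 * s)
    have hsplit := setIntegral_union (μ := volume) (disjoint_sdiff_right (s := closedBall θ₀ s) (t := closedBall θ₀ (2 * s)))
      (measurableSet_closedBall.diff measurableSet_closedBall) (hI.mono_set hsub)
      (hI.mono_set sdiff_subset)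
    rw [union_sdiff_cancel hsub] at hsplit
    have hq2 := hq.integrableOn_isCompact (isCompact_closedBall θ₀ (2 * s))
    have h1 : ∫ θ in closedBall θ₀ (2 * s) \ closedBall θ₀ s, stolzKer δ (θ - θ₀) * q θ ≤
        ∫ θ in closedBall θ₀ (2 * s) \ closedBall θ₀ s, δ / s ^ 2 * q θ := by
      refine setIntegral_mono_on (hI.mono_set sdiff_subset)
        ((hq2.mono_set sdiff_subset).const_mul _)
        (measurableSet_closedBall.diff measurableSet_closedBall) fun θ hθ => ?_
      refine mul_le_mul_of_nonneg_right (stolzKer_le hδ hs0 ?_) (hq0 θ)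
      have := hθ.2
      rw [mem_closedBall, Real.dist_eq, not_le] at this
      exact this.le.trans (le_max_right _ _)
    have h2 : ∫ θ in closedBall θ₀ (2 * s) \ closedBall θ₀ s, δ / s ^ 2 * q θ ≤
        ∫ θ in closedBall θ₀ (2 * s), δ / s ^ 2 * q θ :=
      setIntegral_mono_set (hq2.const_mul _)
        (Eventually.of_forall fun θ => mul_nonneg (by positivity) (hq0 θ))
        (Eventually.of_forall sdiff_subset)
    have h6 := integral_const_mul (μ := volume.restrict (closedBall θ₀ (2 * s))) (δ / s ^ 2) q
    have h3 := mul_le_mul_of_nonneg_left (hav (2 * s) (by positivity) hN)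
      (show 0 ≤ δ / s ^ 2 by positivity)
    have h4 : δ / s ^ 2 * (ε * (2 * s)) = ε * (2 / 2 ^ N) := by
      rw [hs]; field_simp
    have h5 : ε * (4 / 2 ^ N) = ε * (2 / 2 ^ N) + ε * (4 / 2 ^ (N + 1)) := by
      rw [pow_succ]; field_simp; ring
    linarith

theorem locallyIntegrable_comp_circleMap {k : ℂ → ℝ} (hk : Integrable k circ) :
    LocallyIntegrable (fun θ => k (circleMap 0 1 θ)) := by
  have h := (integrable_circ_iff hk.aestronglyMeasurable).1 hk
  have hp : Function.Periodic (fun θ => k (circleMap 0 1 θ)) (2 * Real.pi) := fun θ => by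
    simp [periodic_circleMap 0 1 θ]
  intro x
  refine ⟨Icc (x - 1) (x + 1), Icc_mem_nhds (by linarith) (by linarith), ?_⟩
  rw [← intervalIntegrable_iff_integrableOn_Icc_of_le (by linarith)]
  exact hp.intervalIntegrable₀ Real.two_pi_pos.ne' (by simpa [CircleIntegrable] using h) _ _

theorem integral_circ_closedBall {k : ℂ → ℝ} (hk : AEStronglyMeasurable k circ) (θ₀ : ℝ) :
    ∫ ζ, k ζ ∂circ =
      (2 * Real.pi)⁻¹ * ∫ θ in closedBall θ₀ Real.pi, k (circleMap 0 1 θ) := by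
  have hp : Function.Periodic (fun θ => k (circleMap 0 1 θ)) (2 * Real.pi) := fun θ => by
    simp [periodic_circleMap 0 1 θ]
  rw [integral_circ hk, Real.circleAverage, smul_eq_mul, Real.closedBall_eq_Icc,
    integral_Icc_eq_integral_Ioc]
  congr 1
  have h := hp.intervalIntegral_add_eq 0 (θ₀ - Real.pi)
  rw [zero_add] at h
  rw [h, intervalIntegral.integral_of_le (by linarith [Real.pi_pos])]
  congr 3
  ring

theorem poissonKernel_le_stolzKer {A : ℝ} (hA : 0 ≤ A) {t : ℂ} (ht : t ∈ ball (0:ℂ) 1) {θ θ₀ : ℝ}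
    (htA : ‖t - circleMap 0 1 θ₀‖ ≤ A * (1 - ‖t‖)) (hθ : |θ - θ₀| ≤ Real.pi) :
    poissonKernel 0 t (circleMap 0 1 θ) ≤
      2 * (2 * (1 + A)) ^ 2 * stolzKer (1 - ‖t‖) (θ - θ₀) := by
  have hδ : 0 < 1 - ‖t‖ := by simpa using ht
  have hζ : circleMap 0 1 θ ∈ sphere (0:ℂ) 1 := circleMap_mem_sphere 0 zero_le_one θ
  rw [poissonKernel_zero hζ]
  set ζ := circleMap 0 1 θ
  have hn : ‖ζ‖ = 1 := mem_sphere_zero_iff_norm.1 hζ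
  have h1 : 1 - ‖t‖ ≤ ‖ζ - t‖ := by rw [← hn]; exact norm_sub_norm_le _ _
  have h2 : ‖ζ - circleMap 0 1 θ₀‖ ≤ ‖ζ - t‖ + ‖t - circleMap 0 1 θ₀‖ := norm_sub_le_norm_sub_add_norm_sub _ _ _
  have h3 := norm_circleMap_sub_ge hθ
  have h4 : 1 / 2 * |θ - θ₀| ≤ 2 / Real.pi * |θ - θ₀| := by
    refine mul_le_mul_of_nonneg_right ?_ (abs_nonneg _)
    rw [div_le_div_iff₀ two_pos Real.pi_pos]
    linarith [Real.pi_le_four]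
  have h5 : A * (1 - ‖t‖) ≤ A * ‖ζ - t‖ := mul_le_mul_of_nonneg_left h1 hA
  have hm : max (1 - ‖t‖) |θ - θ₀| ≤ 2 * (1 + A) * ‖ζ - t‖ := by
    refine max_le ?_ ?_
    · nlinarith [norm_nonneg (ζ - t)]
    · linarith
  have hm0 : 0 < max (1 - ‖t‖) |θ - θ₀| := lt_max_of_lt_left hδ
  have hpos : 0 < ‖ζ - t‖ := hδ.trans_le h1
  unfold stolzKer
  rw [← mul_div_assoc, div_le_div_iff₀ (by positivity) (by positivity)]
  have h6 : (max (1 - ‖t‖) |θ - θ₀|) ^ 2 ≤ (2 * (1 + A) * ‖ζ - t‖) ^ 2 := by gcongr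
  have h7 : 1 - ‖t‖ ^ 2 ≤ 2 * (1 - ‖t‖) := by nlinarith [sq_nonneg (1 - ‖t‖)]
  calc (1 - ‖t‖ ^ 2) * (max (1 - ‖t‖) |θ - θ₀|) ^ 2
      ≤ (2 * (1 - ‖t‖)) * (2 * (1 + A) * ‖ζ - t‖) ^ 2 := by gcongr
    _ = _ := by ring

/-- Nontangential boundary values of Poisson integrals of integrable functions (Fatou). -/
theorem ae_tendsto_pint {k : ℂ → ℝ} (hk : Integrable k circ) :
    ∀ᵐ ζ₀ ∂circ, ∀ A : ℝ, Tendsto (pint k)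
      (𝓝[{t | t ∈ ball (0:ℂ) 1 ∧ ‖t - ζ₀‖ ≤ A * (1 - ‖t‖)}] ζ₀) (𝓝 (k ζ₀)) := by
  have hloc := locallyIntegrable_comp_circleMap hk
  refine ae_circ_of_ae ?_
  filter_upwards [IsUnifLocDoublingMeasure.ae_tendsto_average_norm_sub volume hloc 1] with θ₀ hθ₀ A
  wlog hA : 0 ≤ A generalizing A
  · refine (this 0 le_rfl).mono_left (nhdsWithin_mono _ fun t ht => ⟨ht.1, ht.2.trans ?_⟩)
    have : 0 < 1 - ‖t‖ := by simpa using ht.1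
    nlinarith
  set ζ₀ := circleMap 0 1 θ₀
  set q : ℝ → ℝ := fun θ => |k (circleMap 0 1 θ) - k ζ₀| with hq
  have hqi : LocallyIntegrable q := by
    have := hloc.sub (locallyIntegrable_const (k ζ₀))
    intro x
    obtain ⟨s, hs, hi⟩ := this x
    exact ⟨s, hs, hi.norm⟩
  have hq0 : ∀ θ, 0 ≤ q θ := fun θ => abs_nonneg _
  have hav : ∀ ε > 0, ∃ η > 0, η ≤ Real.pi ∧
      ∀ s, 0 < s → s ≤ η → ∫ θ in closedBall θ₀ s, q θ ≤ ε * s := by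
    intro ε hε
    have := hθ₀ (fun _ => θ₀) (fun s : ℝ => s) (l := 𝓝[>] 0) tendsto_id
      (by
        filter_upwards [self_mem_nhdsWithin] with s hs
        rw [one_mul]; exact mem_closedBall_self (le_of_lt hs))
    have h2 := this.eventually (eventually_lt_nhds (show (0:ℝ) < ε / 2 by positivity))
    obtain ⟨η, hη, hη2⟩ := mem_nhdsGT_iff_exists_Ioc_subset.1 h2
    refine ⟨min η Real.pi, lt_min hη Real.pi_pos, min_le_right _ _, fun s hs hsη => ?_⟩
    have h3 : ⨍ y in closedBall θ₀ s, ‖k (circleMap 0 1 y) - k ζ₀‖ < ε / 2 :=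
      hη2 ⟨hs, hsη.trans (min_le_left _ _)⟩
    rw [setAverage_eq, smul_eq_mul, Measure.real, Real.volume_closedBall,
      ENNReal.toReal_ofReal (by positivity), inv_mul_lt_iff₀ (by positivity)] at h3
    calc ∫ θ in closedBall θ₀ s, q θ = ∫ θ in closedBall θ₀ s, ‖k (circleMap 0 1 θ) - k ζ₀‖ := rfl
      _ ≤ _ := by linarith
  set Q := ∫ θ in closedBall θ₀ Real.pi, q θ
  have hQ : 0 ≤ Q := integral_nonneg hq0
  set B := 2 * (1 + A)
  have hB : 0 < B := by positivity
  rw [Metric.tendsto_nhds]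
  intro e he
  obtain ⟨η, hη, hηπ, hηav⟩ := hav (e / (20 * B ^ 2)) (by positivity)
  have hev : ∀ᶠ t in 𝓝 ζ₀, B ^ 2 * (4 * (1 - ‖t‖) * Q / η ^ 2) < e / 2 ∧ 1 - ‖t‖ < η := by
    have hc : Tendsto (fun t : ℂ => 1 - ‖t‖) (𝓝 ζ₀) (𝓝 0) := by
      have : Continuous fun t : ℂ => 1 - ‖t‖ := by fun_prop
      convert this.tendsto ζ₀ using 2
      simp [ζ₀]
    have hc2 : Tendsto (fun t : ℂ => B ^ 2 * (4 * (1 - ‖t‖) * Q / η ^ 2)) (𝓝 ζ₀) (𝓝 0) := by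
      have := (((hc.const_mul 4).mul_const Q).div_const (η ^ 2)).const_mul (B ^ 2)
      simpa using this
    exact (hc2.eventually (eventually_lt_nhds (by positivity))).and
      (hc.eventually (eventually_lt_nhds hη))
  filter_upwards [self_mem_nhdsWithin, nhdsWithin_le_nhds hev] with t ⟨ht, htA⟩ ⟨he1, hδη⟩
  have hδ : 0 < 1 - ‖t‖ := by simpa using ht
  set δ := 1 - ‖t‖
  have hki : Integrable (fun ζ => k ζ - k ζ₀) circ := hk.sub (integrable_const _)
  have e1 : pint k t - k ζ₀ = pint (fun ζ => k ζ - k ζ₀) t := by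
    rw [pint_sub hk (integrable_const _) ht, pint_const _ ht]
  have e2 : |pint (fun ζ => k ζ - k ζ₀) t| ≤
      ∫ ζ, poissonKernel 0 t ζ * |k ζ - k ζ₀| ∂circ := by
    refine (abs_integral_le_integral_abs).trans (integral_mono_of_nonneg
      (Eventually.of_forall fun _ => abs_nonneg _)
      (integrable_poissonKernel_mul hki.abs ht) ?_)
    filter_upwards [circ_sphere] with ζ hζ
    rw [abs_mul, abs_of_nonneg (poissonKernel_nonneg hζ ht)]
  rw [integral_circ_closedBall (integrable_poissonKernel_mul hki.abs ht).aestronglyMeasurable θ₀]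
    at e2
  have hI := integrableOn_stolzKer_mul hqi hδ θ₀ Real.pi
  have e3 : ∫ θ in closedBall θ₀ Real.pi,
      poissonKernel 0 t (circleMap 0 1 θ) * |k (circleMap 0 1 θ) - k ζ₀| ≤
      ∫ θ in closedBall θ₀ Real.pi, 2 * B ^ 2 * (stolzKer δ (θ - θ₀) * q θ) := by
    refine integral_mono_of_nonneg (Eventually.of_forall fun θ => mul_nonneg
      (poissonKernel_nonneg (circleMap_mem_sphere 0 zero_le_one θ) ht) (abs_nonneg _))
      (hI.const_mul _) ?_
    filter_upwards [ae_restrict_mem measurableSet_closedBall] with θ hθ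
    rw [← mul_assoc]
    refine mul_le_mul_of_nonneg_right (poissonKernel_le_stolzKer hA ht htA ?_) (hq0 θ)
    rwa [mem_closedBall, Real.dist_eq] at hθ
  rw [integral_const_mul] at e3
  obtain ⟨N, hN1, hN2⟩ := exists_nat_pow_near (x := η / δ) (y := 2)
    (by rw [le_div_iff₀ hδ]; linarith) one_lt_two
  rw [le_div_iff₀ hδ] at hN1
  rw [div_lt_iff₀ hδ, pow_succ] at hN2
  have hdy := integral_stolzKer_dyadic hqi hq0 hδ hηav N hN1
  set s := 2 ^ N * δ with hs
  have hs0 : 0 < s := by positivity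
  have hsη : η / 2 ≤ s := by rw [hs]; linarith
  have hsub : closedBall θ₀ s ⊆ closedBall θ₀ Real.pi :=
    closedBall_subset_closedBall (hN1.trans hηπ)
  have hsplit := setIntegral_union (μ := volume)
    (disjoint_sdiff_right (s := closedBall θ₀ s) (t := closedBall θ₀ Real.pi))
    (measurableSet_closedBall.diff measurableSet_closedBall) (hI.mono_set hsub)
    (hI.mono_set sdiff_subset)
  rw [union_sdiff_cancel hsub] at hsplit
  have hq2 := hqi.integrableOn_isCompact (isCompact_closedBall θ₀ Real.pi)
  have e4 : ∫ θ in closedBall θ₀ Real.pi \ closedBall θ₀ s, stolzKer δ (θ - θ₀) * q θ ≤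
      ∫ θ in closedBall θ₀ Real.pi \ closedBall θ₀ s, 4 * δ / η ^ 2 * q θ := by
    refine setIntegral_mono_on (hI.mono_set sdiff_subset)
      ((hq2.mono_set sdiff_subset).const_mul _)
      (measurableSet_closedBall.diff measurableSet_closedBall) fun θ hθ => ?_
    refine mul_le_mul_of_nonneg_right ((stolzKer_le hδ (half_pos hη) ?_).trans_eq ?_) (hq0 θ)
    · have := hθ.2
      rw [mem_closedBall, Real.dist_eq, not_le] at this
      exact (hsη.trans this.le).trans (le_max_right _ _)
    · field_simp; norm_num
  have e5 : ∫ θ in closedBall θ₀ Real.pi \ closedBall θ₀ s, 4 * δ / η ^ 2 * q θ ≤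
      ∫ θ in closedBall θ₀ Real.pi, 4 * δ / η ^ 2 * q θ :=
    setIntegral_mono_set (hq2.const_mul _)
      (Eventually.of_forall fun θ => mul_nonneg (by positivity) (hq0 θ))
      (Eventually.of_forall sdiff_subset)
  have e6 : ∫ θ in closedBall θ₀ Real.pi, 4 * δ / η ^ 2 * q θ = 4 * δ / η ^ 2 * Q :=
    integral_const_mul _ _
  have e7 : ∫ θ in closedBall θ₀ Real.pi, stolzKer δ (θ - θ₀) * q θ ≤
      5 * (e / (20 * B ^ 2)) + 4 * δ / η ^ 2 * Q := by
    have : 0 ≤ e / (20 * B ^ 2) * (4 / 2 ^ N) := by positivity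
    linarith
  rw [Real.dist_eq, e1]
  set J := ∫ θ in closedBall θ₀ Real.pi, stolzKer δ (θ - θ₀) * q θ
  have hJ : 0 ≤ J := integral_nonneg fun θ => mul_nonneg (stolzKer_nonneg hδ _) (hq0 θ)
  have hpi : (2 * Real.pi)⁻¹ ≤ 1 / 2 := by
    rw [one_div]
    exact inv_anti₀ two_pos (by linarith [Real.pi_gt_three])
  calc |pint (fun ζ => k ζ - k ζ₀) t| ≤ (2 * Real.pi)⁻¹ * (2 * B ^ 2 * J) :=
        e2.trans (mul_le_mul_of_nonneg_left e3 (by positivity))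
    _ ≤ 1 / 2 * (2 * B ^ 2 * J) := mul_le_mul_of_nonneg_right hpi (by positivity)
    _ = B ^ 2 * J := by ring
    _ ≤ B ^ 2 * (5 * (e / (20 * B ^ 2)) + 4 * δ / η ^ 2 * Q) := by gcongr
    _ = e / 4 + B ^ 2 * (4 * δ * Q / η ^ 2) := by field_simp; ring
    _ < e := by linarith

end

section

/-- Weak sequential compactness in `L²` of uniformly bounded functions on the circle. -/
theorem exists_weak_limit_circ {κ : ℕ → ℂ → ℝ} {M : ℝ} (hm : ∀ i, AEStronglyMeasurable (κ i) circ)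
    (hb : ∀ i, ∀ᵐ ζ ∂circ, |κ i ζ| ≤ M) :
    ∃ k : ℂ → ℝ, Integrable k circ ∧ ∃ l : Filter ℕ, l.NeBot ∧ l ≤ atTop ∧
      ∀ g : ℂ → ℝ, MemLp g 2 circ →
        Tendsto (fun i => ∫ ζ, g ζ * κ i ζ ∂circ) l (𝓝 (∫ ζ, g ζ * k ζ ∂circ)) := by
  have hL : ∀ i, MemLp (κ i) 2 circ := fun i => MemLp.of_bound (hm i) M (hb i)
  set x : ℕ → WeakDual ℝ (Lp ℝ 2 circ) :=
    fun i => StrongDual.toWeakDual (innerSL ℝ ((hL i).toLp (κ i))) with hx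
  have hxC : ∀ i, x i ∈ WeakDual.toStrongDual ⁻¹' closedBall (0 : StrongDual ℝ (Lp ℝ 2 circ)) |M| := by
    intro i
    simp only [hx, mem_preimage, mem_closedBall, dist_zero_right]
    have h0 : ‖(innerSL ℝ ((hL i).toLp (κ i)))‖ ≤ |M| := by
      rw [innerSL_apply_norm, Lp.norm_toLp]
      refine ENNReal.toReal_le_of_le_ofReal (abs_nonneg _) ?_
      refine (eLpNorm_le_of_ae_bound (C := |M|) ?_).trans ?_
      · filter_upwards [hb i] with ζ hζ
        exact hζ.trans (le_abs_self M)
      · simp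
    exact h0
  obtain ⟨φ, -, hφ⟩ := (WeakDual.isCompact_closedBall (𝕜 := ℝ) (0 : StrongDual ℝ (Lp ℝ 2 circ)) |M|).ultrafilter_le_nhds'
    ((hyperfilter ℕ).map x) (mem_map.2 (Eventually.of_forall hxC))
  set k := (InnerProductSpace.toDual ℝ (Lp ℝ 2 circ)).symm (WeakDual.toStrongDual φ) with hk
  refine ⟨k, (Lp.memLp k).integrable (by norm_num), hyperfilter ℕ, inferInstance,
    Nat.hyperfilter_le_atTop, fun g hg => ?_⟩
  have h1 : Tendsto (fun i => x i (hg.toLp g)) (hyperfilter ℕ) (𝓝 (φ (hg.toLp g))) :=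
    ((WeakDual.eval_continuous (hg.toLp g)).tendsto φ).comp hφ
  have h2 : φ (hg.toLp g) = ∫ ζ, g ζ * k ζ ∂circ := by
    have : φ (hg.toLp g) = inner ℝ k (hg.toLp g) := by
      rw [hk, InnerProductSpace.toDual_symm_apply]; rfl
    rw [this, L2.inner_def]
    refine integral_congr_ae ?_
    filter_upwards [hg.coeFn_toLp] with ζ hζ
    rw [hζ]; simp
  have h3 : ∀ i, x i (hg.toLp g) = ∫ ζ, g ζ * κ i ζ ∂circ := by
    intro i
    have : x i (hg.toLp g) = inner ℝ ((hL i).toLp (κ i)) (hg.toLp g) := rfl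
    rw [this, L2.inner_def]
    refine integral_congr_ae ?_
    filter_upwards [hg.coeFn_toLp, (hL i).coeFn_toLp] with ζ hζ h'
    rw [hζ, h']; simp
  rw [h2] at h1
  exact h1.congr h3

theorem sphere_subset_cannulus {r : ℝ} (hr : r < 1) : sphere (0:ℂ) 1 ⊆ cannulus r 1 := fun t ht => by
  rw [mem_sphere_zero_iff_norm] at ht
  exact ⟨by linarith, ht.le⟩

theorem annulus_subset_ball (r : ℝ) : annulus r 1 ⊆ ball (0:ℂ) 1 := fun t ht => by
  simpa using ht.2

/-- A subharmonic function in an annulus is controlled by the Poisson integral of its outer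
boundary values. -/
theorem le_pint_add {r M : ℝ} (hr : 0 < r) (hr1 : r < 1) {v : ℂ → ℝ}
    (hc : ContinuousOn v (cannulus r 1)) (hs : ∀ t ∈ annulus r 1, SubMeanAt v t)
    (hM : ∀ t, ‖t‖ = r → v t - pint v t ≤ M) {t : ℂ} (ht : t ∈ annulus r 1) :
    v t ≤ pint v t + M * (Real.log ‖t‖ / Real.log r) := by
  have hcs : ContinuousOn v (sphere 0 1) := hc.mono (sphere_subset_cannulus hr1)
  have hki := integrable_circ_of_continuousOn hcs
  have hh : IsHarmonicOn (dirSol v) (annulus r 1) :=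
    (isHarmonicOn_dirSol hki).mono (isOpen_annulus r 1) (annulus_subset_ball r)
  have hsub : cannulus r 1 ⊆ closedBall (0:ℂ) 1 := fun t ht => by simpa using ht.2
  have := annulus_le (v := fun t => v t - dirSol v t) (M := M) hr hr1
    (hc.sub ((continuousOn_dirSol hcs).mono hsub))
    (fun t ht => SubMeanAt.sub_harmonic (isOpen_annulus r 1) ht (hc.mono (annulus_subset_cannulus r 1)) (hs t ht) hh)
    (fun t h => by
      rw [dirSol_of_notMem (by simp [h]), sub_self])
    (fun t h => by
      rw [dirSol_of_mem (by simpa [h] using hr1)]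
      exact hM t h) t (annulus_subset_cannulus _ _ ht)
  rw [dirSol_of_mem (annulus_subset_ball r ht), div_one, div_one] at this
  linarith

theorem pint_le_const {k : ℂ → ℝ} {M : ℝ} (hk : Integrable k circ) (h : ∀ᵐ ζ ∂circ, k ζ ≤ M)
    {t : ℂ} (ht : t ∈ ball (0:ℂ) 1) : pint k t ≤ M := by
  have := pint_mono hk (integrable_const M) h ht
  rwa [pint_const M ht] at this

theorem le_pint_const {k : ℂ → ℝ} {M : ℝ} (hk : Integrable k circ) (h : ∀ᵐ ζ ∂circ, M ≤ k ζ)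
    {t : ℂ} (ht : t ∈ ball (0:ℂ) 1) : M ≤ pint k t := by
  have := pint_mono (integrable_const M) hk h ht
  rwa [pint_const M ht] at this

theorem abs_sub_pint_le {r M : ℝ} (hr : 0 < r) (hr1 : r < 1) {u : ℂ → ℝ}
    (hc : ContinuousOn u (cannulus r 1)) (hu : IsHarmonicOn u (annulus r 1))
    (hM : ∀ t, ‖t‖ = r → |u t - pint u t| ≤ M) {t : ℂ} (ht : t ∈ annulus r 1) :
    |u t - pint u t| ≤ M * (Real.log ‖t‖ / Real.log r) := by
  have hneg : ∀ t, pint (fun ζ => - u ζ) t = - pint u t := fun t => by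
    simpa using pint_const_mul (-1) u t
  have h1 := le_pint_add hr hr1 hc (fun t ht => hu.subMeanAt (isOpen_annulus r 1) ht)
    (fun t h => (le_abs_self _).trans (hM t h)) ht
  have h2 := le_pint_add (v := fun t => - u t) (M := M) hr hr1 hc.neg
    (fun t ht => hu.neg.subMeanAt (isOpen_annulus r 1) ht)
    (fun t h => by
      rw [hneg]
      have := (neg_le_abs _).trans (hM t h)
      linarith) ht
  rw [hneg] at h2
  rw [abs_le]
  constructor <;> linarith

/-- A bounded harmonic function in an annulus is, up to an error vanishing at the outer circle,
the Poisson integral of an integrable function. -/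
theorem exists_pint_of_bounded {r₀ r M : ℝ} (hr₀ : 0 < r₀) (hr : r₀ < r) (hr1 : r < 1) {u : ℂ → ℝ}
    (hu : IsHarmonicOn u (annulus r₀ 1)) (hM : ∀ t ∈ annulus r₀ 1, |u t| ≤ M) :
    ∃ k : ℂ → ℝ, Integrable k circ ∧
      ∀ t ∈ annulus r 1, |u t - pint k t| ≤ 2 * M * (Real.log ‖t‖ / Real.log r) := by
  have hr0 : 0 < r := hr₀.trans hr
  obtain ⟨ρ, -, hρ, hρlim⟩ := exists_seq_strictMono_tendsto' (show r₀ / r < 1 from (div_lt_one hr0).2 hr)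
  have hρ0 : ∀ i, 0 < ρ i := fun i => (by positivity : (0:ℝ) < r₀ / r).trans (hρ i).1
  have hmem : ∀ i, ∀ t ∈ cannulus r 1, (ρ i : ℂ) * t ∈ annulus r₀ 1 := by
    intro i t ht
    have h1 := (div_lt_iff₀ hr0).1 (hρ i).1
    have h2 : ‖(ρ i : ℂ) * t‖ = ρ i * ‖t‖ := by simp [abs_of_pos (hρ0 i)]
    rw [annulus, mem_ofPred_eq, h2]
    constructor
    · exact h1.trans_le (mul_le_mul_of_nonneg_left ht.1 (hρ0 i).le)
    · calc ρ i * ‖t‖ ≤ ρ i * 1 := mul_le_mul_of_nonneg_left ht.2 (hρ0 i).le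
        _ < 1 := by linarith [(hρ i).2]
  set κ : ℕ → ℂ → ℝ := fun i t => u (ρ i * t) with hκ
  have hκc : ∀ i, ContinuousOn (κ i) (cannulus r 1) := fun i =>
    hu.continuousOn.comp (by fun_prop) (hmem i)
  have hκh : ∀ i, IsHarmonicOn (κ i) (annulus r 1) := fun i =>
    hu.comp (isOpen_annulus r 1) (by fun_prop) fun t ht => hmem i t (annulus_subset_cannulus _ _ ht)
  have hκi : ∀ i, Integrable (κ i) circ := fun i =>
    integrable_circ_of_continuousOn ((hκc i).mono (sphere_subset_cannulus hr1))
  have hκb : ∀ i, ∀ᵐ ζ ∂circ, |κ i ζ| ≤ M := fun i => by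
    filter_upwards [circ_sphere] with ζ hζ
    exact hM _ (hmem i ζ (sphere_subset_cannulus hr1 hζ))
  obtain ⟨k, hk, l, hl, hle, hlim⟩ := exists_weak_limit_circ
    (fun i => (hκi i).aestronglyMeasurable) hκb
  refine ⟨k, hk, fun t ht => ?_⟩
  have htb := annulus_subset_ball r ht
  have hP : MemLp (poissonKernel 0 t) 2 circ := by
    refine MemLp.of_bound (measurable_poissonKernel t).aestronglyMeasurable ((1 + ‖t‖) / (1 - ‖t‖)) ?_
    filter_upwards [circ_sphere] with ζ hζ
    rw [Real.norm_of_nonneg (poissonKernel_nonneg hζ htb)]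
    exact poissonKernel_le hζ htb
  have h1 := hlim _ hP
  have h2 : Tendsto (fun i => κ i t) l (𝓝 (u t)) := by
    have hct : ContinuousAt u t := hu.continuousOn.continuousAt
      ((isOpen_annulus r₀ 1).mem_nhds ⟨hr.trans ht.1, ht.2⟩)
    refine Tendsto.comp (y := 𝓝 t) hct (Tendsto.mono_left ?_ hle)
    have : Tendsto (fun i => (ρ i : ℂ) * t) atTop (𝓝 ((1:ℝ) * t)) :=
      ((continuous_ofReal.tendsto 1).comp hρlim).mul_const t
    simpa using this
  refine le_of_tendsto (h2.sub h1).abs (Eventually.of_forall fun i => ?_)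
  refine abs_sub_pint_le hr0 hr1 (hκc i) (hκh i) (fun s hs => ?_) ht
  have hsb : s ∈ ball (0:ℂ) 1 := by simpa [hs] using hr1
  have h3 := abs_le.1 (hM _ (hmem i s ⟨hs.ge, hs.le.trans hr1.le⟩))
  have h4 := pint_le_const (hκi i) ((hκb i).mono fun ζ h => (abs_le.1 h).2) hsb
  have h5 := le_pint_const (hκi i) ((hκb i).mono fun ζ h => (abs_le.1 h).1) hsb
  rw [abs_le]
  constructor <;> linarith [h3.1, h3.2]

/-- The Stolz region at `ζ`. -/
def stolz (A : ℝ) (ζ : ℂ) : Set ℂ := {t | t ∈ ball (0:ℂ) 1 ∧ ‖t - ζ‖ ≤ A * (1 - ‖t‖)}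

theorem tendsto_of_abs_sub_pint_le {r C : ℝ} (hr1 : r < 1) {u k : ℂ → ℝ}
    (h : ∀ t ∈ annulus r 1, |u t - pint k t| ≤ C * (Real.log ‖t‖ / Real.log r)) {ζ : ℂ}
    (hζ : ζ ∈ sphere (0:ℂ) 1) {A L : ℝ} (hk : Tendsto (pint k) (𝓝[stolz A ζ] ζ) (𝓝 L)) :
    Tendsto u (𝓝[stolz A ζ] ζ) (𝓝 L) := by
  have hn := mem_sphere_zero_iff_norm.1 hζ
  have hlog : Tendsto (fun t : ℂ => C * (Real.log ‖t‖ / Real.log r)) (𝓝[stolz A ζ] ζ) (𝓝 0) := by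
    have : ContinuousAt (fun t : ℂ => C * (Real.log ‖t‖ / Real.log r)) ζ := by
      refine continuousAt_const.mul (ContinuousAt.div_const ?_ _)
      exact continuous_norm.continuousAt.log (by rw [hn]; exact one_ne_zero)
    have h2 := this.tendsto
    rw [hn, Real.log_one, zero_div, mul_zero] at h2
    exact h2.mono_left nhdsWithin_le_nhds
  have hev : ∀ᶠ t in 𝓝[stolz A ζ] ζ, r < ‖t‖ :=
    nhdsWithin_le_nhds (continuous_norm.continuousAt.eventually (lt_mem_nhds (by simpa only [hn] using hr1)))
  have h0 : Tendsto (fun t => u t - pint k t) (𝓝[stolz A ζ] ζ) (𝓝 0) := by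
    refine squeeze_zero_norm' ?_ hlog
    filter_upwards [self_mem_nhdsWithin, hev] with t ht hrt
    exact h t ⟨hrt, by simpa using ht.1⟩
  simpa using h0.add hk

/-- Fatou's theorem for bounded analytic functions in an annulus. -/
theorem exists_stolz_limit {r₀ M : ℝ} (hr₀ : 0 < r₀) (hr1 : r₀ < 1) {g : ℂ → ℂ}
    (hg : DifferentiableOn ℂ g (annulus r₀ 1)) (hM : ∀ t ∈ annulus r₀ 1, ‖g t‖ ≤ M) :
    ∀ᵐ ζ ∂circ, ∃ L : ℂ, ∀ A : ℝ, Tendsto g (𝓝[stolz A ζ] ζ) (𝓝 L) := by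
  obtain ⟨r, hr, hr1⟩ := exists_between hr1
  obtain ⟨k, hk, hk2⟩ := exists_pint_of_bounded hr₀ hr hr1
    (isHarmonicOn_re (isOpen_annulus r₀ 1) hg) fun t ht => (abs_re_le_norm _).trans (hM t ht)
  obtain ⟨l, hl, hl2⟩ := exists_pint_of_bounded hr₀ hr hr1
    (isHarmonicOn_re (isOpen_annulus r₀ 1) (hg.const_mul (-I)))
    (M := M) fun t ht => (abs_re_le_norm _).trans (by simpa using hM t ht)
  filter_upwards [ae_tendsto_pint hk, ae_tendsto_pint hl, circ_sphere] with ζ h1 h2 hζ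
  refine ⟨k ζ + l ζ * I, fun A => ?_⟩
  have e1 := tendsto_of_abs_sub_pint_le hr1 hk2 hζ (h1 A)
  have e2 := tendsto_of_abs_sub_pint_le hr1 hl2 hζ (h2 A)
  have e3 := ((continuous_ofReal.tendsto _).comp e1).add
    (((continuous_ofReal.tendsto _).comp e2).mul_const I)
  refine e3.congr fun t => ?_
  simp only [Function.comp]
  have : (-I * g t).re = (g t).im := by simp
  rw [this, re_add_im]

end

section

theorem isPreconnected_annulus {r R : ℝ} (hr : 0 ≤ r) : IsPreconnected (annulus r R) := by
  have : annulus r R = (fun p : ℝ × ℝ => circleMap 0 p.1 p.2) '' (Ioo r R ×ˢ univ) := by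
    ext t
    constructor
    · intro ht
      refine ⟨(‖t‖, arg t), ⟨ht, trivial⟩, ?_⟩
      simp [circleMap, norm_mul_exp_arg_mul_I]
    · rintro ⟨⟨ρ, θ⟩, ⟨h, -⟩, rfl⟩
      have : ‖circleMap 0 ρ θ‖ = ρ := by
        rw [norm_circleMap_zero, abs_of_pos (hr.trans_lt h.1)]
      rw [annulus, mem_ofPred_eq, this]; exact h
  rw [this]
  refine (isPreconnected_Ioo.prod isPreconnected_univ).image _ (Continuous.continuousOn ?_)
  unfold circleMap; fun_prop

/-- The integral defining the winding number about `z` of the image of the circle of radius `ρ`. -/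
def windInt (γ : ℂ → ℂ) (ρ : ℝ) (z : ℂ) : ℂ := ∮ t in C(0, ρ), deriv γ t / (γ t - z)

theorem windInt_eventually_eq {γ : ℂ → ℂ} {ρ : ℝ} (hρ : 0 < ρ) {U : Set ℂ} (hU : IsOpen U)
    (hγ : DifferentiableOn ℂ γ U) (hs : sphere (0:ℂ) ρ ⊆ U) {z : ℂ}
    (hz : z ∉ γ '' sphere (0:ℂ) ρ) : ∀ᶠ w in 𝓝 z, windInt γ ρ z = windInt γ ρ w := by
  have hcs : ContinuousOn γ (sphere (0:ℂ) ρ) := hγ.continuousOn.mono hs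
  have hcomp : IsCompact (γ '' sphere (0:ℂ) ρ) := (isCompact_sphere 0 ρ).image_of_continuousOn hcs
  obtain ⟨d, hd, hball⟩ := Metric.isOpen_iff.1 hcomp.isClosed.isOpen_compl z hz
  have hdist : ∀ t ∈ sphere (0:ℂ) ρ, d ≤ ‖γ t - z‖ := fun t ht => by
    by_contra! h
    exact hball (mem_ball_iff_norm.2 h) ⟨t, ht, rfl⟩
  filter_upwards [ball_mem_nhds z hd] with w hw
  rw [mem_ball_iff_norm] at hw
  have hderivc : ContinuousOn (deriv γ) (sphere (0:ℂ) ρ) :=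
    (hγ.deriv hU).continuousOn.mono hs
  have hne : ∀ v ∈ ball z d, ∀ t ∈ sphere (0:ℂ) ρ, γ t - v ≠ 0 := fun v hv t ht h => by
    rw [sub_eq_zero] at h
    exact hball hv ⟨t, ht, h⟩
  have hci : ∀ v ∈ ball z d, CircleIntegrable (fun t => deriv γ t / (γ t - v)) 0 ρ := fun v hv =>
    (hderivc.div (hcs.sub continuousOn_const) (hne v hv)).circleIntegrable hρ.le
  have hzb := mem_ball_self (x := z) hd
  have hwb := mem_ball_iff_norm.2 hw
  rw [eq_comm, ← sub_eq_zero, windInt, windInt, ← circleIntegral.integral_sub (hci w hwb) (hci z hzb)]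
  refine circleIntegral.integral_eq_zero_of_hasDerivWithinAt (f := fun t => log ((γ t - w) / (γ t - z)))
    hρ.le fun t ht => ?_
  have hg : HasDerivAt γ (deriv γ t) t := (hγ.differentiableAt (hU.mem_nhds (hs ht))).hasDerivAt
  have h1 := hne w hwb t ht
  have h2 := hne z hzb t ht
  have hslit : (γ t - w) / (γ t - z) ∈ slitPlane := by
    refine ball_one_subset_slitPlane ?_
    rw [mem_ball_iff_norm]
    have : (γ t - w) / (γ t - z) - 1 = -((w - z) / (γ t - z)) := by field_simp; ring
    rw [this, norm_neg, norm_div, div_lt_one (norm_pos_iff.2 h2)]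
    exact hw.trans_le (hdist t ht)
  have := (((hg.sub_const w).div (hg.sub_const z) h2).clog hslit).hasDerivWithinAt (s := sphere (0:ℂ) ρ)
  refine this.congr_deriv ?_
  simp only [Pi.div_apply]
  field_simp

theorem windInt_eq_of_isPreconnected {γ : ℂ → ℂ} {ρ : ℝ} (hρ : 0 < ρ) {U : Set ℂ} (hU : IsOpen U)
    (hγ : DifferentiableOn ℂ γ U) (hs : sphere (0:ℂ) ρ ⊆ U) {W : Set ℂ} (hW : IsPreconnected W)
    (hd : ∀ z ∈ W, z ∉ γ '' sphere (0:ℂ) ρ) {z w : ℂ} (hz : z ∈ W) (hw : w ∈ W) :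
    windInt γ ρ z = windInt γ ρ w :=
  hW.induction₂ (fun z w => windInt γ ρ z = windInt γ ρ w)
    (fun x hx => nhdsWithin_le_nhds (windInt_eventually_eq hρ hU hγ hs (hd x hx)))
    (fun _ _ _ _ _ _ h1 h2 => h1.trans h2) (fun _ _ _ _ h => h.symm) hz hw

theorem windInt_jump {γ : ℂ → ℂ} {r R : ℝ} (hr : 0 ≤ r)
    (hγ : DifferentiableOn ℂ γ (annulus r R)) (hinj : InjOn γ (annulus r R))
    (hder : ∀ t ∈ annulus r R, deriv γ t ≠ 0) {ρ ρ' : ℝ} (hρ : r < ρ) (hρ' : ρ < ρ') (hR : ρ' < R)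
    {s : ℂ} (hs : s ∈ annulus r R) (hs1 : ‖s‖ ≠ ρ) (hs2 : ‖s‖ ≠ ρ') :
    windInt γ ρ' (γ s) - windInt γ ρ (γ s) =
      (∮ t in C(0, ρ'), (t - s)⁻¹) - ∮ t in C(0, ρ), (t - s)⁻¹ := by
  have hA := isOpen_annulus r R
  have hAs := hA.mem_nhds hs
  have hρ0 : 0 < ρ := hr.trans_lt hρ
  set q : ℂ → ℂ := fun t => deriv γ t / dslope γ s t with hq
  have hd0 : ∀ t ∈ annulus r R, dslope γ s t ≠ 0 := by
    intro t ht
    rcases eq_or_ne t s with rfl | h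
    · rw [dslope_same]; exact hder _ ht
    · intro h0
      have := sub_smul_dslope γ s t
      rw [h0, smul_zero, eq_comm, sub_eq_zero] at this
      exact h (hinj ht hs this)
  have hqd : DifferentiableOn ℂ q (annulus r R) :=
    (hγ.deriv hA).div ((differentiableOn_dslope hAs).2 hγ) hd0
  have hqs : q s = 1 := by
    simp only [hq, dslope_same]; exact div_self (hder s hs)
  have hQ : DifferentiableOn ℂ (dslope q s) (annulus r R) := (differentiableOn_dslope hAs).2 hqd
  have key : ∀ t ∈ annulus r R, t ≠ s → dslope q s t = deriv γ t / (γ t - γ s) - (t - s)⁻¹ := by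
    intro t ht hts
    have h1 := sub_ne_zero.2 hts
    rw [dslope_of_ne _ hts, slope_def_field, hqs, ← sub_smul_dslope γ s t, smul_eq_mul, hq]
    have := hd0 t ht
    field_simp
  have hsph : ∀ ρ₁, r < ρ₁ → ρ₁ < R → sphere (0:ℂ) ρ₁ ⊆ annulus r R := fun ρ₁ h1 h2 t ht => by
    rw [mem_sphere_zero_iff_norm] at ht
    exact ⟨by rwa [ht], by rwa [ht]⟩
  have hint : ∀ ρ₁, r < ρ₁ → ρ₁ < R → ‖s‖ ≠ ρ₁ →
      (∮ t in C(0, ρ₁), dslope q s t) = windInt γ ρ₁ (γ s) - ∮ t in C(0, ρ₁), (t - s)⁻¹ := by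
    intro ρ₁ h1 h2 h3
    have hρ1 : 0 ≤ ρ₁ := hr.trans h1.le
    have hts : ∀ t ∈ sphere (0:ℂ) ρ₁, t ≠ s := fun t ht h => by
      rw [mem_sphere_zero_iff_norm, h] at ht; exact h3 ht
    have hS := hsph ρ₁ h1 h2
    rw [windInt, ← circleIntegral.integral_sub]
    · exact circleIntegral.integral_congr hρ1 fun t ht => key t (hS ht) (hts t ht)
    · refine ContinuousOn.circleIntegrable hρ1 (((hγ.deriv hA).continuousOn.mono hS).div
        ((hγ.continuousOn.mono hS).sub continuousOn_const) fun t ht h => ?_)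
      exact hts t ht (hinj (hS ht) hs (sub_eq_zero.1 h))
    · exact ContinuousOn.circleIntegrable hρ1 (ContinuousOn.inv₀ (by fun_prop)
        fun t ht => sub_ne_zero.2 (hts t ht))
  have heq := circleIntegral_eq_of_differentiable_on_annulus_off_countable (c := 0) hρ0 hρ'.le
    countable_empty (f := dslope q s)
    (hQ.continuousOn.mono fun t ht => ⟨by
      have : ρ ≤ ‖t‖ := by simpa using ht.2
      linarith, by
      have : ‖t‖ ≤ ρ' := by simpa using ht.1
      linarith⟩)
    (fun t ht => hQ.differentiableAt (hA.mem_nhds ⟨by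
      have : ρ < ‖t‖ := by simpa using ht.1.2
      linarith, by
      have : ‖t‖ < ρ' := by simpa using ht.1.1
      linarith⟩))
  rw [hint ρ hρ (hρ'.trans hR) hs1, hint ρ' (hρ.trans hρ') hR hs2] at heq
  linear_combination heq

theorem circleIntegral_inv_of_lt {ρ : ℝ} (hρ : 0 ≤ ρ) {s : ℂ} (hs : ρ < ‖s‖) :
    (∮ t in C(0, ρ), (t - s)⁻¹) = 0 := by
  have hne : ∀ t ∈ closedBall (0:ℂ) ρ, t - s ≠ 0 := fun t ht h => by
    rw [sub_eq_zero] at h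
    rw [h, mem_closedBall_zero_iff] at ht
    linarith
  refine circleIntegral_eq_zero_of_differentiable_on_off_countable hρ countable_empty
    (ContinuousOn.inv₀ (by fun_prop) hne) fun t ht => ?_
  exact (differentiableAt_id.sub_const s).inv (hne t (ball_subset_closedBall ht.1))

/-- A connected set missing an analytic Jordan curve cannot contain points of both sides. -/
theorem not_both_sides {γ : ℂ → ℂ} {r R : ℝ} (hr : 0 ≤ r) (hr1 : r < 1)
    (hγ : DifferentiableOn ℂ γ (annulus r R)) (hinj : InjOn γ (annulus r R))
    (hder : ∀ t ∈ annulus r R, deriv γ t ≠ 0) {W : Set ℂ} (hW : IsPreconnected W)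
    (hd : ∀ z ∈ W, z ∉ γ '' sphere (0:ℂ) 1) {s s' : ℂ} (hs : s ∈ annulus r 1)
    (hs' : s' ∈ annulus 1 R) (hsW : γ s ∈ W) (hsW' : γ s' ∈ W) : False := by
  have hR : 1 < R := hs'.1.trans hs'.2
  obtain ⟨ρ, hρ, hρs⟩ := exists_between hs.1
  have hρ1 : ρ < 1 := hρs.trans hs.2
  have hρ0 : 0 < ρ := hr.trans_lt hρ
  have hA := isOpen_annulus r R
  have hsA : s ∈ annulus r R := ⟨hs.1, hs.2.trans hR⟩
  have hsA' : s' ∈ annulus r R := ⟨hr1.trans hs'.1, hs'.2⟩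
  have hsph : ∀ ρ₁, r < ρ₁ → ρ₁ < R → sphere (0:ℂ) ρ₁ ⊆ annulus r R := fun ρ₁ h1 h2 t ht => by
    rw [mem_sphere_zero_iff_norm] at ht
    exact ⟨by rwa [ht], by rwa [ht]⟩
  have h1 : windInt γ 1 (γ s) = windInt γ 1 (γ s') :=
    windInt_eq_of_isPreconnected one_pos hA hγ (hsph 1 hr1 hR) hW hd hsW hsW'
  have hsubA : annulus ρ R ⊆ annulus r R := fun t ht => ⟨hρ.trans ht.1, ht.2⟩
  have h2 : windInt γ ρ (γ s) = windInt γ ρ (γ s') := by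
    refine windInt_eq_of_isPreconnected hρ0 hA hγ (hsph ρ hρ (hρ1.trans hR))
      ((isPreconnected_annulus (R := R) hρ0.le).image γ (hγ.continuousOn.mono hsubA)) ?_
      ⟨s, ⟨hρs, hsA.2⟩, rfl⟩ ⟨s', ⟨hρ1.trans hs'.1, hsA'.2⟩, rfl⟩
    rintro _ ⟨t, ht, rfl⟩ ⟨t', ht', he⟩
    have := hinj (hsph ρ hρ (hρ1.trans hR) ht') (hsubA ht) he
    rw [this, mem_sphere_zero_iff_norm] at ht'
    exact ht.1.ne' ht'
  have j1 := windInt_jump hr hγ hinj hder hρ hρ1 hR hsA hρs.ne' hs.2.ne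
  have j2 := windInt_jump hr hγ hinj hder hρ hρ1 hR hsA' (hρ1.trans hs'.1).ne' hs'.1.ne'
  rw [circleIntegral.integral_sub_inv_of_mem_ball (by simpa using hs.2),
    circleIntegral_inv_of_lt hρ0.le hρs, h1, h2, j2, circleIntegral_inv_of_lt zero_le_one hs'.1,
    circleIntegral_inv_of_lt hρ0.le (hρ1.trans hs'.1)] at j1
  simp [Real.pi_ne_zero] at j1

end

section

theorem exists_cannulus_subset {N : Set ℂ} (hN : N ∈ 𝓝ˢ (sphere (0:ℂ) 1)) :
    ∃ r, 0 < r ∧ r < 1 ∧ cannulus r r⁻¹ ⊆ N := by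
  obtain ⟨U, hU, hSU, hUN⟩ := mem_nhdsSet_iff_exists.1 hN
  obtain ⟨δ, hδ, hsub⟩ := (isCompact_sphere (0:ℂ) 1).exists_thickening_subset_open hU hSU
  have h1 : Tendsto (fun r : ℝ => r⁻¹) (𝓝[<] 1) (𝓝 1) := by
    have : ContinuousAt (fun r : ℝ => r⁻¹) 1 := by fun_prop (disch := norm_num)
    have := this.tendsto
    simp only [inv_one] at this
    exact this.mono_left nhdsWithin_le_nhds
  have h2 : ∀ᶠ r in 𝓝[<] (1:ℝ), r⁻¹ < 1 + δ := h1.eventually (gt_mem_nhds (by linarith))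
  have h3 : ∀ᶠ r in 𝓝[<] (1:ℝ), max 0 (1 - δ) < r :=
    nhdsWithin_le_nhds (lt_mem_nhds (max_lt one_pos (by linarith)))
  obtain ⟨r, h2, h3, h4⟩ := (h2.and (h3.and self_mem_nhdsWithin)).exists
  refine ⟨r, (le_max_left _ _).trans_lt h3, h4, fun t ht => hUN (hsub ?_)⟩
  have hr0 := (le_max_left (0:ℝ) (1-δ)).trans_lt h3
  have ht1 : r ≤ ‖t‖ := ht.1
  have ht2 : ‖t‖ ≤ r⁻¹ := ht.2
  have ht0 : 0 < ‖t‖ := hr0.trans_le ht1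
  have h5 := (le_max_right (0:ℝ) (1-δ)).trans_lt h3
  rw [mem_thickening_iff]
  have hne : (‖t‖:ℂ) ≠ 0 := by exact_mod_cast ht0.ne'
  refine ⟨t / ‖t‖, by simp [ht0.ne'], ?_⟩
  have : t - t / ‖t‖ = (t / ‖t‖) * ((‖t‖ - 1 : ℝ) : ℂ) := by push_cast; field_simp
  rw [dist_eq_norm, this, norm_mul, norm_div, Complex.norm_real, Complex.norm_real, norm_norm,
    div_self ht0.ne', one_mul, Real.norm_eq_abs, abs_lt]
  constructor <;> linarith

theorem exists_bilipschitz {γ : ℂ → ℂ} {K : Set ℂ} (hK : IsCompact K)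
    (hγ : ∀ t ∈ K, AnalyticAt ℂ γ t) (hinj : InjOn γ K) (hder : ∀ t ∈ K, deriv γ t ≠ 0) :
    ∃ B, 1 ≤ B ∧ ∀ s ∈ K, ∀ t ∈ K, ‖γ s - γ t‖ ≤ B * ‖s - t‖ ∧ ‖s - t‖ ≤ B * ‖γ s - γ t‖ := by
  suffices h : ∃ B, 1 ≤ B ∧ ∀ p ∈ K ×ˢ K, ‖γ p.1 - γ p.2‖ ≤ B * ‖p.1 - p.2‖ ∧
      ‖p.1 - p.2‖ ≤ B * ‖γ p.1 - γ p.2‖ by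
    obtain ⟨B, h1, h2⟩ := h
    exact ⟨B, h1, fun s hs t ht => h2 (s, t) ⟨hs, ht⟩⟩
  refine (hK.prod hK).induction_on (p := fun S : Set (ℂ × ℂ) => ∃ B, 1 ≤ B ∧ ∀ p ∈ S,
    ‖γ p.1 - γ p.2‖ ≤ B * ‖p.1 - p.2‖ ∧ ‖p.1 - p.2‖ ≤ B * ‖γ p.1 - γ p.2‖) ?_ ?_ ?_ ?_
  · exact ⟨1, le_rfl, by simp⟩
  · rintro S T hST ⟨B, h1, h2⟩
    exact ⟨B, h1, fun p hp => h2 p (hST hp)⟩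
  · rintro S T ⟨B, h1, h2⟩ ⟨B', h1', h2'⟩
    refine ⟨max B B', h1.trans (le_max_left _ _), ?_⟩
    rintro p (hp | hp)
    · exact ⟨(h2 p hp).1.trans (by gcongr; exact le_max_left _ _),
        (h2 p hp).2.trans (by gcongr; exact le_max_left _ _)⟩
    · exact ⟨(h2' p hp).1.trans (by gcongr; exact le_max_right _ _),
        (h2' p hp).2.trans (by gcongr; exact le_max_right _ _)⟩
  · rintro ⟨s, t⟩ ⟨hs, ht⟩
    suffices h : ∃ B, ∀ᶠ p in 𝓝 (s, t), ‖γ p.1 - γ p.2‖ ≤ B * ‖p.1 - p.2‖ ∧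
        ‖p.1 - p.2‖ ≤ B * ‖γ p.1 - γ p.2‖ by
      obtain ⟨B, hB⟩ := h
      refine ⟨_, mem_nhdsWithin_of_mem_nhds hB, max B 1, le_max_right _ _, fun p hp => ?_⟩
      exact ⟨hp.1.trans (by gcongr; exact le_max_left _ _),
        hp.2.trans (by gcongr; exact le_max_left _ _)⟩
    by_cases hst : s = t
    · subst hst
      have hstr := (hγ s hs).hasStrictDerivAt
      have hc : 0 < ‖deriv γ s‖ := norm_pos_iff.2 (hder s hs)
      have := hstr.hasStrictFDerivAt.isLittleO.bound (half_pos hc)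
      refine ⟨2 * ‖deriv γ s‖ + 2 / ‖deriv γ s‖, this.mono fun p hp => ?_⟩
      simp only [ContinuousLinearMap.toSpanSingleton_apply, smul_eq_mul] at hp
      have e1 : ‖γ p.1 - γ p.2‖ ≤ ‖γ p.1 - γ p.2 - (p.1 - p.2) * deriv γ s‖
        + ‖p.1 - p.2‖ * ‖deriv γ s‖ := by
        rw [← norm_mul]; simpa using norm_add_le (γ p.1 - γ p.2 - (p.1 - p.2) * deriv γ s) ((p.1 - p.2) * deriv γ s)
      have e2 : ‖p.1 - p.2‖ * ‖deriv γ s‖ ≤ ‖γ p.1 - γ p.2 - (p.1 - p.2) * deriv γ s‖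
        + ‖γ p.1 - γ p.2‖ := by
        rw [← norm_mul, add_comm, norm_sub_rev (γ p.1 - γ p.2)]
        simpa using norm_add_le (γ p.1 - γ p.2) ((p.1 - p.2) * deriv γ s - (γ p.1 - γ p.2))
      have e3 : 0 ≤ 2 / ‖deriv γ s‖ := by positivity
      constructor
      · nlinarith [norm_nonneg (p.1 - p.2)]
      · have : ‖p.1 - p.2‖ ≤ 2 / ‖deriv γ s‖ * ‖γ p.1 - γ p.2‖ := by
          rw [div_mul_eq_mul_div, le_div_iff₀ hc]; linarith
        nlinarith [norm_nonneg (γ p.1 - γ p.2)]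
    · have hne : γ s ≠ γ t := fun h => hst (hinj hs ht h)
      have hc1 : ContinuousAt (fun p : ℂ × ℂ => γ p.1 - γ p.2) (s, t) :=
        ((hγ s hs).continuousAt.comp (x := (s,t)) continuousAt_fst).sub
          ((hγ t ht).continuousAt.comp (x := (s,t)) continuousAt_snd)
      have hc2 : ContinuousAt (fun p : ℂ × ℂ => p.1 - p.2) (s, t) := by fun_prop
      have n1 : 0 < ‖γ s - γ t‖ := norm_pos_iff.2 (sub_ne_zero.2 hne)
      have n2 : 0 < ‖s - t‖ := norm_pos_iff.2 (sub_ne_zero.2 hst)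
      have q1 := (hc1.norm.tendsto.eventually (gt_mem_nhds (lt_two_mul_self n1)))
      have q2 := (hc1.norm.tendsto.eventually (lt_mem_nhds (half_lt_self n1)))
      have q3 := (hc2.norm.tendsto.eventually (gt_mem_nhds (lt_two_mul_self n2)))
      have q4 := (hc2.norm.tendsto.eventually (lt_mem_nhds (half_lt_self n2)))
      refine ⟨4 * ‖γ s - γ t‖ / ‖s - t‖ + 4 * ‖s - t‖ / ‖γ s - γ t‖, ?_⟩
      filter_upwards [q1, q2, q3, q4] with p p1 p2 p3 p4
      have f1 : 2 * ‖γ s - γ t‖ ≤ 4 * ‖γ s - γ t‖ / ‖s - t‖ * ‖p.1 - p.2‖ := by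
        rw [div_mul_eq_mul_div, le_div_iff₀ n2]; nlinarith
      have f2 : 2 * ‖s - t‖ ≤ 4 * ‖s - t‖ / ‖γ s - γ t‖ * ‖γ p.1 - γ p.2‖ := by
        rw [div_mul_eq_mul_div, le_div_iff₀ n1]; nlinarith
      have f3 : 0 ≤ 4 * ‖γ s - γ t‖ / ‖s - t‖ * ‖γ p.1 - γ p.2‖ := by positivity
      have f4 : 0 ≤ 4 * ‖s - t‖ / ‖γ s - γ t‖ * ‖p.1 - p.2‖ := by positivity
      constructor <;> rw [add_mul] <;> linarith

/-- A bi-Lipschitz conformal collar of a boundary curve of `Ω`, the inner half lying in `Ω`. -/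
structure IsCollar (Ω : Set ℂ) (γ : ℂ → ℂ) (r B : ℝ) : Prop where
  r_pos : 0 < r
  r_lt : r < 1
  one_le : 1 ≤ B
  diff : DifferentiableOn ℂ γ (annulus r r⁻¹)
  deriv_ne : ∀ t ∈ annulus r r⁻¹, deriv γ t ≠ 0
  inner : ∀ t ∈ annulus r 1, γ t ∈ Ω
  bdry : ∀ t ∈ sphere (0:ℂ) 1, γ t ∈ frontier Ω
  outer : ∀ t ∈ annulus 1 r⁻¹, γ t ∉ closure Ω
  lip : ∀ s ∈ annulus r r⁻¹, ∀ t ∈ annulus r r⁻¹, ‖γ s - γ t‖ ≤ B * ‖s - t‖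
  antilip : ∀ s ∈ annulus r r⁻¹, ∀ t ∈ annulus r r⁻¹, ‖s - t‖ ≤ B * ‖γ s - γ t‖

theorem annulus_mono {r r' R R' : ℝ} (h : r' ≤ r) (h' : R ≤ R') : annulus r R ⊆ annulus r' R' :=
  fun _ ht => ⟨h.trans_lt ht.1, ht.2.trans_le h'⟩

theorem sphere_subset_annulus {r R : ℝ} (hr : r < 1) (hR : 1 < R) : sphere (0:ℂ) 1 ⊆ annulus r R :=
  fun t ht => by
    rw [mem_sphere_zero_iff_norm] at ht
    exact ⟨by rwa [ht], by rwa [ht]⟩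

theorem IsCollar.mono {Ω : Set ℂ} {γ : ℂ → ℂ} {r B r' B' : ℝ} (h : IsCollar Ω γ r B)
    (hr : r ≤ r') (hr1 : r' < 1) (hB : B ≤ B') : IsCollar Ω γ r' B' := by
  have h0 := h.r_pos.trans_le hr
  have hi : r'⁻¹ ≤ r⁻¹ := inv_anti₀ h.r_pos hr
  have hs : annulus r' r'⁻¹ ⊆ annulus r r⁻¹ := annulus_mono hr hi
  exact ⟨h0, hr1, h.one_le.trans hB, h.diff.mono hs, fun t ht => h.deriv_ne t (hs ht),
    fun t ht => h.inner t (annulus_mono hr le_rfl ht), h.bdry,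
    fun t ht => h.outer t (annulus_mono le_rfl hi ht),
    fun s h1 t h2 => (h.lip s (hs h1) t (hs h2)).trans (by gcongr),
    fun s h1 t h2 => (h.antilip s (hs h1) t (hs h2)).trans (by gcongr)⟩

theorem IsCollar.injOn {Ω : Set ℂ} {γ : ℂ → ℂ} {r B : ℝ} (h : IsCollar Ω γ r B) :
    InjOn γ (annulus r r⁻¹) := fun s hs t ht e => by
  have := h.antilip s hs t ht
  rw [e, sub_self, norm_zero, mul_zero] at this
  exact sub_eq_zero.1 (norm_le_zero_iff.1 this)

theorem inv_mem_annulus {r : ℝ} (hr : 0 < r) {t : ℂ} (ht : t ∈ annulus r r⁻¹) :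
    t⁻¹ ∈ annulus r r⁻¹ := by
  have h0 : 0 < ‖t‖ := hr.trans ht.1
  exact ⟨by rw [norm_inv]; exact (lt_inv_comm₀ hr h0).2 ht.2,
    by rw [norm_inv]; exact inv_strictAnti₀ hr ht.1⟩

theorem exists_curve_annulus {C V : Set ℂ} (hC : IsAnalyticCurve C) (hV : IsOpen V) (hCV : C ⊆ V) :
    ∃ (γ : ℂ → ℂ) (r : ℝ), 0 < r ∧ r < 1 ∧ DifferentiableOn ℂ γ (annulus r r⁻¹) ∧
      InjOn γ (annulus r r⁻¹) ∧ (∀ t ∈ annulus r r⁻¹, deriv γ t ≠ 0) ∧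
      γ '' sphere (0:ℂ) 1 = C ∧ MapsTo γ (annulus r r⁻¹) V := by
  obtain ⟨γ, hγ, hinj, himg, hder⟩ := hC
  have hK := isCompact_sphere (0:ℂ) 1
  obtain ⟨N, hN, hNi⟩ := hinj.exists_mem_nhdsSet hK (fun t ht => (hγ t ht).continuousAt)
    (fun t ht => by
      have hst := (hγ t ht).hasStrictDerivAt.hasStrictFDerivAt_equiv (hder t ht)
      have hi := (hst.toOpenPartialHomeomorph γ).injOn
      rw [hst.toOpenPartialHomeomorph_coe] at hi
      exact ⟨_, (hst.toOpenPartialHomeomorph γ).open_source.mem_nhds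
        hst.mem_toOpenPartialHomeomorph_source, hi⟩)
  have h1 : {t | AnalyticAt ℂ γ t} ∈ 𝓝ˢ (sphere (0:ℂ) 1) :=
    (isOpen_analyticAt ℂ γ).mem_nhdsSet.2 hγ
  have h2 : {t | deriv γ t ≠ 0} ∈ 𝓝ˢ (sphere (0:ℂ) 1) :=
    mem_nhdsSet_iff_forall.2 fun t ht => (hγ t ht).deriv.continuousAt.eventually_ne (hder t ht)
  have h3 : γ ⁻¹' V ∈ 𝓝ˢ (sphere (0:ℂ) 1) :=
    mem_nhdsSet_iff_forall.2 fun t ht => (hγ t ht).continuousAt.preimage_mem_nhds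
      (hV.mem_nhds (hCV (himg ▸ mem_image_of_mem γ ht)))
  obtain ⟨r, hr, hr1, hsub⟩ := exists_cannulus_subset (inter_mem (inter_mem hN h1) (inter_mem h2 h3))
  have hs : annulus r r⁻¹ ⊆ cannulus r r⁻¹ := annulus_subset_cannulus _ _
  exact ⟨γ, r, hr, hr1, fun t ht => (hsub (hs ht)).1.2.differentiableAt.differentiableWithinAt,
    hNi.mono fun t ht => (hsub (hs ht)).1.1, fun t ht => (hsub (hs ht)).2.1, himg,
    fun t ht => (hsub (hs ht)).2.2⟩

theorem exists_isCollar {Ω C V : Set ℂ} (hΩ : IsOpen Ω) (hconn : IsPreconnected Ω)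
    (hC : IsAnalyticCurve C) (hCf : C ⊆ frontier Ω) (hV : IsOpen V) (hCV : C ⊆ V)
    (hVf : V ∩ frontier Ω ⊆ C) :
    ∃ (γ : ℂ → ℂ) (r B : ℝ), IsCollar Ω γ r B ∧ γ '' sphere (0:ℂ) 1 = C ∧
      MapsTo γ (annulus r r⁻¹) V := by
  obtain ⟨γ, r, hr, hr1, hγ, hinj, hder, himg, hmaps⟩ := exists_curve_annulus hC hV hCV
  have hR : 1 < r⁻¹ := (one_lt_inv₀ hr).2 hr1
  have hA := isOpen_annulus r r⁻¹
  have hS : sphere (0:ℂ) 1 ⊆ annulus r r⁻¹ := sphere_subset_annulus hr1 hR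
  have hoff : ∀ t ∈ annulus r r⁻¹, ‖t‖ ≠ 1 → γ t ∉ frontier Ω := fun t ht h1 h2 => by
    have := hVf ⟨hmaps ht, h2⟩
    rw [← himg] at this
    obtain ⟨s, hs, he⟩ := this
    rw [← hinj (hS hs) ht he] at h1
    exact h1 (mem_sphere_zero_iff_norm.1 hs)
  have hside : ∀ A : Set ℂ, IsPreconnected A → A ⊆ annulus r r⁻¹ → (∀ t ∈ A, ‖t‖ ≠ 1) →
      γ '' A ⊆ Ω ∨ γ '' A ⊆ (closure Ω)ᶜ := fun A hA1 hA2 hA3 => by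
    refine (hA1.image γ (hγ.continuousOn.mono hA2)).subset_or_subset hΩ isClosed_closure.isOpen_compl
      (disjoint_compl_right.mono_left subset_closure) ?_
    rintro _ ⟨t, ht, rfl⟩
    by_cases h : γ t ∈ closure Ω
    · left
      by_contra h'
      exact hoff t (hA2 ht) (hA3 t ht) (by rw [frontier, hΩ.interior_eq]; exact ⟨h, h'⟩)
    · exact Or.inr h
  have hi := hside (annulus r 1) (isPreconnected_annulus hr.le) (annulus_mono le_rfl hR.le)
    (fun t ht => ht.2.ne)
  have ho := hside (annulus 1 r⁻¹) (isPreconnected_annulus zero_le_one) (annulus_mono hr1.le le_rfl)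
    (fun t ht => ht.1.ne')
  -- the general conclusion once sides are known
  have key : ∀ δ : ℂ → ℂ, DifferentiableOn ℂ δ (annulus r r⁻¹) → InjOn δ (annulus r r⁻¹) →
      (∀ t ∈ annulus r r⁻¹, deriv δ t ≠ 0) → δ '' sphere (0:ℂ) 1 = C →
      MapsTo δ (annulus r r⁻¹) V → δ '' annulus r 1 ⊆ Ω → δ '' annulus 1 r⁻¹ ⊆ (closure Ω)ᶜ →
      ∃ (γ : ℂ → ℂ) (r B : ℝ), IsCollar Ω γ r B ∧ γ '' sphere (0:ℂ) 1 = C ∧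
      MapsTo γ (annulus r r⁻¹) V := by
    intro δ h1 h2 h3 h4 h5 h6 h7
    obtain ⟨r', hr', hr1'⟩ := exists_between hr1
    have h0 := hr.trans hr'
    have hi' : r'⁻¹ < r⁻¹ := inv_strictAnti₀ hr hr'
    have hsub : cannulus r' r'⁻¹ ⊆ annulus r r⁻¹ :=
      fun t ht => ⟨hr'.trans_le ht.1, lt_of_le_of_lt ht.2 hi'⟩
    obtain ⟨B, hB, hbl⟩ := exists_bilipschitz (γ := δ) (isCompact_cannulus (r := r') (R := r'⁻¹))
      (fun t ht => h1.analyticAt (hA.mem_nhds (hsub ht))) (h2.mono hsub)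
      (fun t ht => h3 t (hsub ht))
    have hs : annulus r' r'⁻¹ ⊆ cannulus r' r'⁻¹ := annulus_subset_cannulus _ _
    refine ⟨δ, r', B, ⟨h0, hr1', hB, h1.mono (hs.trans hsub), fun t ht => h3 t (hsub (hs ht)),
      fun t ht => h6 ⟨t, annulus_mono hr'.le le_rfl ht, rfl⟩,
      fun t ht => hCf (h4 ▸ mem_image_of_mem δ ht),
      fun t ht => h7 ⟨t, annulus_mono le_rfl hi'.le ht, rfl⟩,
      fun s hs1 t ht1 => (hbl s (hs hs1) t (hs ht1)).1,
      fun s hs1 t ht1 => (hbl s (hs hs1) t (hs ht1)).2⟩, h4, fun t ht => h5 (hsub (hs ht))⟩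
  have hfd : Disjoint Ω (frontier Ω) := by
    rw [frontier, hΩ.interior_eq]; exact disjoint_sdiff_right
  have hnotd : ∀ z ∈ Ω, z ∉ γ '' sphere (0:ℂ) 1 := fun z hz h =>
    disjoint_left.1 hfd hz (hCf (himg ▸ h))
  have hmid : ∃ ρ : ℝ, r < ρ ∧ ρ < 1 := exists_between hr1
  have hmid' : ∃ ρ : ℝ, 1 < ρ ∧ ρ < r⁻¹ := exists_between hR
  obtain ⟨ρ, hρ, hρ1⟩ := hmid
  obtain ⟨ρ', hρ', hρ1'⟩ := hmid'
  have m1 : ((ρ:ℝ):ℂ) ∈ annulus r 1 := by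
    refine ⟨?_, ?_⟩ <;> rw [Complex.norm_real, Real.norm_eq_abs, abs_of_pos (hr.trans hρ)] <;> assumption
  have m2 : ((ρ':ℝ):ℂ) ∈ annulus 1 r⁻¹ := by
    refine ⟨?_, ?_⟩ <;> rw [Complex.norm_real, Real.norm_eq_abs, abs_of_pos (one_pos.trans hρ')] <;> assumption
  rcases hi with hi | hi <;> rcases ho with ho | ho
  · exact (not_both_sides hr.le hr1 hγ hinj hder hconn hnotd m1 m2
      (hi ⟨_, m1, rfl⟩) (ho ⟨_, m2, rfl⟩)).elim
  · exact key γ hγ hinj hder himg hmaps hi ho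
  · refine key (fun t => γ t⁻¹) ?_ ?_ ?_ ?_ ?_ ?_ ?_
    · exact hγ.comp (differentiableOn_inv.mono fun t ht => norm_pos_iff.1 (hr.trans ht.1))
        fun t ht => inv_mem_annulus hr ht
    · exact fun s hs t ht e => inv_injective (hinj (inv_mem_annulus hr hs) (inv_mem_annulus hr ht) e)
    · intro t ht
      have ht0 : t ≠ 0 := norm_pos_iff.1 (hr.trans ht.1)
      have := ((hγ.differentiableAt (hA.mem_nhds (inv_mem_annulus hr ht))).hasDerivAt.comp t
        (hasDerivAt_inv ht0)).deriv
      change deriv (γ ∘ Inv.inv) t ≠ 0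
      rw [this]
      exact mul_ne_zero (hder _ (inv_mem_annulus hr ht)) (by simpa using ht0)
    · rw [← himg]
      ext z
      constructor
      · rintro ⟨t, ht, rfl⟩
        exact ⟨t⁻¹, by simpa using ht, rfl⟩
      · rintro ⟨t, ht, rfl⟩
        exact ⟨t⁻¹, by simpa using ht, by simp⟩
    · exact fun t ht => hmaps (inv_mem_annulus hr ht)
    · rintro _ ⟨t, ht, rfl⟩
      have h0 : 0 < ‖t‖ := hr.trans ht.1
      exact ho ⟨t⁻¹, ⟨by rw [norm_inv]; exact (one_lt_inv₀ h0).2 ht.2,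
        by rw [norm_inv]; exact inv_strictAnti₀ hr ht.1⟩, rfl⟩
    · rintro _ ⟨t, ht, rfl⟩
      have h0 : 0 < ‖t‖ := one_pos.trans ht.1
      exact hi ⟨t⁻¹, ⟨by rw [norm_inv]; exact (lt_inv_comm₀ hr h0).2 ht.2,
        by rw [norm_inv]; exact (inv_lt_one₀ h0).2 ht.1⟩, rfl⟩
  · exfalso
    have h1S : (1:ℂ) ∈ sphere (0:ℂ) 1 := by simp
    have hstr := ((hγ.analyticAt (hA.mem_nhds (hS h1S))).hasStrictDerivAt)
    have hmap := hstr.map_nhds_eq (hder 1 (hS h1S))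
    have himgn : γ '' annulus r r⁻¹ ∈ 𝓝 (γ 1) := by
      rw [← hmap]; exact image_mem_map (hA.mem_nhds (hS h1S))
    have hcl : γ 1 ∈ closure Ω := (hCf (himg ▸ mem_image_of_mem γ h1S)).1
    obtain ⟨z, ⟨t, ht, rfl⟩, hz⟩ := mem_closure_iff_nhds.1 hcl _ himgn
    rcases lt_trichotomy ‖t‖ 1 with h | h | h
    · exact hi ⟨t, ⟨ht.1, h⟩, rfl⟩ (subset_closure hz)
    · exact hnotd _ hz ⟨t, mem_sphere_zero_iff_norm.2 h, rfl⟩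
    · exact ho ⟨t, ⟨h, ht.2⟩, rfl⟩ (subset_closure hz)

end

section

namespace IsCollar

variable {Ω : Set ℂ} {γ : ℂ → ℂ} {r B : ℝ}

theorem one_lt_inv (h : IsCollar Ω γ r B) : 1 < r⁻¹ := (one_lt_inv₀ h.r_pos).2 h.r_lt

theorem sphere_subset (h : IsCollar Ω γ r B) : sphere (0:ℂ) 1 ⊆ annulus r r⁻¹ :=
  sphere_subset_annulus h.r_lt h.one_lt_inv

theorem inner_subset (h : IsCollar Ω γ r B) : annulus r 1 ⊆ annulus r r⁻¹ :=
  annulus_mono le_rfl h.one_lt_inv.le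

theorem B_pos (h : IsCollar Ω γ r B) : 0 < B := one_pos.trans_le h.one_le

theorem analyticAt (h : IsCollar Ω γ r B) {t : ℂ} (ht : t ∈ annulus r r⁻¹) : AnalyticAt ℂ γ t :=
  h.diff.analyticAt ((isOpen_annulus _ _).mem_nhds ht)

theorem map_nhds (h : IsCollar Ω γ r B) {t : ℂ} (ht : t ∈ annulus r r⁻¹) :
    map γ (𝓝 t) = 𝓝 (γ t) :=
  (h.analyticAt ht).hasStrictDerivAt.map_nhds_eq (h.deriv_ne t ht)

theorem isOpen_image (h : IsCollar Ω γ r B) {U : Set ℂ} (hU : IsOpen U) (hUA : U ⊆ annulus r r⁻¹) :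
    IsOpen (γ '' U) := by
  refine isOpen_iff_mem_nhds.2 ?_
  rintro _ ⟨t, ht, rfl⟩
  rw [← h.map_nhds (hUA ht)]
  exact image_mem_map (hU.mem_nhds ht)

theorem exists_inverse (h : IsCollar Ω γ r B) : ∃ ψ : ℂ → ℂ,
    DifferentiableOn ℂ ψ (γ '' annulus r r⁻¹) ∧ ∀ t ∈ annulus r r⁻¹, ψ (γ t) = t := by
  have hl : LeftInvOn (Function.invFunOn γ (annulus r r⁻¹)) γ (annulus r r⁻¹) :=
    h.injOn.leftInvOn_invFunOn
  refine ⟨Function.invFunOn γ (annulus r r⁻¹), ?_, hl⟩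
  rintro _ ⟨t, ht, rfl⟩
  have ho := h.isOpen_image (isOpen_annulus r r⁻¹) le_rfl
  have hn := ho.mem_nhds (mem_image_of_mem γ ht)
  have hc : ContinuousAt (Function.invFunOn γ (annulus r r⁻¹)) (γ t) := by
    rw [ContinuousAt, hl ht, tendsto_iff_norm_sub_tendsto_zero]
    have : Tendsto (fun z => B * ‖z - γ t‖) (𝓝 (γ t)) (𝓝 0) := by
      have : ContinuousAt (fun z => B * ‖z - γ t‖) (γ t) := by fun_prop
      simpa using this.tendsto
    refine squeeze_zero' (.of_forall fun _ => norm_nonneg _) ?_ this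
    filter_upwards [hn] with z hz
    obtain ⟨s, hs, rfl⟩ := hz
    rw [hl hs]
    exact h.antilip s hs t ht
  refine (HasDerivAt.of_local_left_inverse (f := γ) (f' := deriv γ t) hc ?_ (h.deriv_ne t ht)
    ?_).differentiableAt.differentiableWithinAt
  · rw [hl ht]; exact (h.analyticAt ht).differentiableAt.hasDerivAt
  · filter_upwards [hn] with z hz
    obtain ⟨s, hs, rfl⟩ := hz
    rw [hl hs]

theorem le_one_of_mem_closure (h : IsCollar Ω γ r B) {t : ℂ} (ht : t ∈ annulus r r⁻¹)
    (hc : γ t ∈ closure Ω) : ‖t‖ ≤ 1 :=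
  not_lt.1 fun hlt => h.outer t ⟨hlt, ht.2⟩ hc

theorem lt_one_of_mem (h : IsCollar Ω γ r B) (hΩ : IsOpen Ω) {t : ℂ} (ht : t ∈ annulus r r⁻¹)
    (hc : γ t ∈ Ω) : ‖t‖ < 1 := by
  refine (h.le_one_of_mem_closure ht (subset_closure hc)).lt_of_ne fun h1 => ?_
  have := h.bdry t (mem_sphere_zero_iff_norm.2 h1)
  rw [frontier, hΩ.interior_eq] at this
  exact this.2 hc

theorem infDist_le (h : IsCollar Ω γ r B) (hΩ : IsOpen Ω) {t : ℂ} (ht : t ∈ annulus r 1) :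
    infDist (γ t) Ωᶜ ≤ B * (1 - ‖t‖) := by
  have ht0 : 0 < ‖t‖ := h.r_pos.trans ht.1
  have hs : t / ‖t‖ ∈ sphere (0:ℂ) 1 := by simp [ht0.ne']
  have hb := h.bdry _ hs
  rw [frontier, hΩ.interior_eq] at hb
  refine (infDist_le_dist_of_mem hb.2).trans ?_
  rw [dist_eq_norm]
  refine (h.lip _ (h.inner_subset ht) _ (h.sphere_subset hs)).trans_eq ?_
  have hne : (‖t‖:ℂ) ≠ 0 := by exact_mod_cast ht0.ne'
  have : t - t / ‖t‖ = (t / ‖t‖) * ((‖t‖ - 1 : ℝ) : ℂ) := by push_cast; field_simp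
  rw [this, norm_mul, mem_sphere_zero_iff_norm.1 hs, Complex.norm_real, Real.norm_eq_abs, one_mul,
    abs_of_neg (by linarith [ht.2])]
  ring

theorem le_infDist (h : IsCollar Ω γ r B) (hne : Ωᶜ.Nonempty) {t : ℂ} (ht : t ∈ annulus ((1 + r) / 2) 1) :
    (1 - ‖t‖) / (4 * B) ≤ infDist (γ t) Ωᶜ := by
  have h1 := ht.1
  have h2 := ht.2
  have hsub : closedBall t ((1 - ‖t‖) / 2) ⊆ annulus r 1 := fun s hs => by
    rw [mem_closedBall_iff_norm] at hs
    have e1 := norm_sub_norm_le t s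
    have e2 := norm_sub_norm_le s t
    rw [norm_sub_rev] at e1
    exact ⟨by linarith [h.r_lt], by linarith⟩
  have hs2 := hsub.trans h.inner_subset
  have htA := hs2 (mem_closedBall_self (by linarith))
  have hball : ball (γ t) ((1 - ‖t‖) / 2 / B / 2) ⊆ γ '' closedBall t ((1 - ‖t‖) / 2) := by
    refine DiffContOnCl.ball_subset_image_closedBall ?_ (by linarith) (fun s hs => ?_) ?_
    · exact (h.diff.mono hs2).diffContOnCl_ball le_rfl
    · have := h.antilip s (hs2 (sphere_subset_closedBall hs)) t htA
      rw [mem_sphere_iff_norm.1 hs] at this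
      rw [div_le_iff₀ h.B_pos]; linarith
    · refine (Filter.Eventually.frequently (f := 𝓝[≠] t) ?_).filter_mono nhdsWithin_le_nhds
      filter_upwards [self_mem_nhdsWithin, mem_nhdsWithin_of_mem_nhds
        ((isOpen_annulus r r⁻¹).mem_nhds htA)] with s hs hsA he
      exact hs (h.injOn hsA htA he)
  have hB := h.B_pos
  refine (Metric.le_infDist hne).2 fun {y} hy => ?_
  by_contra hlt
  push Not at hlt
  have : y ∈ ball (γ t) ((1 - ‖t‖) / 2 / B / 2) := by
    rw [mem_ball, dist_comm]
    refine hlt.trans_eq ?_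
    field_simp; norm_num
  obtain ⟨s, hs, rfl⟩ := hball this
  exact hy (h.inner s (hsub hs))

theorem ntLim_iff (h : IsCollar Ω γ r B) (hΩ : IsOpen Ω) (F : ℂ → ℂ) {τ : ℂ}
    (hτ : τ ∈ sphere (0:ℂ) 1) (L : ℂ) :
    NTLim Ω F (γ τ) L ↔ ∀ A, Tendsto (fun t => F (γ t)) (𝓝[stolz A τ] τ) (𝓝 L) := by
  have hτA := h.sphere_subset hτ
  have hτ1 := mem_sphere_zero_iff_norm.1 hτ
  have hne : Ωᶜ.Nonempty := ⟨γ τ, by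
    have := h.bdry τ hτ
    rw [frontier, hΩ.interior_eq] at this
    exact this.2⟩
  have hB := h.B_pos
  constructor
  · intro hN A
    have ha : (1:ℝ) < 4 * |A| * B ^ 2 + 2 := by nlinarith [abs_nonneg A, sq_nonneg B]
    refine (hN _ ha).comp (tendsto_nhdsWithin_iff.2 ⟨?_, ?_⟩)
    · exact ((h.analyticAt hτA).continuousAt.tendsto).mono_left nhdsWithin_le_nhds
    · have hnear : ∀ᶠ t in 𝓝[stolz A τ] τ, (1 + r) / 2 < ‖t‖ := by
        refine nhdsWithin_le_nhds (continuous_norm.continuousAt.eventually (lt_mem_nhds ?_))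
        simp only [hτ1]; linarith [h.r_lt]
      filter_upwards [hnear, self_mem_nhdsWithin] with t ht hst
      have ht1 : ‖t‖ < 1 := by simpa using hst.1
      have hst2 : ‖t - τ‖ ≤ A * (1 - ‖t‖) := hst.2
      have htA : t ∈ annulus r 1 := ⟨by linarith [h.r_lt], ht1⟩
      refine ⟨h.inner t htA, ?_⟩
      have e1 := h.lip t (h.inner_subset htA) τ hτA
      have e2 := h.le_infDist hne ⟨ht, ht1⟩
      have e3 : 0 < (1 - ‖t‖) / (4 * B) := by have : 0 < 1 - ‖t‖ := by linarith
                                              positivity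
      have e5 : 1 - ‖t‖ ≤ infDist (γ t) Ωᶜ * (4 * B) := (div_le_iff₀ (by positivity)).1 e2
      have e4 : ‖t - τ‖ ≤ |A| * (infDist (γ t) Ωᶜ * (4 * B)) := by
        refine hst2.trans (mul_le_mul (le_abs_self A) e5 (by linarith) (abs_nonneg A))
      have e6 : B * ‖t - τ‖ ≤ B * (|A| * (infDist (γ t) Ωᶜ * (4 * B))) := by gcongr
      nlinarith
  · intro hS a ha
    rw [nhdsWithin, ← h.map_nhds hτA, ← map_inf_principal_preimage,
      tendsto_map'_iff]
    refine (hS (B * (a * B))).mono_left ?_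
    refine le_inf inf_le_left ?_
    refine le_principal_iff.2 ?_
    have hn : annulus r r⁻¹ ∈ 𝓝 τ := (isOpen_annulus r r⁻¹).mem_nhds hτA
    filter_upwards [mem_inf_of_left hn, mem_inf_of_right (mem_principal_self _)] with t htA ht
    have ht1 := h.lt_one_of_mem hΩ htA ht.1
    refine ⟨by simpa using ht1, ?_⟩
    refine (h.antilip t htA τ hτA).trans ?_
    have e1 := h.infDist_le hΩ ⟨htA.1, ht1⟩
    have e2 : ‖γ t - γ τ‖ < a * infDist (γ t) Ωᶜ := ht.2
    rw [mul_assoc]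
    gcongr
    refine e2.le.trans ?_
    rw [mul_assoc]
    gcongr

end IsCollar

end

section

/-- Disjoint collars of all boundary curves. -/
structure Collars (D : MCDomain n) where
  γ : Fin (n+1) → ℂ → ℂ
  r : ℝ
  B : ℝ
  collar : ∀ j, IsCollar D.Ω (γ j) r B
  image : ∀ j, γ j '' sphere (0:ℂ) 1 = D.Γ j
  disj : ∀ j k, j ≠ k → Disjoint (γ j '' annulus r r⁻¹) (γ k '' annulus r r⁻¹)

theorem IsAnalyticCurve.isCompact {C : Set ℂ} (h : IsAnalyticCurve C) : IsCompact C := by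
  obtain ⟨γ, hγ, -, rfl, -⟩ := h
  exact (isCompact_sphere _ _).image_of_continuousOn hγ.continuousOn

theorem IsAnalyticCurve.nonempty {C : Set ℂ} (h : IsAnalyticCurve C) : C.Nonempty := by
  obtain ⟨γ, hγ, -, rfl, -⟩ := h
  exact ⟨γ 1, 1, by simp, rfl⟩

theorem MCDomain.exists_collars (D : MCDomain n) : Nonempty (Collars D) := by
  let V : Fin (n+1) → Set ℂ := fun j => ⋂ k, {z | k ≠ j → infDist z (D.Γ j) < infDist z (D.Γ k)}
  have hVo : ∀ j, IsOpen (V j) := fun j => isOpen_iInter_of_finite fun k => by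
    by_cases h : k = j
    · simp [h]
    · simp only [ne_eq, h, not_false_eq_true, true_imp_iff]
      exact isOpen_lt (continuous_infDist_pt _) (continuous_infDist_pt _)
  have hΓV : ∀ j, D.Γ j ⊆ V j := fun j z hz => by
    refine mem_iInter.2 fun k hk => ?_
    rw [infDist_zero_of_mem hz]
    exact ((D.curve k).isCompact.isClosed.notMem_iff_infDist_pos (D.curve k).nonempty).1
      (disjoint_left.1 (D.disj j k hk.symm) hz)
  have hVd : ∀ j k, j ≠ k → Disjoint (V j) (V k) := fun j k hjk => by
    refine disjoint_left.2 fun z h1 h2 => ?_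
    have a1 := mem_iInter.1 h1 k hjk.symm
    have a2 := mem_iInter.1 h2 j hjk
    exact lt_asymm a1 a2
  have hVf : ∀ j, V j ∩ frontier D.Ω ⊆ D.Γ j := by
    rintro j z ⟨h1, h2⟩
    rw [D.frontier_eq] at h2
    obtain ⟨k, hk⟩ := mem_iUnion.1 h2
    by_contra hj
    have hjk : j ≠ k := fun h => hj (h ▸ hk)
    exact disjoint_left.1 (hVd j k hjk) h1 (hΓV k hk)
  have := fun j => exists_isCollar D.isOpen D.conn.isPreconnected (D.curve j)
    (by rw [D.frontier_eq]; exact subset_iUnion D.Γ j) (hVo j) (hΓV j) (hVf j)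
  choose γ r B hcol himg hmaps using this
  let r₀ := Finset.univ.sup' Finset.univ_nonempty r
  let B₀ := Finset.univ.sup' Finset.univ_nonempty B
  have hr : ∀ j, r j ≤ r₀ := fun j => Finset.le_sup' r (Finset.mem_univ j)
  have hB : ∀ j, B j ≤ B₀ := fun j => Finset.le_sup' B (Finset.mem_univ j)
  have hr1 : r₀ < 1 := (Finset.sup'_lt_iff _).2 fun j _ => (hcol j).r_lt
  refine ⟨⟨γ, r₀, B₀, fun j => (hcol j).mono (hr j) hr1 (hB j), himg, fun j k hjk => ?_⟩⟩
  have hsub : ∀ j, γ j '' annulus r₀ r₀⁻¹ ⊆ V j := fun j => by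
    rintro _ ⟨t, ht, rfl⟩
    exact hmaps j (annulus_mono (hr j) (inv_anti₀ (hcol j).r_pos (hr j)) ht)
  exact (hVd j k hjk).mono (hsub j) (hsub k)

theorem circleAverage_le_of_le {u v : ℂ → ℝ} {U : Set ℂ} (hu : ContinuousOn u U)
    (hv : ContinuousOn v U) (huv : ∀ w ∈ U, u w ≤ v w) {z : ℂ} {R r : ℝ} (hR : closedBall z R ⊆ U)
    (hr : 0 < r) (hrR : r ≤ R) : Real.circleAverage u z r ≤ Real.circleAverage v z r := by
  refine Real.circleAverage_mono (circleIntegrable_of_closedBall hu hR hr hrR)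
    (circleIntegrable_of_closedBall hv hR hr hrR) fun w hw => huv w (hR ?_)
  rw [abs_of_pos hr] at hw
  exact closedBall_subset_closedBall hrR (sphere_subset_closedBall hw)

theorem SubMeanAt.of_le {u v : ℂ → ℝ} {U : Set ℂ} (hU : IsOpen U) {z : ℂ} (hz : z ∈ U)
    (hu : ContinuousOn u U) (hv : ContinuousOn v U) (huv : ∀ w ∈ U, u w ≤ v w) (he : v z ≤ u z)
    (h : SubMeanAt u z) : SubMeanAt v z := by
  obtain ⟨ρ, hρ, hs⟩ := h
  obtain ⟨R, hR, hRU⟩ := exists_closedBall_subset hU hz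
  refine ⟨min ρ R, lt_min hρ hR, fun r hr hr1 => ?_⟩
  exact he.trans ((hs r hr (hr1.trans_le (min_le_left _ _))).trans
    (circleAverage_le_of_le hu hv huv hRU hr (hr1.trans_le (min_le_right _ _)).le))

theorem SubMeanAt.max {u v : ℂ → ℝ} {U : Set ℂ} (hU : IsOpen U) {z : ℂ} (hz : z ∈ U)
    (hcu : ContinuousOn u U) (hcv : ContinuousOn v U) (hu : SubMeanAt u z) (hv : SubMeanAt v z) :
    SubMeanAt (fun w => max (u w) (v w)) z := by
  have hc : ContinuousOn (fun w => Max.max (u w) (v w)) U := hcu.sup hcv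
  rcases le_total (u z) (v z) with h | h
  · exact SubMeanAt.of_le hU hz hcv hc (fun w _ => le_max_right _ _) (by simp [h]) hv
  · exact SubMeanAt.of_le hU hz hcu hc (fun w _ => le_max_left _ _) (by simp [h]) hu

theorem SubMeanAt.const_mul {u : ℂ → ℝ} {z : ℂ} (h : SubMeanAt u z) {c : ℝ} (hc : 0 ≤ c) :
    SubMeanAt (fun w => c * u w) z := by
  obtain ⟨ρ, hρ, hs⟩ := h
  refine ⟨ρ, hρ, fun r hr hr1 => ?_⟩
  have : Real.circleAverage (fun w => c * u w) z r = c * Real.circleAverage u z r := by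
    simpa using Real.circleAverage_fun_smul (a := c) (f := u) (c := z) (R := r)
  rw [this]
  exact mul_le_mul_of_nonneg_left (hs r hr hr1) hc

theorem subMeanAt_const (c : ℝ) (z : ℂ) : SubMeanAt (fun _ => c) z :=
  ⟨1, one_pos, fun r _ _ => by rw [Real.circleAverage_const]⟩

/-- A barrier for the Dirichlet problem. -/
def IsBarrier (Ω : Set ℂ) (ζ : ℂ) (b : ℂ → ℝ) : Prop :=
  ContinuousOn b (closure Ω) ∧ (∀ z ∈ Ω, SubMeanAt b z) ∧ b ζ = 0 ∧
    ∀ z ∈ closure Ω, z ≠ ζ → b z < 0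

theorem IsCollar.exists_barrier {Ω : Set ℂ} {γ : ℂ → ℂ} {r B : ℝ} (h : IsCollar Ω γ r B)
    (hΩ : IsOpen Ω) {τ : ℂ} (hτ : τ ∈ sphere (0:ℂ) 1) : ∃ b, IsBarrier Ω (γ τ) b := by
  classical
  obtain ⟨ψ, hψ, hψγ⟩ := h.exists_inverse
  have hτA := h.sphere_subset hτ
  have hτ1 : ‖τ‖ = 1 := mem_sphere_zero_iff_norm.1 hτ
  obtain ⟨ε, hε, hεA⟩ := Metric.isOpen_iff.1 (isOpen_annulus r r⁻¹) τ hτA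
  set W := γ '' ball τ ε with hW
  have hWo : IsOpen W := h.isOpen_image isOpen_ball hεA
  set δ := ε ^ 2 / 8 with hδ
  have hδ0 : 0 < δ := by positivity
  let l : ℂ → ℝ := fun z => (ψ z * (starRingEnd ℂ) τ).re - 1
  have hl : IsHarmonicOn l W := by
    have : DifferentiableOn ℂ (fun z => ψ z * (starRingEnd ℂ) τ - 1) W :=
      ((hψ.mono (image_mono hεA)).mul_const _).sub_const 1
    exact (isHarmonicOn_re hWo this).congr fun z _ => by simp [l]
  have hlm : IsHarmonicOn (fun _ : ℂ => -δ) W := isHarmonicOn_const hWo _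
  let m : ℂ → ℝ := fun z => max (l z) (-δ)
  have hmc : ContinuousOn m W := hl.continuousOn.sup hlm.continuousOn
  let b : ℂ → ℝ := fun z => if z ∈ W then m z else -δ
  have hbm : ∀ z ∈ W, b z = m z := fun z hz => if_pos hz
  have hlt : ∀ t ∈ ball τ ε, ‖t‖ ≤ 1 → l (γ t) ≤ -(‖t - τ‖ ^ 2 / 2) := fun t ht ht1 => by
    have e1 : ‖t - τ‖ ^ 2 = ‖t‖ ^ 2 + ‖τ‖ ^ 2 - 2 * (t * (starRingEnd ℂ) τ).re := by
      rw [← Complex.normSq_eq_norm_sq, ← Complex.normSq_eq_norm_sq, ← Complex.normSq_eq_norm_sq,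
        Complex.normSq_sub]
    simp only [l, hψγ t (hεA ht)]
    rw [hτ1] at e1
    nlinarith [norm_nonneg t]
  -- away from a smaller closed ball, `b` is constant on the closure
  set Kc := γ '' closedBall τ (ε / 2) with hKc
  have hεε : closedBall τ (ε / 2) ⊆ ball τ ε := closedBall_subset_ball (by linarith)
  have hKcl : IsClosed Kc := ((isCompact_closedBall τ (ε/2)).image_of_continuousOn
    (h.diff.continuousOn.mono (hεε.trans hεA))).isClosed
  have hKW : Kc ⊆ W := image_mono hεε
  have hbc : ∀ z ∈ closure Ω ∩ Kcᶜ, b z = -δ := by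
    rintro z ⟨hz, hzK⟩
    by_cases hzW : z ∈ W
    · rw [hbm z hzW]
      obtain ⟨t, ht, rfl⟩ := hzW
      have ht1 := h.le_one_of_mem_closure (hεA ht) hz
      refine max_eq_right ((hlt t ht ht1).trans ?_)
      have : ε / 2 < ‖t - τ‖ := by
        by_contra hcon
        exact hzK ⟨t, by rw [mem_closedBall_iff_norm]; linarith, rfl⟩
      rw [hδ]; nlinarith
    · exact if_neg hzW
  have hWK : ∀ z, z ∈ W ∨ z ∈ Kcᶜ := fun z => by
    by_cases hz : z ∈ Kc
    · exact Or.inl (hKW hz)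
    · exact Or.inr hz
  refine ⟨b, ?_, ?_, ?_, ?_⟩
  · intro z hz
    rcases hWK z with hzW | hzK
    · exact ((hmc.congr hbm).continuousAt (hWo.mem_nhds hzW)).continuousWithinAt
    · refine (continuousWithinAt_const (b := -δ)).congr_of_eventuallyEq ?_ (hbc z ⟨hz, hzK⟩)
      filter_upwards [self_mem_nhdsWithin, mem_nhdsWithin_of_mem_nhds
        (hKcl.isOpen_compl.mem_nhds hzK)] with w hw1 hw2
      exact hbc w ⟨hw1, hw2⟩
  · intro z hz
    rcases hWK z with hzW | hzK
    · exact ((hl.subMeanAt hWo hzW).max hWo hzW hl.continuousOn hlm.continuousOn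
        (subMeanAt_const _ _)).congr hWo hzW hbm
    · exact (subMeanAt_const (-δ) z).congr (hΩ.inter hKcl.isOpen_compl) ⟨hz, hzK⟩
        fun w hw => hbc w ⟨subset_closure hw.1, hw.2⟩
  · have hmem : γ τ ∈ W := ⟨τ, mem_ball_self hε, rfl⟩
    rw [hbm _ hmem]
    have : (τ * (starRingEnd ℂ) τ).re = 1 := by
      rw [Complex.mul_conj, Complex.normSq_eq_norm_sq, hτ1]; simp
    simp only [m, l, hψγ τ hτA, this]
    simp [hδ0.le]
  · intro z hz hzne
    rcases hWK z with hzW | hzK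
    · rw [hbm z hzW]
      obtain ⟨t, ht, rfl⟩ := hzW
      have ht1 := h.le_one_of_mem_closure (hεA ht) hz
      refine max_lt ((hlt t ht ht1).trans_lt ?_) (by linarith)
      have : 0 < ‖t - τ‖ := norm_pos_iff.2 (sub_ne_zero.2 fun e => hzne (by rw [e]))
      have : 0 < ‖t - τ‖ ^ 2 := by positivity
      linarith
    · rw [hbc z ⟨hz, hzK⟩]; linarith

end

section

/-- Continuous subsolutions of the Dirichlet problem with boundary data `k`. -/
def IsSubsol (Ω : Set ℂ) (k v : ℂ → ℝ) : Prop :=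
  ContinuousOn v (closure Ω) ∧ (∀ z ∈ Ω, SubMeanAt v z) ∧ ∀ ζ ∈ frontier Ω, v ζ ≤ k ζ

theorem IsSubsol.max {Ω : Set ℂ} (hΩ : IsOpen Ω) {k v v' : ℂ → ℝ} (h : IsSubsol Ω k v)
    (h' : IsSubsol Ω k v') : IsSubsol Ω k (fun z => max (v z) (v' z)) :=
  ⟨h.1.sup h'.1, fun z hz => (h.2.1 z hz).max hΩ hz (h.1.mono subset_closure)
    (h'.1.mono subset_closure) (h'.2.1 z hz), fun ζ hζ => max_le (h.2.2 ζ hζ) (h'.2.2 ζ hζ)⟩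

theorem closure_diff_eq_frontier {Ω : Set ℂ} (hΩ : IsOpen Ω) : closure Ω \ Ω = frontier Ω := by
  rw [frontier, hΩ.interior_eq]

theorem IsSubsol.poissonMod {Ω : Set ℂ} (hΩ : IsOpen Ω) {k v : ℂ → ℝ} (h : IsSubsol Ω k v)
    {c : ℂ} {R : ℝ} (hR : 0 < R) (hc : closedBall c R ⊆ Ω) :
    ∃ v', IsSubsol Ω k v' ∧ (∀ z ∈ closure Ω, v z ≤ v' z) ∧ IsHarmonicOn v' (ball c R) := by
  classical
  obtain ⟨u, hu, huh, hub⟩ := exists_dirichlet_ball hR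
    (h.1.mono ((sphere_subset_closedBall.trans hc).trans subset_closure))
  have hle : ∀ z ∈ closedBall c R, v z ≤ u z := by
    refine le_of_subMean_of_harmonic (isCompact_closedBall c R) isOpen_ball ball_subset_closedBall
      (h.1.mono (hc.trans subset_closure)) (fun z hz => h.2.1 z (hc (ball_subset_closedBall hz)))
      hu huh fun z hz => ?_
    refine (hub z ?_).ge
    have h1 := mem_closedBall.1 hz.1
    have h2 : ¬ dist z c < R := fun h => hz.2 (mem_ball.2 h)
    exact mem_sphere.2 (le_antisymm h1 (not_lt.1 h2))
  let w : ℂ → ℝ := fun z => if z ∈ closedBall c R then u z else v z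
  have hw1 : ∀ z ∈ closedBall c R, w z = u z := fun z hz => if_pos hz
  have hw2 : ∀ z, z ∉ ball c R → w z = v z := fun z hz => by
    by_cases h1 : z ∈ closedBall c R
    · rw [hw1 z h1]
      refine hub z (mem_sphere.2 (le_antisymm (mem_closedBall.1 h1) (not_lt.1 fun h => hz h)))
    · exact if_neg h1
  have hwc : ContinuousOn w (closure Ω) := by
    have e : closure Ω ⊆ closedBall c R ∪ (closure Ω ∩ (ball c R)ᶜ) := fun z hz => by
      by_cases h1 : z ∈ ball c R
      · exact Or.inl (ball_subset_closedBall h1)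
      · exact Or.inr ⟨hz, h1⟩
    refine ContinuousOn.mono (ContinuousOn.union_of_isClosed (hu.congr hw1)
      ((h.1.mono inter_subset_left).congr fun z hz => hw2 z hz.2) isClosed_closedBall
      (isClosed_closure.inter isOpen_ball.isClosed_compl)) e
  have hwv : ∀ z ∈ closure Ω, v z ≤ w z := fun z hz => by
    by_cases h1 : z ∈ closedBall c R
    · rw [hw1 z h1]; exact hle z h1
    · rw [hw2 z fun h => h1 (ball_subset_closedBall h)]
  have hwh : IsHarmonicOn w (ball c R) := huh.congr fun z hz => hw1 z (ball_subset_closedBall hz)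
  refine ⟨w, ⟨hwc, fun z hz => ?_, fun ζ hζ => ?_⟩, hwv, hwh⟩
  · by_cases h1 : z ∈ ball c R
    · exact hwh.subMeanAt isOpen_ball h1
    · exact SubMeanAt.of_le hΩ hz (h.1.mono subset_closure) (hwc.mono subset_closure)
        (fun w hw => hwv w (subset_closure hw)) (hw2 z h1).le (h.2.1 z hz)
  · rw [hw2 ζ fun h => ?_]
    · exact h.2.2 ζ hζ
    · rw [← closure_diff_eq_frontier hΩ] at hζ
      exact hζ.2 (hc (ball_subset_closedBall h))

theorem isHarmonicOn_sSup_subsol {Ω : Set ℂ} (hΩ : IsOpen Ω) {k : ℂ → ℝ} {M : ℝ}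
    (hne : ∃ v, IsSubsol Ω k v) (hM : ∀ v, IsSubsol Ω k v → ∀ z ∈ closure Ω, v z ≤ M) :
    IsHarmonicOn (fun z => sSup {x | ∃ v, IsSubsol Ω k v ∧ v z = x}) Ω := by
  set u : ℂ → ℝ := fun z => sSup {x | ∃ v, IsSubsol Ω k v ∧ v z = x} with hu
  have hle : ∀ v, IsSubsol Ω k v → ∀ z ∈ Ω, v z ≤ u z := fun v hv z hz =>
    le_csSup ⟨M, by rintro _ ⟨v, hv, rfl⟩; exact hM v hv z (subset_closure hz)⟩ ⟨v, hv, rfl⟩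
  intro c hc
  obtain ⟨R, hR, hRΩ⟩ := exists_closedBall_subset hΩ hc
  have hcb : c ∈ ball c R := mem_ball_self hR
  have hbΩ : ball c R ⊆ Ω := ball_subset_closedBall.trans hRΩ
  have : IsHarmonicOn u (ball c R) := by
    refine isHarmonicOn_of_approx isOpen_ball fun K hK hKc ε hε => ?_
    obtain ⟨C, hC, hharn⟩ := harnack isOpen_ball (convex_ball c R).isPreconnected hK hKc hcb
    have : ∃ v, IsSubsol Ω k v ∧ u c - ε / C < v c := by
      obtain ⟨_, ⟨v, hv, rfl⟩, h⟩ := exists_lt_of_lt_csSup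
        (s := {x | ∃ v, IsSubsol Ω k v ∧ v c = x}) (by obtain ⟨v, hv⟩ := hne; exact ⟨_, v, hv, rfl⟩)
        (show u c - ε / C < u c by have : 0 < ε / C := by positivity
                                   linarith)
      exact ⟨v, hv, h⟩
    obtain ⟨v₀, hv₀, hv₀c⟩ := this
    obtain ⟨v₁, hv₁, hv₁le, hv₁h⟩ := hv₀.poissonMod hΩ hR hRΩ
    refine ⟨v₁, hv₁h, fun z hz => ?_⟩
    have hzΩ := hbΩ (hK hz)
    rw [abs_of_nonneg (by linarith [hle v₁ hv₁ z hzΩ])]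
    suffices u z ≤ v₁ z + ε by linarith
    refine csSup_le (by obtain ⟨v, hv⟩ := hne; exact ⟨_, v, hv, rfl⟩) ?_
    rintro _ ⟨v, hv, rfl⟩
    obtain ⟨v₂, hv₂, hv₂le, hv₂h⟩ := (hv.max hΩ hv₁).poissonMod hΩ hR hRΩ
    have h1 := hharn (fun z => v₂ z - v₁ z) (hv₂h.sub hv₁h) (fun w hw => by
      have := (le_max_right (v w) (v₁ w)).trans (hv₂le w (subset_closure (hbΩ hw)))
      linarith) z hz
    have h2 := (le_max_left (v z) (v₁ z)).trans (hv₂le z (subset_closure hzΩ))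
    have h3 := hle v₂ hv₂ c hc
    have h4 := hv₁le c (subset_closure hc)
    have h5 : C * (v₂ c - v₁ c) ≤ C * (ε / C) := by gcongr; linarith
    rw [mul_div_cancel₀ _ hC.ne'] at h5
    linarith
  obtain ⟨r, hr, hrs, g, hg⟩ := this c hcb
  exact ⟨r, hr, hrs.trans hbΩ, g, hg⟩

theorem exists_dirichlet {Ω : Set ℂ} (hΩ : IsOpen Ω) (hb : Bornology.IsBounded Ω)
    (hbar : ∀ ζ ∈ frontier Ω, ∃ b, IsBarrier Ω ζ b) {k : ℂ → ℝ} (hk : ContinuousOn k (frontier Ω)) :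
    ∃ u : ℂ → ℝ, ContinuousOn u (closure Ω) ∧ IsHarmonicOn u Ω ∧ ∀ ζ ∈ frontier Ω, u ζ = k ζ := by
  classical
  have hKc : IsCompact (closure Ω) := hb.isCompact_closure
  have hFc : IsCompact (frontier Ω) := hKc.of_isClosed_subset isClosed_frontier frontier_subset_closure
  have hdiff := closure_diff_eq_frontier hΩ
  obtain ⟨M, hM⟩ := hFc.exists_bound_of_continuousOn hk
  simp only [Real.norm_eq_abs, abs_le] at hM
  have hbd : ∀ v, IsSubsol Ω k v → ∀ z ∈ closure Ω, v z ≤ M := fun v hv =>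
    le_of_le_diff hKc hΩ subset_closure hv.1 hv.2.1 fun z hz => by
      rw [hdiff] at hz
      exact (hv.2.2 z hz).trans (hM z hz).2
  have hne : ∃ v, IsSubsol Ω k v := ⟨fun _ => -M, continuousOn_const,
    fun z _ => subMeanAt_const _ _, fun ζ hζ => (hM ζ hζ).1⟩
  have hharm := isHarmonicOn_sSup_subsol hΩ hne hbd
  set u : ℂ → ℝ := fun z => sSup {x | ∃ v, IsSubsol Ω k v ∧ v z = x} with hu
  have hle : ∀ v, IsSubsol Ω k v → ∀ z ∈ Ω, v z ≤ u z := fun v hv z hz =>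
    le_csSup ⟨M, by rintro _ ⟨v, hv, rfl⟩; exact hbd v hv z (subset_closure hz)⟩ ⟨v, hv, rfl⟩
  let U : ℂ → ℝ := fun z => if z ∈ Ω then u z else k z
  have hUΩ : ∀ z ∈ Ω, U z = u z := fun z hz => if_pos hz
  have hUf : ∀ z ∈ frontier Ω, U z = k z := fun z hz => by
    rw [← hdiff] at hz; exact if_neg hz.2
  have hUh := hharm.congr hUΩ
  refine ⟨U, fun ζ hζ => ?_, hUh, hUf⟩
  by_cases hζΩ : ζ ∈ Ω
  · exact (hUh.continuousOn.continuousAt (hΩ.mem_nhds hζΩ)).continuousWithinAt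
  have hζf : ζ ∈ frontier Ω := hdiff ▸ ⟨hζ, hζΩ⟩
  obtain ⟨b, hbc, hbs, hb0, hbneg⟩ := hbar ζ hζf
  have hbnp : ∀ z ∈ closure Ω, b z ≤ 0 := fun z hz => by
    by_cases h : z = ζ
    · rw [h, hb0]
    · exact (hbneg z hz h).le
  -- the two-sided barrier estimate
  have hest : ∀ ε > 0, ∃ C, 0 ≤ C ∧ ∀ ξ ∈ frontier Ω, |k ξ - k ζ| ≤ ε - C * b ξ := by
    intro ε hε
    obtain ⟨δ, hδ, hδk⟩ := Metric.continuousOn_iff.1 hk ζ hζf ε hε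
    have hcomp : IsCompact (frontier Ω \ ball ζ δ) := hFc.diff isOpen_ball
    have : ∃ m > 0, ∀ ξ ∈ frontier Ω \ ball ζ δ, b ξ ≤ -m := by
      rcases (frontier Ω \ ball ζ δ).eq_empty_or_nonempty with he | hne
      · exact ⟨1, one_pos, by simp [he]⟩
      · obtain ⟨ξ₀, hξ₀, hmax⟩ := hcomp.exists_isMaxOn hne
          (hbc.mono (sdiff_subset.trans frontier_subset_closure))
        refine ⟨-b ξ₀, ?_, fun ξ hξ => by simpa using hmax hξ⟩
        have := hbneg ξ₀ (frontier_subset_closure hξ₀.1) fun h => hξ₀.2 (h ▸ mem_ball_self hδ)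
        linarith
    obtain ⟨m, hm, hbm⟩ := this
    have hM0 : 0 ≤ M := by linarith [(hM ζ hζf).1, (hM ζ hζf).2]
    refine ⟨2 * M / m, by positivity, fun ξ hξ => ?_⟩
    have hC : 0 ≤ 2 * M / m := by positivity
    by_cases h : ξ ∈ ball ζ δ
    · have h1 := hδk ξ hξ h
      rw [Real.dist_eq] at h1
      nlinarith [hbnp ξ (frontier_subset_closure hξ)]
    · have h1 := hbm ξ ⟨hξ, h⟩
      have h2 : 2 * M / m * b ξ ≤ 2 * M / m * -m := by gcongr
      have h3 : 2 * M / m * -m = -(2 * M) := by field_simp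
      have h4 : |k ξ - k ζ| ≤ 2 * M := abs_le.2
        ⟨by linarith [(hM ξ hξ).1, (hM ζ hζf).2], by linarith [(hM ξ hξ).2, (hM ζ hζf).1]⟩
      linarith
  have hmain : ∀ ε > 0, ∃ C, 0 ≤ C ∧ ∀ z ∈ closure Ω, |U z - k ζ| ≤ ε - C * b z := by
    intro ε hε
    obtain ⟨C, hC, hCk⟩ := hest ε hε
    refine ⟨C, hC, fun z hz => ?_⟩
    by_cases hzΩ : z ∈ Ω
    swap
    · have hzf : z ∈ frontier Ω := hdiff ▸ ⟨hz, hzΩ⟩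
      rw [hUf z hzf]; exact hCk z hzf
    rw [hUΩ z hzΩ, abs_le]
    have hcs : ∀ w ∈ Ω, SubMeanAt (fun z => C * b z) w := fun w hw => (hbs w hw).const_mul hC
    have hcc : ContinuousOn (fun z => C * b z) (closure Ω) := continuousOn_const.mul hbc
    constructor
    · have hsub : IsSubsol Ω k (fun z => (k ζ - ε) + C * b z) := by
        refine ⟨continuousOn_const.add hcc, fun w hw => (subMeanAt_const (k ζ - ε) w).add hΩ hw
          continuousOn_const (hcc.mono subset_closure) (hcs w hw), fun ξ hξ => ?_⟩
        have := (abs_le.1 (hCk ξ hξ)).1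
        linarith
      have := hle _ hsub z hzΩ
      linarith
    · suffices u z ≤ k ζ + ε - C * b z by linarith
      refine csSup_le (by obtain ⟨v, hv⟩ := hne; exact ⟨_, v, hv, rfl⟩) ?_
      rintro _ ⟨v, hv, rfl⟩
      have := le_of_le_diff hKc hΩ subset_closure (hv.1.add hcc) (fun w hw =>
        (hv.2.1 w hw).add hΩ hw (hv.1.mono subset_closure) (hcc.mono subset_closure) (hcs w hw))
        (m := k ζ + ε) (fun ξ hξ => by
          rw [hdiff] at hξ
          have h1 := (abs_le.1 (hCk ξ hξ)).2
          have h2 := hv.2.2 ξ hξ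
          rw [Pi.add_apply]
          linarith) z hz
      rw [Pi.add_apply] at this
      linarith
  rw [Metric.continuousWithinAt_iff']
  intro ε hε
  obtain ⟨C, hC, hCz⟩ := hmain (ε / 2) (by positivity)
  have hlim : Tendsto (fun z => C * b z) (𝓝[closure Ω] ζ) (𝓝 0) := by
    have := (hbc ζ hζ).tendsto.const_mul C
    rwa [hb0, mul_zero] at this
  filter_upwards [hlim.eventually (lt_mem_nhds (show -(ε / 2) < 0 by linarith)),
    self_mem_nhdsWithin] with z hz1 hz2
  rw [hUf ζ hζf, Real.dist_eq]
  have := hCz z hz2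
  linarith

end

section

theorem measure_le_of_integral_le {μ ν : Measure ℂ} [IsFiniteMeasure μ] [IsFiniteMeasure ν] {C : ℝ}
    (hC : 0 ≤ C) (h : ∀ k : ℂ → ℝ, Continuous k → (∀ z, 0 ≤ k z) →
      ∫ z, k z ∂μ ≤ C * ∫ z, k z ∂ν) : μ ≤ ENNReal.ofReal C • ν := by
  have hF : ∀ F : Set ℂ, IsClosed F → μ F ≤ ENNReal.ofReal C * ν F := by
    intro F hF
    have hpos : ∀ i : ℕ, 0 < 1 / ((i:ℝ) + 1) := fun i => Nat.one_div_pos_of_nat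
    have l1 := tendsto_lintegral_thickenedIndicator_of_isClosed μ hF hpos
      tendsto_one_div_add_atTop_nhds_zero_nat
    have l2 := tendsto_lintegral_thickenedIndicator_of_isClosed ν hF hpos
      tendsto_one_div_add_atTop_nhds_zero_nat
    refine le_of_tendsto_of_tendsto' l1 (ENNReal.Tendsto.const_mul l2
      (Or.inr ENNReal.ofReal_ne_top)) fun i => ?_
    set f := thickenedIndicator (hpos i) F
    have hc : Continuous fun z => (f z : ℝ) := by fun_prop
    have hb : ∀ (m : Measure ℂ) [IsFiniteMeasure m],
        ∫⁻ z, f z ∂m = ENNReal.ofReal (∫ z, (f z : ℝ) ∂m) := fun m _ => by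
      rw [ofReal_integral_eq_lintegral_ofReal]
      · simp
      · refine Integrable.of_bound hc.aestronglyMeasurable 1 (.of_forall fun z => ?_)
        rw [Real.norm_of_nonneg (by positivity)]
        have h1 : f z ≤ 1 := thickenedIndicator_le_one (hpos i) F z
        exact_mod_cast h1
      · exact .of_forall fun z => by positivity
    rw [hb μ, hb ν, ← ENNReal.ofReal_mul hC]
    exact ENNReal.ofReal_le_ofReal (h _ hc fun z => by positivity)
  refine Measure.le_iff.2 fun A hA => ?_
  rw [hA.measure_eq_iSup_isClosed_of_ne_top (measure_ne_top μ A)]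
  refine iSup₂_le fun F hFA => iSup_le fun hFc => (hF F hFc).trans ?_
  rw [Measure.smul_apply, smul_eq_mul]
  gcongr

theorem circ_restrict : circ.restrict (sphere (0:ℂ) 1) = circ :=
  Measure.restrict_eq_self_of_ae_mem circ_sphere

namespace MCDomain
variable (D : MCDomain n)

theorem frontier_compact : IsCompact (frontier D.Ω) :=
  D.bdd.isCompact_closure.of_isClosed_subset isClosed_frontier frontier_subset_closure

theorem exists_solution {k : ℂ → ℝ} (hk : ContinuousOn k (frontier D.Ω)) :
    ∃ u : ℂ → ℝ, ContinuousOn u (closure D.Ω) ∧ IsHarmonicOn u D.Ω ∧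
      (∀ ζ ∈ frontier D.Ω, u ζ = k ζ) ∧ ∀ w ∈ D.Ω, u w = ∫ ζ, k ζ ∂D.ωm w := by
  obtain ⟨c⟩ := D.exists_collars
  obtain ⟨u, hu, huh, hub⟩ := exists_dirichlet D.isOpen D.bdd (fun ζ hζ => by
    rw [D.frontier_eq] at hζ
    obtain ⟨j, hj⟩ := mem_iUnion.1 hζ
    rw [← c.image j] at hj
    obtain ⟨τ, hτ, rfl⟩ := hj
    exact (c.collar j).exists_barrier D.isOpen hτ) hk
  refine ⟨u, hu, huh, hub, fun w hw => ?_⟩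
  rw [D.dirichlet u hu huh w hw]
  refine integral_congr_ae ?_
  have : ∀ᵐ ζ ∂D.ωm w, ζ ∈ frontier D.Ω := D.supp w hw
  filter_upwards [this] with ζ hζ using hub ζ hζ

end MCDomain

namespace Collars
variable {D : MCDomain n} (c : Collars D)

theorem r_pos : 0 < c.r := (c.collar 0).r_pos
theorem r_lt : c.r < 1 := (c.collar 0).r_lt

theorem continuousOn_sphere (j : Fin (n+1)) : ContinuousOn (c.γ j) (sphere (0:ℂ) 1) :=
  (c.collar j).diff.continuousOn.mono (c.collar j).sphere_subset

theorem aemeasurable (j : Fin (n+1)) : AEMeasurable (c.γ j) circ := by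
  rw [← circ_restrict]
  exact (c.continuousOn_sphere j).aemeasurable isClosed_sphere.measurableSet

/-- Sum of the push-forwards of normalized arc length on the circle. -/
def σ : Measure ℂ := ∑ j, circ.map (c.γ j)

instance : IsFiniteMeasure c.σ := by
  unfold σ; infer_instance

theorem lintegral_σ {k : ℂ → ℝ≥0∞} (hk : Measurable k) :
    ∫⁻ z, k z ∂c.σ = ∑ j, ∫⁻ t, k (c.γ j t) ∂circ := by
  rw [σ, lintegral_finsetSum_measure]
  exact Finset.sum_congr rfl fun j _ => lintegral_map' hk.aemeasurable (c.aemeasurable j)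

theorem map_le_σ (j : Fin (n+1)) : circ.map (c.γ j) ≤ c.σ := by
  refine Measure.le_iff.2 fun s hs => ?_
  rw [σ, Measure.finsetSum_apply]
  exact Finset.single_le_sum (f := fun j => (circ.map (c.γ j)) s) (fun _ _ => zero_le)
    (Finset.mem_univ j)

theorem integrable_comp {k : ℂ → ℝ} (hk : Integrable k c.σ) (j : Fin (n+1)) :
    Integrable (fun t => k (c.γ j t)) circ :=
  (hk.mono_measure (c.map_le_σ j)).comp_aemeasurable (c.aemeasurable j)

theorem integral_σ {k : ℂ → ℝ} (hk : Integrable k c.σ) :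
    ∫ z, k z ∂c.σ = ∑ j, ∫ t, k (c.γ j t) ∂circ := by
  rw [σ, integral_finsetSum_measure fun j _ => hk.mono_measure (c.map_le_σ j)]
  refine Finset.sum_congr rfl fun j _ => integral_map (c.aemeasurable j)
    (hk.mono_measure (c.map_le_σ j)).1

theorem integral_comp_le {k : ℂ → ℝ} (hk : Integrable k c.σ) (h0 : ∀ z, 0 ≤ k z) (j : Fin (n+1)) :
    ∫ t, k (c.γ j t) ∂circ ≤ ∫ z, k z ∂c.σ := by
  rw [c.integral_σ hk]
  exact Finset.single_le_sum (f := fun j => ∫ t, k (c.γ j t) ∂circ)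
    (fun _ _ => integral_nonneg fun _ => h0 _) (Finset.mem_univ j)

theorem ae_comp {p : ℂ → Prop} (h : ∀ᵐ z ∂c.σ, p z) (j : Fin (n+1)) :
    ∀ᵐ t ∂circ, p (c.γ j t) :=
  ae_of_ae_map (c.aemeasurable j) (ae_mono (c.map_le_σ j) h)

theorem ae_of_comp {p : ℂ → Prop} (h : ∀ j, ∀ᵐ t ∂circ, p (c.γ j t)) : ∀ᵐ z ∂c.σ, p z := by
  have hj : ∀ j, ∀ᵐ z ∂circ.map (c.γ j), p z := fun j => by
    have h1 : ∀ᵐ t ∂circ, t ∈ sphere (0:ℂ) 1 ∧ p (c.γ j t) := circ_sphere.and (h j)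
    obtain ⟨N, hN, hNm, hN0⟩ := exists_measurable_superset_of_null (ae_iff.1 h1)
    have hSm : MeasurableSet (sphere (0:ℂ) 1 ∩ Nᶜ) := isClosed_sphere.measurableSet.inter hNm.compl
    have himg : MeasurableSet (c.γ j '' (sphere (0:ℂ) 1 ∩ Nᶜ)) :=
      hSm.image_of_continuousOn_injOn ((c.continuousOn_sphere j).mono inter_subset_left)
        ((c.collar j).injOn.mono (inter_subset_left.trans (c.collar j).sphere_subset))
    have h2 : ∀ᵐ z ∂circ.map (c.γ j), z ∈ c.γ j '' (sphere (0:ℂ) 1 ∩ Nᶜ) := by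
      refine (ae_map_iff (c.aemeasurable j) (p := (· ∈ c.γ j '' (sphere (0:ℂ) 1 ∩ Nᶜ))) himg).2 ?_
      have : ∀ᵐ t ∂circ, t ∈ Nᶜ := by rw [ae_iff]; simpa using hN0
      filter_upwards [circ_sphere, this] with t ht1 ht2 using ⟨t, ⟨ht1, ht2⟩, rfl⟩
    filter_upwards [h2] with z hz
    obtain ⟨t, ⟨-, ht⟩, rfl⟩ := hz
    by_contra hp
    exact ht (hN fun h => hp h.2)
  rw [ae_iff, σ, Measure.finsetSum_apply]
  exact Finset.sum_eq_zero fun j _ => ae_iff.1 (hj j)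

/-- The part of the closed domain at depth at least `s` in every collar. -/
def core (s : ℝ) : Set ℂ := closure D.Ω \ ⋃ j, c.γ j '' annulus s c.r⁻¹

theorem isCompact_core {s : ℝ} (hs : c.r ≤ s) : IsCompact (c.core s) :=
  D.bdd.isCompact_closure.diff (isOpen_iUnion fun j => (c.collar j).isOpen_image
    (isOpen_annulus _ _) (annulus_mono hs le_rfl))

theorem inj {j k : Fin (n+1)} {s t : ℂ} (hs : s ∈ annulus c.r c.r⁻¹) (ht : t ∈ annulus c.r c.r⁻¹)
    (h : c.γ j s = c.γ k t) : j = k ∧ s = t := by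
  have hjk : j = k := by
    by_contra hne
    exact disjoint_left.1 (c.disj j k hne) ⟨s, hs, rfl⟩ (h ▸ ⟨t, ht, rfl⟩)
  subst hjk
  exact ⟨rfl, (c.collar j).injOn hs ht h⟩

theorem core_subset {s : ℝ} (hs : s < 1) : c.core s ⊆ D.Ω := by
  rintro z ⟨hz, hzn⟩
  by_contra hzΩ
  have hzf : z ∈ frontier D.Ω := closure_diff_eq_frontier D.isOpen ▸ ⟨hz, hzΩ⟩
  rw [D.frontier_eq] at hzf
  obtain ⟨j, hj⟩ := mem_iUnion.1 hzf
  rw [← c.image j] at hj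
  obtain ⟨t, ht, rfl⟩ := hj
  exact hzn (mem_iUnion.2 ⟨j, t, sphere_subset_annulus hs (c.collar j).one_lt_inv ht, rfl⟩)

theorem γ_mem_core {s : ℝ} (hs : c.r < s) (hs1 : s < 1) (j : Fin (n+1)) {t : ℂ} (ht : c.r < ‖t‖)
    (hts : ‖t‖ ≤ s) : c.γ j t ∈ c.core s := by
  have htA : t ∈ annulus c.r 1 := ⟨ht, hts.trans_lt hs1⟩
  refine ⟨subset_closure ((c.collar j).inner t htA), fun h => ?_⟩
  obtain ⟨k, t', ht', he⟩ := mem_iUnion.1 h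
  have := (c.inj (annulus_mono hs.le le_rfl ht') ((c.collar j).inner_subset htA) he).2
  rw [this] at ht'
  exact absurd ht'.1 (not_lt.2 hts)

theorem core_le {s : ℝ} (hs : c.r < s) (hs1 : s < 1) {v : ℂ → ℝ} (hc : ContinuousOn v (c.core s))
    (hsub : ∀ z ∈ D.Ω, SubMeanAt v z) {m : ℝ} (hm : ∀ j, ∀ t, ‖t‖ = s → v (c.γ j t) ≤ m) :
    ∀ z ∈ c.core s, v z ≤ m := by
  have h0 := c.r_pos
  have hsub' : cannulus s 1 ⊆ annulus c.r c.r⁻¹ := fun t ht =>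
    ⟨hs.trans_le ht.1, lt_of_le_of_lt ht.2 (c.collar 0).one_lt_inv⟩
  have hcl : IsClosed (⋃ j, c.γ j '' cannulus s 1) := isClosed_iUnion_of_finite fun j =>
    ((isCompact_cannulus s 1).image_of_continuousOn
      ((c.collar j).diff.continuousOn.mono hsub')).isClosed
  have hsm : annulus s c.r⁻¹ ⊆ annulus c.r c.r⁻¹ := annulus_mono hs.le le_rfl
  refine le_of_le_diff (c.isCompact_core hs.le) (U := D.Ω \ ⋃ j, c.γ j '' cannulus s 1)
    (D.isOpen.sdiff hcl) ?_ hc (fun z hz => hsub z hz.1) ?_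
  · rintro z ⟨hz, hzn⟩
    refine ⟨subset_closure hz, fun h => hzn ?_⟩
    obtain ⟨j, t, ht, rfl⟩ := mem_iUnion.1 h
    exact mem_iUnion.2 ⟨j, t, ⟨ht.1.le, ((c.collar j).lt_one_of_mem D.isOpen (hsm ht) hz).le⟩, rfl⟩
  · rintro z ⟨hz, hzn⟩
    have hzΩ := c.core_subset hs1 hz
    have : z ∈ ⋃ j, c.γ j '' cannulus s 1 := by
      by_contra h
      exact hzn ⟨hzΩ, h⟩
    obtain ⟨j, t, ht, rfl⟩ := mem_iUnion.1 this
    have ht1 := (c.collar j).lt_one_of_mem D.isOpen (hsub' ht) hzΩ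
    refine hm j t (le_antisymm (not_lt.1 fun hlt => hz.2 (mem_iUnion.2 ⟨j, t, ⟨hlt, ?_⟩, rfl⟩)) ht.1)
    exact (hsub' ht).2

theorem exists_mem_core {z : ℂ} (hz : z ∈ D.Ω) : ∃ s, c.r < s ∧ s < 1 ∧ ∀ s', s ≤ s' → s' < 1 →
    z ∈ c.core s' := by
  by_cases h : ∃ j, ∃ t ∈ annulus c.r c.r⁻¹, c.γ j t = z
  · obtain ⟨j, t, ht, rfl⟩ := h
    have ht1 := (c.collar j).lt_one_of_mem D.isOpen ht hz
    exact ⟨‖t‖, ht.1, ht1, fun s' h1 h2 => c.γ_mem_core (ht.1.trans_le h1) h2 j ht.1 h1⟩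
  · obtain ⟨s, hs, hs1⟩ := exists_between c.r_lt
    refine ⟨s, hs, hs1, fun s' h1 _ => ⟨subset_closure hz, fun h' => h ?_⟩⟩
    obtain ⟨j, t, ht, he⟩ := mem_iUnion.1 h'
    exact ⟨j, t, annulus_mono (hs.le.trans h1) le_rfl ht, he⟩

theorem nonpos_of_collar_le {v : ℂ → ℝ} (hc : ContinuousOn v D.Ω)
    (hsub : ∀ z ∈ D.Ω, SubMeanAt v z) {r C : ℝ} (hr1 : r < 1)
    (h : ∀ j, ∀ t ∈ annulus r 1, v (c.γ j t) ≤ C * (Real.log ‖t‖ / Real.log r)) :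
    ∀ z ∈ D.Ω, v z ≤ 0 := by
  intro z hz
  obtain ⟨s, hs, hs1, hsz⟩ := c.exists_mem_core hz
  have hlim : Tendsto (fun s : ℝ => C * (Real.log s / Real.log r)) (𝓝[<] 1) (𝓝 0) := by
    have : ContinuousAt (fun s : ℝ => C * (Real.log s / Real.log r)) 1 := by
      fun_prop (disch := norm_num)
    have := this.tendsto
    simp only [Real.log_one, zero_div, mul_zero] at this
    exact this.mono_left nhdsWithin_le_nhds
  refine ge_of_tendsto hlim ?_
  have hev : ∀ᶠ s' in 𝓝[<] (1:ℝ), max s r < s' :=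
    nhdsWithin_le_nhds (lt_mem_nhds (max_lt hs1 hr1))
  filter_upwards [hev, self_mem_nhdsWithin] with s' h1 h2
  have h2 : s' < 1 := h2
  have h3 := (le_max_left s r).trans_lt h1
  have h4 := (le_max_right s r).trans_lt h1
  refine c.core_le (hs.trans h3) h2 (hc.mono (c.core_subset h2)) hsub ?_ z (hsz s' h3.le h2)
  intro j t ht
  have := h j t ⟨by rwa [ht], by rwa [ht]⟩
  rwa [ht] at this

end Collars

end

section

theorem Measure.integral_le_of_le_smul {μ ν : Measure ℂ} {C : ℝ} (hC : 0 ≤ C)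
    (h : μ ≤ ENNReal.ofReal C • ν) {k : ℂ → ℝ} (hk : Integrable k ν) (h0 : ∀ z, 0 ≤ k z) :
    ∫ z, k z ∂μ ≤ C * ∫ z, k z ∂ν := by
  have h1 : Integrable k (ENNReal.ofReal C • ν) := hk.smul_measure ENNReal.ofReal_ne_top
  refine (integral_mono_measure h (.of_forall h0) h1).trans_eq ?_
  rw [integral_smul_measure, ENNReal.toReal_ofReal hC, smul_eq_mul]

theorem Measure.integrable_of_le_smul {μ ν : Measure ℂ} {C : ℝ}
    (h : μ ≤ ENNReal.ofReal C • ν) {E : Type*} [NormedAddCommGroup E] {k : ℂ → E}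
    (hk : Integrable k ν) : Integrable k μ :=
  (hk.smul_measure ENNReal.ofReal_ne_top).mono_measure h

namespace MCDomain
variable (D : MCDomain n)

instance : IsProbabilityMeasure D.ω := D.prob _ D.base_mem

theorem ae_mem_frontier {w : ℂ} (hw : w ∈ D.Ω) : ∀ᵐ ζ ∂D.ωm w, ζ ∈ frontier D.Ω := D.supp w hw

theorem ωm_le {K : Set ℂ} (hKΩ : K ⊆ D.Ω) (hK : IsCompact K) {w' : ℂ} (hw' : w' ∈ D.Ω) :
    ∃ C : ℝ, 0 < C ∧ ∀ w ∈ K, D.ωm w ≤ ENNReal.ofReal C • D.ωm w' := by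
  obtain ⟨C, hC, h⟩ := harnack D.isOpen D.conn.isPreconnected hKΩ hK hw'
  refine ⟨C, hC, fun w hw => ?_⟩
  have := D.prob w (hKΩ hw)
  have := D.prob w' hw'
  refine measure_le_of_integral_le hC.le fun k hk h0 => ?_
  obtain ⟨u, -, huh, -, hu⟩ := D.exists_solution hk.continuousOn
  rw [← hu w (hKΩ hw), ← hu w' hw']
  exact h u huh (fun z hz => by rw [hu z hz]; exact integral_nonneg h0) w hw

theorem absolutelyContinuous {w w' : ℂ} (hw : w ∈ D.Ω) (hw' : w' ∈ D.Ω) : D.ωm w ≪ D.ωm w' := by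
  obtain ⟨C, -, h⟩ := D.ωm_le (singleton_subset_iff.2 hw) isCompact_singleton hw'
  exact (Measure.absolutelyContinuous_of_le (h w rfl)).trans
    (Measure.smul_absolutelyContinuous)

theorem integrable_ωm {w : ℂ} (hw : w ∈ D.Ω) {k : ℂ → ℝ} (hk : Integrable k D.ω) :
    Integrable k (D.ωm w) := by
  obtain ⟨C, -, h⟩ := D.ωm_le (singleton_subset_iff.2 hw) isCompact_singleton D.base_mem
  exact Measure.integrable_of_le_smul (h w rfl) hk

end MCDomain

namespace Collars
variable {D : MCDomain n} (c : Collars D)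

theorem continuousOn_comp {u : ℂ → ℝ} (hu : ContinuousOn u (closure D.Ω)) {r : ℝ} (hr : c.r < r)
    (j : Fin (n+1)) : ContinuousOn (fun t => u (c.γ j t)) (cannulus r 1) := by
  have hsub : cannulus r 1 ⊆ annulus c.r c.r⁻¹ := fun t ht =>
    ⟨hr.trans_le ht.1, lt_of_le_of_lt ht.2 (c.collar 0).one_lt_inv⟩
  refine hu.comp ((c.collar j).diff.continuousOn.mono hsub) fun t ht => ?_
  rcases lt_or_eq_of_le ht.2 with h | h
  · exact subset_closure ((c.collar j).inner t ⟨hr.trans_le ht.1, h⟩)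
  · refine frontier_subset_closure ?_
    rw [D.frontier_eq]
    exact mem_iUnion.2 ⟨j, c.image j ▸ ⟨t, by simpa using h, rfl⟩⟩

theorem isHarmonicOn_comp {u : ℂ → ℝ} (hu : IsHarmonicOn u D.Ω) (j : Fin (n+1)) :
    IsHarmonicOn (fun t => u (c.γ j t)) (annulus c.r 1) :=
  hu.comp (isOpen_annulus _ _) ((c.collar j).diff.mono (c.collar j).inner_subset)
    (fun t ht => (c.collar j).inner t ht)

theorem γ_mem_frontier (j : Fin (n+1)) {t : ℂ} (ht : t ∈ sphere (0:ℂ) 1) :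
    c.γ j t ∈ frontier D.Ω := by
  rw [D.frontier_eq]
  exact mem_iUnion.2 ⟨j, c.image j ▸ ⟨t, ht, rfl⟩⟩

theorem σ_frontier : ∀ᵐ z ∂c.σ, z ∈ frontier D.Ω :=
  c.ae_of_comp fun j => circ_sphere.mono fun _ ht => c.γ_mem_frontier j ht

theorem integrable_of_continuous {k : ℂ → ℝ} (hk : Continuous k) : Integrable k c.σ := by
  rw [← Measure.restrict_eq_self_of_ae_mem c.σ_frontier]
  exact hk.continuousOn.integrableOn_compact D.frontier_compact

theorem σ_le : ∃ C : ℝ, 0 < C ∧ c.σ ≤ ENNReal.ofReal C • D.ω := by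
  obtain ⟨s, hs, hs1⟩ := exists_between c.r_lt
  obtain ⟨r, hr, hrs⟩ := exists_between hs
  have hr0 := c.r_pos.trans hr
  obtain ⟨C, hC, h⟩ := harnack D.isOpen D.conn.isPreconnected (c.core_subset hs1)
    (c.isCompact_core hs.le) D.base_mem
  set lam := Real.log (s / 1) / Real.log (r / 1)
  have hl1 : 0 < 1 - lam := by
    have h1 : Real.log r < 0 := Real.log_neg hr0 (hrs.trans hs1)
    have h2 : Real.log r < Real.log s := Real.log_lt_log hr0 hrs
    simp only [lam, div_one, sub_pos]
    rwa [div_lt_one_of_neg h1]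
  refine ⟨(n+1) * (C / (1 - lam)), by positivity,
    measure_le_of_integral_le (by positivity) fun k hk h0 => ?_⟩
  obtain ⟨u, huc, huh, hub, hu⟩ := D.exists_solution hk.continuousOn
  have hu0 : ∀ z ∈ D.Ω, 0 ≤ u z := fun z hz => by rw [hu z hz]; exact integral_nonneg h0
  rw [c.integral_σ (c.integrable_of_continuous hk)]
  have key : ∀ j ∈ Finset.univ, ∫ t, k (c.γ j t) ∂circ ≤ C / (1 - lam) * ∫ z, k z ∂D.ω := by
    intro j _
    have h1 := circleAverage_outer_le hr0 hrs hs1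
      ((c.isHarmonicOn_comp huh j).mono (isOpen_annulus r 1) (annulus_mono hr.le le_rfl))
      (c.continuousOn_comp huc hr j) (fun t ht => hu0 _ ((c.collar j).inner t ⟨by rwa [ht], by
        rw [ht]; exact hrs.trans hs1⟩))
    have h2 : ∫ t, k (c.γ j t) ∂circ = Real.circleAverage (fun t => u (c.γ j t)) 0 1 := by
      rw [← integral_circ (integrable_circ_of_continuousOn ((c.continuousOn_comp huc hr j).mono
        (sphere_subset_cannulus (hrs.trans hs1)))).1]
      refine integral_congr_ae ?_
      filter_upwards [circ_sphere] with t ht using (hub _ (c.γ_mem_frontier j ht)).symm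
    have h3 : Real.circleAverage (fun t => u (c.γ j t)) 0 s ≤ C * ∫ z, k z ∂D.ω := by
      have hcc : ContinuousOn (fun t => u (c.γ j t)) (sphere 0 |s|) := by
        refine (c.continuousOn_comp huc hr j).mono fun t ht => ?_
        have : ‖t‖ = s := by simpa [abs_of_pos (hr0.trans hrs)] using ht
        exact ⟨by rw [this]; exact hrs.le, by rw [this]; exact hs1.le⟩
      refine Real.circleAverage_mono_on_of_le_circle hcc.circleIntegrable' fun t ht => ?_
      have ht' : ‖t‖ = s := by simpa [abs_of_pos (hr0.trans hrs)] using ht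
      have := h u huh hu0 _ (c.γ_mem_core hs hs1 j (by rw [ht']; exact hs) ht'.le)
      rwa [hu _ D.base_mem] at this
    rw [h2, div_mul_eq_mul_div, le_div_iff₀ hl1, mul_comm]
    exact h1.trans h3
  refine (Finset.sum_le_sum key).trans_eq ?_
  simp; ring

theorem ω_le : ∃ C : ℝ, 0 < C ∧ D.ω ≤ ENNReal.ofReal C • c.σ := by
  obtain ⟨s, hs, hs1⟩ := exists_between c.r_lt
  obtain ⟨r, hr, hrs⟩ := exists_between hs
  have hr0 := c.r_pos.trans hr
  obtain ⟨C, hC, h⟩ := harnack D.isOpen D.conn.isPreconnected (singleton_subset_iff.2 D.base_mem)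
    isCompact_singleton
    (c.core_subset hs1 (c.γ_mem_core hs hs1 0 (t := (r:ℂ)) (by simpa [abs_of_pos hr0])
      (by simpa [abs_of_pos hr0] using hrs.le)))
  set lam := Real.log s / Real.log r
  have hlog : Real.log r < 0 := Real.log_neg hr0 (hrs.trans hs1)
  have hl1 : 0 < 1 - lam := by
    have h2 : Real.log r < Real.log s := Real.log_lt_log hr0 hrs
    simp only [lam, sub_pos]
    rwa [div_lt_one_of_neg hlog]
  have hl0 : 0 ≤ lam := div_nonneg_of_nonpos (Real.log_nonpos (hr0.trans hrs).le hs1.le) hlog.le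
  have hs1' : 0 < 1 - s := by linarith
  have hs0 := hr0.trans hrs
  refine ⟨C * ((1 + s) / (1 - s) / (1 - lam)), by positivity,
    measure_le_of_integral_le (by positivity) fun k hk h0 => ?_⟩
  obtain ⟨u, huc, huh, hub, hu⟩ := D.exists_solution hk.continuousOn
  have hu0 : ∀ z ∈ D.Ω, 0 ≤ u z := fun z hz => by rw [hu z hz]; exact integral_nonneg h0
  set S := ∫ z, k z ∂c.σ
  -- the maximum over the inner circles
  obtain ⟨z₀, hz₀, hmax⟩ := (c.isCompact_core hs.le).exists_isMaxOn
    ⟨_, c.γ_mem_core hs hs1 0 (t := (r:ℂ)) (by simpa [abs_of_pos hr0])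
      (by simpa [abs_of_pos hr0] using hrs.le)⟩ (huc.mono sdiff_subset)
  have hM : ∀ z ∈ c.core s, u z ≤ u z₀ := hmax
  have hM0 : 0 ≤ u z₀ := hu0 _ (c.core_subset hs1 hz₀)
  have hpc : ∀ j, Integrable (fun t => u (c.γ j t)) circ := fun j =>
    integrable_circ_of_continuousOn ((c.continuousOn_comp huc hr j).mono
        (sphere_subset_cannulus (hrs.trans hs1)))
  have hp0 : ∀ j, ∀ᵐ t ∂circ, 0 ≤ u (c.γ j t) := fun j => by
    filter_upwards [circ_sphere] with t ht
    rw [hub _ (c.γ_mem_frontier j ht)]; exact h0 _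
  have hintS : ∀ j, ∫ t, u (c.γ j t) ∂circ ≤ S := fun j => by
    refine le_trans (le_of_eq ?_) (c.integral_comp_le (c.integrable_of_continuous hk) h0 j)
    refine integral_congr_ae ?_
    filter_upwards [circ_sphere] with t ht using hub _ (c.γ_mem_frontier j ht)
  have hS0 : 0 ≤ S := integral_nonneg h0
  have key : ∀ j, ∀ t, ‖t‖ = s → u (c.γ j t) ≤ (1 + s) / (1 - s) * S + u z₀ * lam := by
    intro j t ht
    have hb : t ∈ ball (0:ℂ) 1 := by simpa [ht]
    have h1 := le_pint_add hr0 (hrs.trans hs1) (M := u z₀) (c.continuousOn_comp huc hr j)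
      (fun t ht => (c.isHarmonicOn_comp huh j).subMeanAt (isOpen_annulus _ _)
        (annulus_mono hr.le le_rfl ht)) (fun t' ht' => by
        have h1 := hM _ (c.γ_mem_core hs hs1 j (t := t') (by rwa [ht']) (by rw [ht']; exact hrs.le))
        have h2 : 0 ≤ pint (fun t => u (c.γ j t)) t' :=
          le_pint_const (hpc j) (hp0 j) (by simpa [ht'] using hrs.trans hs1)
        linarith) (t := t) ⟨by rwa [ht], by rwa [ht]⟩
    have h2 := pint_le (hpc j) (hp0 j) hb
    rw [ht] at h1 h2
    have h3 : (1 + s) / (1 - s) * ∫ t, u (c.γ j t) ∂circ ≤ (1 + s) / (1 - s) * S := by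
      have := hintS j
      gcongr
    exact h1.trans (by linarith)
  have h4 := c.core_le hs hs1 (huc.mono sdiff_subset) (fun z hz => huh.subMeanAt D.isOpen hz) key
    z₀ hz₀
  have h5 : u z₀ ≤ (1 + s) / (1 - s) / (1 - lam) * S := by
    rw [div_mul_eq_mul_div, le_div_iff₀ hl1]; linarith
  have h6 := h u huh hu0 D.w₀ rfl
  rw [hu _ D.base_mem] at h6
  refine h6.trans ?_
  rw [mul_assoc]
  refine mul_le_mul_of_nonneg_left ((hM _ (c.γ_mem_core hs hs1 0 ?_ ?_)).trans h5) hC.le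
  · simpa [abs_of_pos hr0]
  · simpa [abs_of_pos hr0] using hrs.le

theorem integrable_σ {k : ℂ → ℝ} (hk : Integrable k D.ω) : Integrable k c.σ := by
  obtain ⟨C, -, h⟩ := c.σ_le
  exact Measure.integrable_of_le_smul h hk

theorem integrable_ω {k : ℂ → ℝ} (hk : Integrable k c.σ) : Integrable k D.ω := by
  obtain ⟨C, -, h⟩ := c.ω_le
  exact Measure.integrable_of_le_smul h hk

theorem ae_σ {p : ℂ → Prop} (h : ∀ᵐ z ∂D.ω, p z) : ∀ᵐ z ∂c.σ, p z := by
  obtain ⟨C, -, hC⟩ := c.σ_le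
  exact ((Measure.absolutelyContinuous_of_le hC).trans Measure.smul_absolutelyContinuous) h

theorem ae_ω {p : ℂ → Prop} (h : ∀ᵐ z ∂c.σ, p z) : ∀ᵐ z ∂D.ω, p z := by
  obtain ⟨C, -, hC⟩ := c.ω_le
  exact ((Measure.absolutelyContinuous_of_le hC).trans Measure.smul_absolutelyContinuous) h

end Collars

end

section

namespace MCDomain
variable (D : MCDomain n)

/-- The Poisson integral of a boundary function. -/
def P (k : ℂ → ℝ) (w : ℂ) : ℝ := ∫ ζ, k ζ ∂D.ωm w

variable {D}

theorem P_congr {k l : ℂ → ℝ} (h : k =ᵐ[D.ω] l) {w : ℂ} (hw : w ∈ D.Ω) : D.P k w = D.P l w :=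
  integral_congr_ae ((D.absolutelyContinuous hw D.base_mem).ae_eq h)

theorem P_sub {k l : ℂ → ℝ} (hk : Integrable k D.ω) (hl : Integrable l D.ω) {w : ℂ}
    (hw : w ∈ D.Ω) : D.P (fun z => k z - l z) w = D.P k w - D.P l w :=
  integral_sub (D.integrable_ωm hw hk) (D.integrable_ωm hw hl)

theorem P_mono {k l : ℂ → ℝ} (hk : Integrable k D.ω) (hl : Integrable l D.ω)
    (h : ∀ᵐ z ∂D.ω, k z ≤ l z) {w : ℂ} (hw : w ∈ D.Ω) : D.P k w ≤ D.P l w :=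
  integral_mono_ae (D.integrable_ωm hw hk) (D.integrable_ωm hw hl)
    (D.absolutelyContinuous hw D.base_mem h)

theorem P_const (a : ℝ) {w : ℂ} (hw : w ∈ D.Ω) : D.P (fun _ => a) w = a := by
  have := D.prob w hw
  simp [P]

theorem abs_P_le {K : Set ℂ} (hKΩ : K ⊆ D.Ω) (hK : IsCompact K) :
    ∃ C : ℝ, 0 < C ∧ ∀ k : ℂ → ℝ, Integrable k D.ω → ∀ w ∈ K, |D.P k w| ≤ C * ∫ z, |k z| ∂D.ω := by
  obtain ⟨C, hC, h⟩ := D.ωm_le hKΩ hK D.base_mem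
  refine ⟨C, hC, fun k hk w hw => (abs_integral_le_integral_abs).trans ?_⟩
  exact Measure.integral_le_of_le_smul hC.le (h w hw) hk.abs fun z => abs_nonneg _

theorem exists_continuous_approx {k : ℂ → ℝ} (hk : Integrable k D.ω) {ε : ℝ} (hε : 0 < ε) :
    ∃ l : ℂ → ℝ, Continuous l ∧ Integrable l D.ω ∧ ∫ z, |k z - l z| ∂D.ω ≤ ε := by
  obtain ⟨l, -, hl, hlc, hli⟩ := hk.exists_hasCompactSupport_integral_sub_le hε
  exact ⟨l, hlc, hli, hl⟩

theorem isHarmonicOn_P_of_continuous {k : ℂ → ℝ} (hk : Continuous k) : IsHarmonicOn (D.P k) D.Ω := by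
  obtain ⟨u, -, huh, -, hu⟩ := D.exists_solution hk.continuousOn
  exact huh.congr fun z hz => (hu z hz).symm

theorem isHarmonicOn_P {k : ℂ → ℝ} (hk : Integrable k D.ω) : IsHarmonicOn (D.P k) D.Ω := by
  refine isHarmonicOn_of_approx D.isOpen fun K hKΩ hK ε hε => ?_
  obtain ⟨C, hC, h⟩ := abs_P_le hKΩ hK
  obtain ⟨l, hlc, hl, hle⟩ := exists_continuous_approx hk (div_pos hε hC)
  refine ⟨D.P l, isHarmonicOn_P_of_continuous hlc, fun z hz => ?_⟩
  rw [← P_sub hk hl (hKΩ hz)]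
  refine (h _ (hk.sub hl) z hz).trans ?_
  calc C * ∫ z, |k z - l z| ∂D.ω ≤ C * (ε / C) := by gcongr
    _ = ε := by field_simp

end MCDomain

namespace Collars
variable {D : MCDomain n} (c : Collars D)

theorem integral_abs_comp_le : ∃ C : ℝ, 0 < C ∧ ∀ k : ℂ → ℝ, Integrable k D.ω → ∀ j,
    ∫ t, |k (c.γ j t)| ∂circ ≤ C * ∫ z, |k z| ∂D.ω := by
  obtain ⟨C, hC, h⟩ := c.σ_le
  refine ⟨C, hC, fun k hk j => ?_⟩
  exact (c.integral_comp_le (c.integrable_σ hk).abs (fun _ => abs_nonneg _) j).trans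
    (Measure.integral_le_of_le_smul hC.le h hk.abs fun z => abs_nonneg _)

theorem integrable_comp_ω {k : ℂ → ℝ} (hk : Integrable k D.ω) (j : Fin (n+1)) :
    Integrable (fun t => k (c.γ j t)) circ := c.integrable_comp (c.integrable_σ hk) j

theorem abs_P_sub_pint_le {r : ℝ} (hr : c.r < r) (hr1 : r < 1) : ∃ C : ℝ, 0 < C ∧
    ∀ k : ℂ → ℝ, Integrable k D.ω → ∀ j, ∀ t ∈ annulus r 1,
      |D.P k (c.γ j t) - pint (fun t => k (c.γ j t)) t| ≤
        C * (∫ z, |k z| ∂D.ω) * (Real.log ‖t‖ / Real.log r) := by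
  have hr0 := c.r_pos.trans hr
  have h1r : 0 < 1 - r := by linarith
  obtain ⟨C₁, hC₁, h₁⟩ := MCDomain.abs_P_le (c.core_subset hr1) (c.isCompact_core hr.le)
  obtain ⟨C₂, hC₂, h₂⟩ := c.integral_abs_comp_le
  have hpint : ∀ k : ℂ → ℝ, Integrable k D.ω → ∀ j, ∀ t ∈ ball (0:ℂ) 1,
      |pint (fun t => k (c.γ j t)) t| ≤ (1 + ‖t‖) / (1 - ‖t‖) * (C₂ * ∫ z, |k z| ∂D.ω) := by
    intro k hk j t ht
    have hkj := c.integrable_comp_ω hk j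
    refine (abs_pint_le hkj ht).trans ((pint_le hkj.abs (.of_forall fun _ => abs_nonneg _) ht).trans ?_)
    have : 0 < 1 - ‖t‖ := by simpa using ht
    exact mul_le_mul_of_nonneg_left (h₂ k hk j) (by positivity)
  set C := C₁ + (1 + r) / (1 - r) * C₂
  have hcont : ∀ k : ℂ → ℝ, Continuous k → Integrable k D.ω → ∀ j, ∀ t ∈ annulus r 1,
      |D.P k (c.γ j t) - pint (fun t => k (c.γ j t)) t| ≤
        C * (∫ z, |k z| ∂D.ω) * (Real.log ‖t‖ / Real.log r) := by
    intro k hkc hk j t ht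
    obtain ⟨u, huc, huh, hub, hu⟩ := D.exists_solution hkc.continuousOn
    have hΩ : ∀ t ∈ cannulus r 1, ‖t‖ < 1 → c.γ j t ∈ D.Ω := fun t ht h1 =>
      (c.collar j).inner t ⟨hr.trans_le ht.1, h1⟩
    have hpe : pint (fun t => u (c.γ j t)) = pint (fun t => k (c.γ j t)) := by
      funext t
      refine integral_congr_ae ?_
      filter_upwards [circ_sphere] with t ht
      simp only [hub _ (c.γ_mem_frontier j ht)]
    have := abs_sub_pint_le hr0 hr1 (M := C * (∫ z, |k z| ∂D.ω)) (c.continuousOn_comp huc hr j)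
      ((c.isHarmonicOn_comp huh j).mono (isOpen_annulus r 1) (annulus_mono hr.le le_rfl))
      (fun t ht => by
        have hcore := c.γ_mem_core hr hr1 j (t := t) (by rwa [ht]) ht.le
        have e1 := h₁ k hk _ hcore
        have e2 := hpint k hk j t (by simpa [ht])
        rw [hpe, hu _ (c.core_subset hr1 hcore)]
        rw [ht] at e2
        refine (abs_sub _ _).trans ((add_le_add e1 e2).trans_eq ?_)
        simp only [C]; ring) ht
    rwa [hpe, hu _ (hΩ t ⟨ht.1.le, ht.2.le⟩ ht.2)] at this
  refine ⟨C, by positivity, fun k hk j t ht => ?_⟩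
  have htΩ : c.γ j t ∈ D.Ω := (c.collar j).inner t ⟨hr.trans ht.1, ht.2⟩
  have htb : t ∈ ball (0:ℂ) 1 := annulus_subset_ball r ht
  obtain ⟨C₃, hC₃, h₃⟩ := MCDomain.abs_P_le (singleton_subset_iff.2 htΩ) isCompact_singleton
  set q := (1 + ‖t‖) / (1 - ‖t‖) * C₂
  set L := Real.log ‖t‖ / Real.log r
  have hL : 0 ≤ L := by simpa using log_div_log_nonneg hr0 ht.1.le ht.2.le
  have hq : 0 < q := by
    have : 0 < 1 - ‖t‖ := by simpa using htb
    have := hC₂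
    positivity
  have hCpos : 0 < C := by positivity
  refine le_of_forall_pos_le_add fun ε hε => ?_
  obtain ⟨l, hlc, hl, hle⟩ := MCDomain.exists_continuous_approx hk
    (div_pos hε (show 0 < C₃ + q + C * L by positivity))
  set δ := ∫ z, |k z - l z| ∂D.ω
  have e1 := h₃ _ (hk.sub hl) _ rfl
  have e2 := hpint _ (hk.sub hl) j t htb
  have e3 := hcont l hlc hl j t ht
  simp only [Pi.sub_apply] at e1 e2
  have e4 : ∫ z, |l z| ∂D.ω ≤ (∫ z, |k z| ∂D.ω) + δ := by
    have hd : δ = ∫ z, |(k - l) z| ∂D.ω := rfl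
    rw [hd, ← integral_add hk.abs (hk.sub hl).abs]
    refine integral_mono hl.abs (hk.abs.add (hk.sub hl).abs) fun z => ?_
    have := abs_sub (k z) (k z - l z)
    simpa using this
  have e5 : D.P (k - l) (c.γ j t) = D.P k (c.γ j t) - D.P l (c.γ j t) := MCDomain.P_sub hk hl htΩ
  have e6 := pint_sub (c.integrable_comp_ω hk j) (c.integrable_comp_ω hl j) htb
  rw [e5] at e1
  rw [e6] at e2
  have e7 : δ * (C₃ + q + C * L) ≤ ε := by
    rwa [le_div_iff₀ (by positivity)] at hle
  have e8 : C * (∫ z, |l z| ∂D.ω) * L ≤ C * ((∫ z, |k z| ∂D.ω) + δ) * L := by gcongr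
  have e9 : |D.P k (c.γ j t) - pint (fun t => k (c.γ j t)) t| ≤
      |D.P k (c.γ j t) - D.P l (c.γ j t)| +
      |pint (fun t => k (c.γ j t)) t - pint (fun t => l (c.γ j t)) t| +
      |D.P l (c.γ j t) - pint (fun t => l (c.γ j t)) t| := by
    have := abs_add_three (D.P k (c.γ j t) - D.P l (c.γ j t))
      (-(pint (fun t => k (c.γ j t)) t - pint (fun t => l (c.γ j t)) t))
      (D.P l (c.γ j t) - pint (fun t => l (c.γ j t)) t)
    rw [abs_neg] at this
    refine le_trans (le_of_eq ?_) this
    congr 1; ring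
  have e2' : |pint (fun t => k (c.γ j t)) t - pint (fun t => l (c.γ j t)) t| ≤ q * δ := by
    refine e2.trans_eq ?_
    simp only [q, δ]; ring
  have e1' : |D.P k (c.γ j t) - D.P l (c.γ j t)| ≤ C₃ * δ := e1
  nlinarith

/-- Poisson integrals have the expected nontangential boundary values. -/
theorem ae_tendsto_P {k : ℂ → ℝ} (hk : Integrable k D.ω) (j : Fin (n+1)) :
    ∀ᵐ ζ ∂circ, ∀ A, Tendsto (fun t => D.P k (c.γ j t)) (𝓝[stolz A ζ] ζ) (𝓝 (k (c.γ j ζ))) := by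
  obtain ⟨r, hr, hr1⟩ := exists_between c.r_lt
  obtain ⟨C, -, h⟩ := c.abs_P_sub_pint_le hr hr1
  filter_upwards [circ_sphere, ae_tendsto_pint (c.integrable_comp_ω hk j)] with ζ hζ hlim A
  exact tendsto_of_abs_sub_pint_le hr1 (h k hk j) hζ (hlim A)

/-- Bounded analytic functions have nontangential limits almost everywhere. -/
theorem _root_.MCDomain.ae_exists_ntLim {g : ℂ → ℂ} (hg : DifferentiableOn ℂ g D.Ω) {M : ℝ}
    (hM : ∀ z ∈ D.Ω, ‖g z‖ ≤ M) : ∀ᵐ ζ ∂D.ω, ∃ L, NTLim D.Ω g ζ L := by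
  obtain ⟨c⟩ := D.exists_collars
  refine c.ae_ω (c.ae_of_comp fun j => ?_)
  have := exists_stolz_limit c.r_pos c.r_lt (g := fun t => g (c.γ j t)) (M := M)
    (hg.comp ((c.collar j).diff.mono (c.collar j).inner_subset) (fun t ht => (c.collar j).inner t ht))
    (fun t ht => hM _ ((c.collar j).inner t ht))
  filter_upwards [circ_sphere, this] with ζ hζ hL
  obtain ⟨L, hL⟩ := hL
  exact ⟨L, ((c.collar j).ntLim_iff D.isOpen g hζ L).2 hL⟩

end Collars

end

section

theorem tendsto_radial {ζ : ℂ} (hζ : ζ ∈ sphere (0:ℂ) 1) :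
    Tendsto (fun ρ : ℝ => (ρ:ℂ) * ζ) (𝓝[<] 1) (𝓝[stolz 1 ζ] ζ) := by
  have hn : ‖ζ‖ = 1 := by simpa using hζ
  refine tendsto_nhdsWithin_iff.2 ⟨?_, ?_⟩
  · have : Continuous fun ρ : ℝ => (ρ:ℂ) * ζ := by fun_prop
    have := this.tendsto 1
    simp only [ofReal_one, one_mul] at this
    exact this.mono_left nhdsWithin_le_nhds
  · have h0 : ∀ᶠ ρ : ℝ in 𝓝[<] 1, 0 < ρ := nhdsWithin_le_nhds (lt_mem_nhds one_pos)
    filter_upwards [h0, self_mem_nhdsWithin] with ρ h0 h1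
    have h1 : ρ < 1 := h1
    have e : ‖(ρ:ℂ) * ζ‖ = ρ := by simp [hn, abs_of_pos h0]
    refine ⟨by rwa [mem_ball_zero_iff, e], ?_⟩
    rw [e, show (ρ:ℂ) * ζ - ζ = ((ρ - 1 : ℝ) : ℂ) * ζ by push_cast; ring, norm_mul, hn,
      norm_real, Real.norm_eq_abs, abs_of_neg (by linarith)]
    linarith

theorem stolz_neBot {ζ : ℂ} (hζ : ζ ∈ sphere (0:ℂ) 1) : (𝓝[stolz 1 ζ] ζ).NeBot :=
  (tendsto_radial hζ).neBot

theorem circleAverage_scale (H : ℂ → ℝ) (ρ : ℝ) :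
    Real.circleAverage (fun ζ => H (ρ * ζ)) 0 1 = Real.circleAverage H 0 ρ := by
  simp [Real.circleAverage, circleMap]

theorem continuousOn_scale {r₀ ρ : ℝ} {E : Type*} [TopologicalSpace E] {G : ℂ → E}
    (hG : ContinuousOn G (annulus r₀ 1)) (hr₀ : 0 < r₀) {r : ℝ} (hρ : r₀ < ρ * r) (hr : 0 < r)
    (hρ1 : ρ < 1) : ContinuousOn (fun ζ => G (ρ * ζ)) (cannulus r 1) := by
  have h0 : 0 < ρ := pos_of_mul_pos_left (hr₀.trans hρ) hr.le
  refine hG.comp (by fun_prop) fun t ht => ?_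
  have e : ‖(ρ:ℂ) * t‖ = ρ * ‖t‖ := by simp [abs_of_pos h0]
  refine ⟨?_, ?_⟩ <;> rw [e]
  · exact hρ.trans_le (by gcongr; exact ht.1)
  · have := ht.2
    nlinarith

theorem integral_circ_bounded {r₀ : ℝ} (hr₀ : 0 < r₀) (hr1 : r₀ < 1) {H : ℂ → ℝ}
    (hH : IsHarmonicOn H (annulus r₀ 1)) (h0 : ∀ t ∈ annulus r₀ 1, 0 ≤ H t) :
    ∃ s < 1, ∃ B : ℝ, 0 ≤ B ∧ ∀ ρ : ℝ, s < ρ → ρ < 1 → ∫ ζ, H (ρ * ζ) ∂circ ≤ B := by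
  obtain ⟨s, hs, hs1⟩ := exists_between hr1
  obtain ⟨r, hr, hrs⟩ := exists_between hs
  have hr0 := hr₀.trans hr
  have hs0 := hr0.trans hrs
  set lam := Real.log s / Real.log r
  have hlr : Real.log r < 0 := Real.log_neg hr0 (hrs.trans hs1)
  have hls : Real.log r < Real.log s := Real.log_lt_log hr0 hrs
  have hlam : 0 < 1 - lam := by
    simp only [lam, sub_pos]; rwa [div_lt_one_of_neg hlr]
  have hcirc : ∀ ρ : ℝ, r₀ < ρ → ρ < 1 → ∫ ζ, H (ρ * ζ) ∂circ = Real.circleAverage H 0 ρ := by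
    intro ρ h1 h2
    rw [integral_circ, circleAverage_scale]
    refine (integrable_circ_of_continuousOn ((continuousOn_scale hH.continuousOn hr₀ (r := 1)
      (by simpa) one_pos h2).mono fun t ht => ?_)).1
    have : ‖t‖ = 1 := by simpa using ht
    exact ⟨this.ge, this.le⟩
  have hpos : ∀ ρ : ℝ, r₀ < ρ → ρ < 1 → 0 ≤ ∫ ζ, H (ρ * ζ) ∂circ := fun ρ h1 h2 => by
    refine integral_nonneg_of_ae ?_
    filter_upwards [circ_sphere] with t ht
    have ht : ‖t‖ = 1 := by simpa using ht
    have e : ‖(ρ:ℂ) * t‖ = ρ := by simp [abs_of_pos (hr₀.trans h1), ht]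
    exact h0 _ ⟨by rwa [e], by rwa [e]⟩
  refine ⟨s, hs1, Real.circleAverage H 0 s / (1 - lam),
    div_nonneg (hcirc s hs hs1 ▸ hpos s hs hs1) hlam.le, fun ρ h1 h2 => ?_⟩
  have hρ0 := hs0.trans h1
  have key := circleAverage_outer_le hr0 hrs h1
    (hH.mono (isOpen_annulus r ρ) (annulus_mono hr.le h2.le))
    (hH.continuousOn.mono fun t ht => ⟨hr.trans_le ht.1, ht.2.trans_lt h2⟩)
    (fun t ht => h0 t ⟨by rwa [ht], by rw [ht]; exact hrs.trans hs1⟩)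
  have hA := hpos ρ (hs.trans h1) h2
  rw [hcirc ρ (hs.trans h1) h2] at hA ⊢
  rw [le_div_iff₀ hlam]
  refine le_trans ?_ key
  rw [mul_comm]
  refine mul_le_mul_of_nonneg_right ?_ hA
  have hlρ : Real.log ρ < 0 := Real.log_neg hρ0 h2
  have hlρr : Real.log r < Real.log ρ := Real.log_lt_log hr0 (hrs.trans h1)
  rw [Real.log_div hs0.ne' hρ0.ne', Real.log_div hr0.ne' hρ0.ne']
  simp only [lam, sub_le_sub_iff_left]
  rw [← neg_div_neg_eq, ← neg_div_neg_eq (Real.log s), div_le_div_iff₀ (by linarith) (by linarith)]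
  nlinarith

/-- Truncated logarithm. -/
def logMax (M x : ℝ) : ℝ := Real.log (max x (Real.exp (-M)))

theorem logMax_eq {M x : ℝ} (hx : 0 < x) : logMax M x = max (Real.log x) (-M) := by
  unfold logMax
  rcases le_total x (Real.exp (-M)) with h | h
  · rw [max_eq_right h, Real.log_exp, max_eq_right]
    rwa [Real.log_le_iff_le_exp hx]
  · rw [max_eq_left h, max_eq_left]
    rwa [Real.le_log_iff_exp_le hx]

theorem logMax_zero (M : ℝ) : logMax M 0 = -M := by
  simp [logMax, max_eq_right (Real.exp_pos (-M)).le]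

theorem continuous_logMax (M : ℝ) : Continuous (logMax M) :=
  (continuous_id.max continuous_const).log fun _ => (lt_max_of_lt_right (Real.exp_pos _)).ne'

theorem neg_le_logMax (M x : ℝ) : -M ≤ logMax M x := by
  rw [logMax, Real.le_log_iff_exp_le (lt_max_of_lt_right (Real.exp_pos _))]
  exact le_max_right _ _

theorem logMax_mono (M : ℝ) : Monotone (logMax M) := fun _ _ h =>
  Real.log_le_log (lt_max_of_lt_right (Real.exp_pos _)) (max_le_max_right _ h)

theorem logMax_le {M x : ℝ} (hM : 0 ≤ M) (hx : 0 ≤ x) : logMax M x ≤ x := by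
  rcases hx.eq_or_lt with rfl | hx
  · rw [logMax_zero]; linarith
  · rw [logMax_eq hx]
    exact max_le ((Real.log_le_sub_one_of_pos hx).trans (by linarith)) (by linarith)

theorem abs_logMax_le {M x : ℝ} (hM : 0 ≤ M) (hx : 0 ≤ x) : |logMax M x| ≤ M + x :=
  abs_le.2 ⟨by linarith [neg_le_logMax M x], by linarith [logMax_le hM hx]⟩

theorem logMax_le_min {M N x : ℝ} (hM : 0 ≤ M) (hN : 1 ≤ N) (hx : 0 ≤ x) :
    logMax M x ≤ logMax M (min x N) + x / N := by
  rcases le_total x N with h | h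
  · rw [min_eq_left h]
    have : 0 ≤ x / N := by positivity
    linarith
  · have hx0 : 0 < x := by linarith
    have hN0 : 0 < N := by linarith
    rw [min_eq_right h, logMax_eq hx0, logMax_eq hN0,
      max_eq_left ((neg_nonpos.2 hM).trans (Real.log_nonneg (hN.trans h))),
      max_eq_left ((neg_nonpos.2 hM).trans (Real.log_nonneg hN))]
    have := Real.log_le_sub_one_of_pos (show 0 < x / N by positivity)
    rw [Real.log_div hx0.ne' hN0.ne'] at this
    linarith

theorem subMeanAt_logMax {G : ℂ → ℂ} {U : Set ℂ} (hU : IsOpen U) (hG : DifferentiableOn ℂ G U)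
    (M : ℝ) {z : ℂ} (hz : z ∈ U) : SubMeanAt (fun z => logMax M ‖G z‖) z := by
  have hc : ContinuousOn (fun z => logMax M ‖G z‖) U :=
    (continuous_logMax M).comp_continuousOn hG.continuousOn.norm
  by_cases h0 : G z = 0
  · refine SubMeanAt.of_le hU hz continuousOn_const hc (fun w _ => neg_le_logMax M _) ?_
      (subMeanAt_const (-M) z)
    simp [h0, logMax_zero]
  · have hV : IsOpen (U ∩ G ⁻¹' {0}ᶜ) := hG.continuousOn.isOpen_inter_preimage hU isOpen_compl_singleton
    have hh := isHarmonicOn_log_norm hV (hG.mono inter_subset_left) fun w hw => hw.2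
    refine ((hh.subMeanAt hV ⟨hz, h0⟩).max hV ⟨hz, h0⟩ hh.continuousOn continuousOn_const
      (subMeanAt_const (-M) z)).congr hV ⟨hz, h0⟩ fun w hw => ?_
    exact logMax_eq (norm_pos_iff.2 hw.2)

theorem logMax_le_pint {r₀ r M : ℝ} (hr₀ : 0 < r₀) (hr : r₀ < r) (hr1 : r < 1) (hM : 0 ≤ M)
    {G : ℂ → ℂ} (hG : DifferentiableOn ℂ G (annulus r₀ 1)) {H : ℂ → ℝ}
    (hH : IsHarmonicOn H (annulus r₀ 1)) (hGH : ∀ t ∈ annulus r₀ 1, ‖G t‖ ≤ H t) {g : ℂ → ℝ}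
    (hg : Integrable g circ)
    (hlim : ∀ᵐ ζ ∂circ, Tendsto (fun ρ : ℝ => ‖G (ρ * ζ)‖) (𝓝[<] 1) (𝓝 (g ζ))) :
    ∃ C : ℝ, ∀ t ∈ annulus r 1,
      logMax M ‖G t‖ ≤ pint (fun ζ => logMax M (g ζ)) t + C * (Real.log ‖t‖ / Real.log r) := by
  have hr0 := hr₀.trans hr
  obtain ⟨s, hs1, B, hB0, hB⟩ := integral_circ_bounded hr₀ (hr.trans hr1) hH
    (fun t ht => (norm_nonneg _).trans (hGH t ht))
  obtain ⟨r', hr', hr'r⟩ := exists_between hr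
  obtain ⟨K, hK⟩ := (isCompact_cannulus r' r).exists_bound_of_continuousOn
    (hG.continuousOn.mono fun t ht => ⟨hr'.trans_le ht.1, ht.2.trans_lt hr1⟩)
  have hg0 : ∀ᵐ ζ ∂circ, 0 ≤ g ζ := by
    filter_upwards [hlim] with ζ h
    exact ge_of_tendsto h (.of_forall fun _ => norm_nonneg _)
  obtain ⟨ρ, -, hρ1, hρ⟩ := exists_seq_strictMono_tendsto (1:ℝ)
  have hρ' : Tendsto ρ atTop (𝓝[<] 1) :=
    tendsto_nhdsWithin_iff.2 ⟨hρ, .of_forall fun i => hρ1 i⟩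
  have hrr : r' / r < 1 := (div_lt_one hr0).2 hr'r
  have hev : ∀ᶠ i in atTop, max s (r' / r) < ρ i := hρ.eventually (lt_mem_nhds (max_lt hs1 hrr))
  refine ⟨K + M, fun t ht => ?_⟩
  have htb : t ∈ ball (0:ℂ) 1 := annulus_subset_ball r ht
  set q := (1 + ‖t‖) / (1 - ‖t‖)
  have hq : 0 < q := by
    have : 0 < 1 - ‖t‖ := by simpa using htb
    positivity
  have hint : Integrable (fun ζ => logMax M (g ζ)) circ := by
    refine (((integrable_const M).add hg)).mono'
      ((continuous_logMax M).comp_aestronglyMeasurable hg.1) ?_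
    filter_upwards [hg0] with ζ h using abs_logMax_le hM h
  have hN : ∀ N : ℝ, 1 ≤ N → logMax M ‖G t‖ ≤ pint (fun ζ => logMax M (g ζ)) t + q * B / N +
      (K + M) * (Real.log ‖t‖ / Real.log r) := by
    intro N hN
    have hmb : ∀ x, 0 ≤ x → |logMax M (min x N)| ≤ M + N := fun x hx =>
      (abs_logMax_le hM (le_min hx (by linarith))).trans (by linarith [min_le_right x N])
    have hintN : Integrable (fun ζ => logMax M (min (g ζ) N)) circ := by
      refine (integrable_const (M + N)).mono' ((continuous_logMax M).comp_aestronglyMeasurable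
        (hg.1.aemeasurable.min aemeasurable_const).aestronglyMeasurable) ?_
      filter_upwards [hg0] with ζ h using hmb _ h
    have hcs : ∀ i, max s (r' / r) < ρ i → ContinuousOn (fun ζ => G (ρ i * ζ)) (cannulus r 1) ∧
        0 < ρ i ∧ r' < ρ i * r := fun i hi => by
      have h1 : r' < ρ i * r := (div_lt_iff₀ hr0).1 ((le_max_right _ _).trans_lt hi)
      exact ⟨continuousOn_scale hG.continuousOn hr₀ (hr'.trans h1) hr0 (hρ1 i),
        pos_of_mul_pos_left ((hr₀.trans hr').trans h1) hr0.le, h1⟩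
    have l1 : Tendsto (fun i => logMax M ‖G (ρ i * t)‖) atTop (𝓝 (logMax M ‖G t‖)) := by
      have hGt : ContinuousAt G t := hG.continuousOn.continuousAt
        ((isOpen_annulus _ _).mem_nhds (annulus_mono hr.le le_rfl ht))
      have h1 : Tendsto (fun i => (ρ i : ℂ) * t) atTop (𝓝 t) := by
        have := ((continuous_ofReal.tendsto (1:ℝ)).comp hρ).mul_const t
        simpa using this
      exact ((continuous_logMax M).tendsto _).comp ((hGt.norm.tendsto).comp h1)
    have l2 : Tendsto (fun i => pint (fun ζ => logMax M (min ‖G (ρ i * ζ)‖ N)) t) atTop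
        (𝓝 (pint (fun ζ => logMax M (min (g ζ) N)) t)) := by
      refine tendsto_integral_filter_of_dominated_convergence (fun _ => q * (M + N)) ?_ ?_
        (integrable_const _) ?_
      · filter_upwards [hev] with i hi
        refine (integrable_poissonKernel_mul (integrable_circ_of_continuousOn ?_) htb).1
        exact (continuous_logMax M).comp_continuousOn ((((hcs i hi).1.mono
          (sphere_subset_cannulus hr1)).norm).inf continuousOn_const)
      · refine .of_forall fun i => ?_
        filter_upwards [circ_sphere] with ζ hζ
        rw [norm_mul, Real.norm_of_nonneg (poissonKernel_nonneg hζ htb)]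
        exact mul_le_mul (poissonKernel_le hζ htb) (hmb _ (norm_nonneg _)) (norm_nonneg _) hq.le
      · filter_upwards [hlim] with ζ h
        refine Tendsto.const_mul _ (((continuous_logMax M).tendsto _).comp ?_)
        exact (h.comp hρ').min tendsto_const_nhds
    have hle : pint (fun ζ => logMax M (min (g ζ) N)) t ≤ pint (fun ζ => logMax M (g ζ)) t :=
      pint_mono hintN hint (.of_forall fun ζ => logMax_mono M (min_le_left _ _)) htb
    refine le_trans (le_of_tendsto_of_tendsto l1 ((l2.add_const (q * B / N)).add_const
      ((K + M) * (Real.log ‖t‖ / Real.log r))) ?_) (by gcongr)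
    filter_upwards [hev] with i hi
    obtain ⟨hci, hρ0, hρr⟩ := hcs i hi
    have hsc : ContinuousOn (fun ζ => G (ρ i * ζ)) (sphere 0 1) :=
      hci.mono (sphere_subset_cannulus hr1)
    have hvint : Integrable (fun ζ => logMax M ‖G (ρ i * ζ)‖) circ := integrable_circ_of_continuousOn
      ((continuous_logMax M).comp_continuousOn hsc.norm)
    have hGint : Integrable (fun ζ => ‖G (ρ i * ζ)‖) circ := integrable_circ_of_continuousOn hsc.norm
    have hmap : MapsTo (fun ζ : ℂ => (ρ i : ℂ) * ζ) (annulus r 1) (annulus r₀ 1) := fun t ht => by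
      have e : ‖(ρ i:ℂ) * t‖ = ρ i * ‖t‖ := by simp [abs_of_pos hρ0]
      change r₀ < ‖(ρ i:ℂ) * t‖ ∧ ‖(ρ i:ℂ) * t‖ < 1
      rw [e]
      exact ⟨(hr'.trans hρr).trans (by gcongr; exact ht.1), by nlinarith [ht.2, hρ1 i]⟩
    have s1 := le_pint_add hr0 hr1 (M := K + M)
      ((continuous_logMax M).comp_continuousOn hci.norm)
      (fun t ht => subMeanAt_logMax (isOpen_annulus r 1)
        (hG.comp ((differentiableOn_const _).mul differentiableOn_id) hmap) M ht)
      (fun t' ht' => by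
        have e : ‖(ρ i:ℂ) * t'‖ = ρ i * r := by simp [abs_of_pos hρ0, ht']
        have h1 := hK ((ρ i:ℂ) * t') ⟨by rw [e]; exact hρr.le, by rw [e]; nlinarith [hρ1 i]⟩
        have h2 : -M ≤ pint (fun ζ => logMax M ‖G (ρ i * ζ)‖) t' := le_pint_const hvint
          (.of_forall fun _ => neg_le_logMax _ _) (by simpa [ht'])
        have h3 := logMax_le hM (norm_nonneg (G ((ρ i:ℂ) * t')))
        simp only [Function.comp_apply] at *
        change logMax M ‖G (ρ i * t')‖ - pint (fun ζ => logMax M ‖G (ρ i * ζ)‖) t' ≤ K + M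
        linarith) ht
    change logMax M ‖G (ρ i * t)‖ ≤ pint (fun ζ => logMax M ‖G (ρ i * ζ)‖) t + _ at s1
    refine s1.trans (add_le_add_left ?_ _)
    have hmi : Integrable (fun ζ => logMax M (min ‖G (ρ i * ζ)‖ N)) circ :=
      integrable_circ_of_continuousOn
        ((continuous_logMax M).comp_continuousOn (hsc.norm.inf continuousOn_const))
    have hdi : Integrable (fun ζ => N⁻¹ * ‖G (ρ i * ζ)‖) circ := hGint.const_mul _
    have s2 := pint_mono hvint (hmi.add hdi) (.of_forall fun ζ => by
      have := logMax_le_min hM hN (norm_nonneg (G (ρ i * ζ)))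
      simpa [div_eq_inv_mul] using this) htb
    have s3 := pint_add hmi hdi htb
    have s4 := pint_le hdi (.of_forall fun _ => by positivity) htb
    have s5 : ∫ ζ, N⁻¹ * ‖G (ρ i * ζ)‖ ∂circ ≤ N⁻¹ * B := by
      rw [integral_const_mul]
      refine mul_le_mul_of_nonneg_left (le_trans ?_ (hB (ρ i) ((le_max_left _ _).trans_lt hi)
        (hρ1 i))) (by positivity)
      have hb : ∀ ζ ∈ sphere (0:ℂ) 1, (ρ i : ℂ) * ζ ∈ annulus r₀ 1 := fun ζ hζ => by
        have hζ : ‖ζ‖ = 1 := by simpa using hζ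
        have e : ‖(ρ i:ℂ) * ζ‖ = ρ i := by simp [abs_of_pos hρ0, hζ]
        refine ⟨?_, by rw [e]; exact hρ1 i⟩
        rw [e]; nlinarith
      refine integral_mono_ae hGint (integrable_circ_of_continuousOn
        (hH.continuousOn.comp (by fun_prop) hb)) ?_
      filter_upwards [circ_sphere] with ζ hζ using hGH _ (hb ζ hζ)
    have s6 : q * ∫ ζ, N⁻¹ * ‖G (ρ i * ζ)‖ ∂circ ≤ q * B / N := by
      refine (mul_le_mul_of_nonneg_left s5 hq.le).trans_eq ?_
      rw [div_eq_inv_mul]; ring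
    refine s2.trans (le_of_eq_of_le s3 ?_)
    gcongr
    exact s4.trans s6
  have lN : Tendsto (fun N : ℝ => pint (fun ζ => logMax M (g ζ)) t + q * B / N +
      (K + M) * (Real.log ‖t‖ / Real.log r)) atTop (𝓝 (pint (fun ζ => logMax M (g ζ)) t + 0 +
      (K + M) * (Real.log ‖t‖ / Real.log r))) :=
    ((tendsto_const_nhds.div_atTop tendsto_id).const_add _).add_const _
  rw [add_zero] at lN
  exact ge_of_tendsto lN (eventually_atTop.2 ⟨1, hN⟩)

end

section

namespace Collars
variable {D : MCDomain n} (c : Collars D)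

theorem ae_tendsto_stolz {F f : ℂ → ℂ} (hlim : ∀ᵐ ζ ∂D.ω, NTLim D.Ω F ζ (f ζ)) (j : Fin (n+1)) :
    ∀ᵐ ζ ∂circ, ∀ A, Tendsto (fun t => F (c.γ j t)) (𝓝[stolz A ζ] ζ) (𝓝 (f (c.γ j ζ))) := by
  filter_upwards [circ_sphere, c.ae_comp (c.ae_σ hlim) j] with ζ hζ h
  exact ((c.collar j).ntLim_iff D.isOpen F hζ _).1 h

theorem differentiableOn_comp {F : ℂ → ℂ} (hF : DifferentiableOn ℂ F D.Ω) (j : Fin (n+1)) :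
    DifferentiableOn ℂ (fun t => F (c.γ j t)) (annulus c.r 1) :=
  hF.comp ((c.collar j).diff.mono (c.collar j).inner_subset) (fun t ht => (c.collar j).inner t ht)

end Collars

namespace MCDomain
variable {D : MCDomain n}

/-- Nontangential limits are almost everywhere unique. -/
theorem ntLim_unique {F f g : ℂ → ℂ} (hf : ∀ᵐ ζ ∂D.ω, NTLim D.Ω F ζ (f ζ))
    (hg : ∀ᵐ ζ ∂D.ω, NTLim D.Ω F ζ (g ζ)) : f =ᵐ[D.ω] g := by
  obtain ⟨c⟩ := D.exists_collars
  refine c.ae_ω (c.ae_of_comp fun j => ?_)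
  filter_upwards [circ_sphere, c.ae_tendsto_stolz hf j, c.ae_tendsto_stolz hg j] with ζ hζ h1 h2
  have := stolz_neBot hζ
  exact tendsto_nhds_unique (h1 1) (h2 1)

theorem ntLim_congr {F G : ℂ → ℂ} {ζ L : ℂ} (h : ∀ z ∈ D.Ω, F z = G z) (hF : NTLim D.Ω F ζ L) :
    NTLim D.Ω G ζ L := fun a ha => by
  refine (hF a ha).congr' ?_
  filter_upwards [self_mem_nhdsWithin] with z hz using h z hz.1

theorem integrable_norm {F f : ℂ → ℂ} (hF : DifferentiableOn ℂ F D.Ω) {h : ℂ → ℝ}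
    (hh : IsHarmonicOn h D.Ω) (hFh : ∀ z ∈ D.Ω, ‖F z‖ ≤ h z)
    (hlim : ∀ᵐ ζ ∂D.ω, NTLim D.Ω F ζ (f ζ)) (hfm : Measurable f) :
    Integrable (fun ζ => ‖f ζ‖) D.ω := by
  obtain ⟨c⟩ := D.exists_collars
  refine c.integrable_ω ⟨hfm.norm.aestronglyMeasurable, ?_⟩
  rw [HasFiniteIntegral, c.lintegral_σ hfm.norm.enorm]
  refine ENNReal.sum_lt_top.2 fun j _ => ?_
  obtain ⟨s, hs1, B, hB0, hB⟩ := integral_circ_bounded c.r_pos c.r_lt (c.isHarmonicOn_comp hh j)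
    (fun t ht => (norm_nonneg _).trans (hFh _ ((c.collar j).inner t ht)))
  obtain ⟨ρ, -, hρ1, hρ⟩ := exists_seq_strictMono_tendsto (1:ℝ)
  have hρ' : Tendsto ρ atTop (𝓝[<] 1) :=
    tendsto_nhdsWithin_iff.2 ⟨hρ, .of_forall fun i => hρ1 i⟩
  have hev : ∀ᶠ i in atTop, max s c.r < ρ i := hρ.eventually (lt_mem_nhds (max_lt hs1 c.r_lt))
  obtain ⟨N, hN⟩ := eventually_atTop.1 hev
  set κ : ℕ → ℂ → ℝ≥0∞ := fun i ζ => ‖F (c.γ j (ρ (i + N) * ζ))‖ₑ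
  have hmem : ∀ i, ∀ ζ ∈ sphere (0:ℂ) 1, (ρ (i + N) : ℂ) * ζ ∈ annulus c.r 1 := fun i ζ hζ => by
    have hζ : ‖ζ‖ = 1 := by simpa using hζ
    have h1 := (le_max_right _ _).trans_lt (hN (i + N) (Nat.le_add_left _ _))
    have e : ‖(ρ (i+N):ℂ) * ζ‖ = ρ (i+N) := by simp [abs_of_pos (c.r_pos.trans h1), hζ]
    exact ⟨by rwa [e], by rw [e]; exact hρ1 _⟩
  have hcont : ∀ i, ContinuousOn (fun ζ => F (c.γ j (ρ (i + N) * ζ))) (sphere 0 1) := fun i =>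
    (c.differentiableOn_comp hF j).continuousOn.comp (by fun_prop) (hmem i)
  have hmeas : ∀ i, AEMeasurable (κ i) circ := fun i =>
    (integrable_circ_of_continuousOn (hcont i)).1.enorm
  have hκ : ∀ i, ∫⁻ ζ, κ i ζ ∂circ ≤ ENNReal.ofReal B := fun i => by
    have hi := hN (i + N) (Nat.le_add_left _ _)
    have hint : Integrable (fun ζ => h (c.γ j (ρ (i + N) * ζ))) circ :=
      integrable_circ_of_continuousOn
        ((c.isHarmonicOn_comp hh j).continuousOn.comp (by fun_prop) (hmem i))
    refine le_trans ?_ (ENNReal.ofReal_le_ofReal (hB (ρ (i + N)) ((le_max_left _ _).trans_lt hi)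
      (hρ1 _)))
    have hle : ∀ᵐ ζ ∂circ, ‖F (c.γ j (ρ (i + N) * ζ))‖ ≤ h (c.γ j (ρ (i + N) * ζ)) := by
      filter_upwards [circ_sphere] with ζ hζ using hFh _ ((c.collar j).inner _ (hmem i ζ hζ))
    rw [ofReal_integral_eq_lintegral_ofReal hint (hle.mono fun ζ hζ => (norm_nonneg _).trans hζ)]
    refine lintegral_mono_ae ?_
    filter_upwards [hle] with ζ hζ
    simp only [κ, ← ofReal_norm]
    exact ENNReal.ofReal_le_ofReal hζ
  have hFatou := lintegral_liminf_le' (u := atTop) hmeas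
  refine lt_of_le_of_lt ?_ (lt_of_le_of_lt (hFatou.trans
    (liminf_le_of_frequently_le' (Frequently.of_forall hκ))) ENNReal.ofReal_lt_top)
  refine lintegral_mono_ae ?_
  filter_upwards [circ_sphere, c.ae_tendsto_stolz hlim j] with ζ hζ hl
  have := (((hl 1).comp (tendsto_radial hζ)).comp
    (hρ'.comp (tendsto_add_atTop_nat N))).enorm.liminf_eq
  simp only [enorm_norm]
  exact this.ge

theorem logMax_le_P {F f : ℂ → ℂ} (hF : DifferentiableOn ℂ F D.Ω) {h : ℂ → ℝ}
    (hh : IsHarmonicOn h D.Ω) (hFh : ∀ z ∈ D.Ω, ‖F z‖ ≤ h z)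
    (hlim : ∀ᵐ ζ ∂D.ω, NTLim D.Ω F ζ (f ζ)) (hfm : Measurable f) {M : ℝ} (hM : 0 ≤ M) :
    Integrable (fun ζ => logMax M ‖f ζ‖) D.ω ∧
    ∀ z ∈ D.Ω, logMax M ‖F z‖ ≤ D.P (fun ζ => logMax M ‖f ζ‖) z := by
  have hfi := integrable_norm hF hh hFh hlim hfm
  have hint : Integrable (fun ζ => logMax M ‖f ζ‖) D.ω :=
    ((integrable_const M).add hfi).mono' ((continuous_logMax M).comp_aestronglyMeasurable hfi.1)
      (.of_forall fun ζ => abs_logMax_le hM (norm_nonneg _))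
  refine ⟨hint, fun z hz => ?_⟩
  obtain ⟨c⟩ := D.exists_collars
  obtain ⟨r, hr, hr1⟩ := exists_between c.r_lt
  obtain ⟨C, hC, hCle⟩ := c.abs_P_sub_pint_le hr hr1
  have hj : ∀ j, ∃ C : ℝ, ∀ t ∈ annulus r 1, logMax M ‖F (c.γ j t)‖ ≤
      pint (fun ζ => logMax M ‖f (c.γ j ζ)‖) t + C * (Real.log ‖t‖ / Real.log r) := fun j => by
    refine logMax_le_pint c.r_pos hr hr1 hM (c.differentiableOn_comp hF j)
      (c.isHarmonicOn_comp hh j) (fun t ht => hFh _ ((c.collar j).inner t ht))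
      (c.integrable_comp_ω hfi j) ?_
    filter_upwards [circ_sphere, c.ae_tendsto_stolz hlim j] with ζ hζ hl
    exact ((hl 1).comp (tendsto_radial hζ)).norm
  choose K hK using hj
  have hP := isHarmonicOn_P hint
  have hv : ContinuousOn (fun z => logMax M ‖F z‖) D.Ω :=
    (continuous_logMax M).comp_continuousOn hF.continuousOn.norm
  have := c.nonpos_of_collar_le (v := fun z => logMax M ‖F z‖ - D.P (fun ζ => logMax M ‖f ζ‖) z)
    (hv.sub hP.continuousOn)
    (fun z hz => (subMeanAt_logMax D.isOpen hF M hz).sub_harmonic D.isOpen hz hv hP)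
    (C := (∑ j, |K j|) + C * ∫ ζ, |logMax M ‖f ζ‖| ∂D.ω) hr1 (fun j t ht => by
      have e1 := hK j t ht
      have e2 := (abs_le.1 (hCle _ hint j t ht)).1
      have hL : 0 ≤ Real.log ‖t‖ / Real.log r := by
        simpa using log_div_log_nonneg (c.r_pos.trans hr) ht.1.le ht.2.le
      have e3 : K j ≤ ∑ j, |K j| := (le_abs_self _).trans
        (Finset.single_le_sum (f := fun j => |K j|) (fun _ _ => abs_nonneg _) (Finset.mem_univ j))
      have e4 := mul_le_mul_of_nonneg_right e3 hL
      rw [add_mul]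
      linarith) z hz
  linarith

theorem ae_eq_zero_of_eq_zero {F f : ℂ → ℂ} (hlim : ∀ᵐ ζ ∂D.ω, NTLim D.Ω F ζ (f ζ))
    (h0 : ∀ z ∈ D.Ω, F z = 0) : f =ᵐ[D.ω] 0 := by
  refine ntLim_unique hlim (.of_forall fun ζ => ?_)
  exact ntLim_congr (F := fun _ => 0) (fun z hz => (h0 z hz).symm) fun a _ => tendsto_const_nhds

theorem tendsto_logMax {x : ℝ} (hx : 0 < x) :
    Tendsto (fun i : ℕ => logMax i x) atTop (𝓝 (Real.log x)) := by
  refine tendsto_const_nhds.congr' ?_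
  obtain ⟨N, hN⟩ := exists_nat_ge (-Real.log x)
  filter_upwards [eventually_ge_atTop N] with i hi
  rw [logMax_eq hx, max_eq_left]
  have : (N:ℝ) ≤ i := by exact_mod_cast hi
  linarith

theorem log_integrable {F f : ℂ → ℂ} (hF : DifferentiableOn ℂ F D.Ω) {h : ℂ → ℝ}
    (hh : IsHarmonicOn h D.Ω) (hFh : ∀ z ∈ D.Ω, ‖F z‖ ≤ h z)
    (hlim : ∀ᵐ ζ ∂D.ω, NTLim D.Ω F ζ (f ζ)) (hfm : Measurable f) (hne : ¬ f =ᵐ[D.ω] 0) :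
    (∀ᵐ ζ ∂D.ω, f ζ ≠ 0) ∧ Integrable (fun ζ => Real.log ‖f ζ‖) D.ω ∧
    ∀ z ∈ D.Ω, F z ≠ 0 → Real.log ‖F z‖ ≤ D.P (fun ζ => Real.log ‖f ζ‖) z := by
  have hfi := integrable_norm hF hh hFh hlim hfm
  have hM := fun i : ℕ => logMax_le_P hF hh hFh hlim hfm (Nat.cast_nonneg (α := ℝ) i)
  obtain ⟨w, hw, hw0⟩ : ∃ w ∈ D.Ω, F w ≠ 0 := by
    by_contra! hcon
    exact hne (ae_eq_zero_of_eq_zero hlim hcon)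
  have hpos : 0 < ‖F w‖ := norm_pos_iff.2 hw0
  set B := (∫ ζ, ‖f ζ‖ ∂D.ωm w) - Real.log ‖F w‖
  set κ : ℕ → ℂ → ℝ≥0∞ := fun i ζ => ENNReal.ofReal (‖f ζ‖ - logMax i ‖f ζ‖)
  have hκm : ∀ i, Measurable (κ i) := fun i =>
    (hfm.norm.sub ((continuous_logMax i).measurable.comp hfm.norm)).ennreal_ofReal
  have hκ : ∀ i, ∫⁻ ζ, κ i ζ ∂D.ωm w ≤ ENNReal.ofReal B := fun i => by
    have i1 := D.integrable_ωm hw hfi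
    have i2 := D.integrable_ωm hw (hM i).1
    have e : ENNReal.ofReal (∫ ζ, (‖f ζ‖ - logMax i ‖f ζ‖) ∂D.ωm w) = ∫⁻ ζ, κ i ζ ∂D.ωm w :=
      ofReal_integral_eq_lintegral_ofReal (i1.sub i2) (.of_forall fun ζ =>
        sub_nonneg.2 (logMax_le (Nat.cast_nonneg i) (norm_nonneg _)))
    rw [← e, integral_sub i1 i2]
    refine ENNReal.ofReal_le_ofReal (sub_le_sub_left ?_ _)
    have h1 := (hM i).2 w hw
    rw [logMax_eq hpos] at h1
    exact (le_max_left _ _).trans h1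
  have hFatou := (lintegral_liminf_le (μ := D.ωm w) (u := atTop) hκm).trans
    (liminf_le_of_frequently_le' (Frequently.of_forall hκ))
  have hlt : ∀ᵐ ζ ∂D.ωm w, liminf (fun i => κ i ζ) atTop < ⊤ :=
    ae_lt_top' (Measurable.liminf hκm).aemeasurable (hFatou.trans_lt ENNReal.ofReal_lt_top).ne
  have hf0 : ∀ᵐ ζ ∂D.ωm w, f ζ ≠ 0 := by
    filter_upwards [hlt] with ζ hζ h0
    refine hζ.ne ?_
    have : Tendsto (fun i => κ i ζ) atTop (𝓝 ⊤) := by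
      simp only [κ, h0, norm_zero, logMax_zero, zero_sub, neg_neg, ENNReal.ofReal_natCast]
      exact ENNReal.tendsto_nat_nhds_top
    exact this.liminf_eq
  have hint' : Integrable (fun ζ => ‖f ζ‖ - Real.log ‖f ζ‖) (D.ωm w) := by
    refine ⟨(hfm.norm.sub (Real.measurable_log.comp hfm.norm)).aestronglyMeasurable, ?_⟩
    refine lt_of_le_of_lt ?_ (hFatou.trans_lt ENNReal.ofReal_lt_top)
    refine lintegral_mono_ae ?_
    filter_upwards [hf0] with ζ hζ
    have hp : 0 < ‖f ζ‖ := norm_pos_iff.2 hζ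
    have : Tendsto (fun i => κ i ζ) atTop (𝓝 (ENNReal.ofReal (‖f ζ‖ - Real.log ‖f ζ‖))) :=
      ENNReal.tendsto_ofReal ((tendsto_logMax hp).const_sub _)
    rw [this.liminf_eq, ← ofReal_norm, Real.norm_of_nonneg]
    linarith [Real.log_le_sub_one_of_pos hp]
  have hlogw : Integrable (fun ζ => Real.log ‖f ζ‖) (D.ωm w) := by
    have := (D.integrable_ωm hw hfi).sub hint'
    refine this.congr (.of_forall fun ζ => ?_)
    simp
  have hlog : Integrable (fun ζ => Real.log ‖f ζ‖) D.ω := by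
    obtain ⟨C, -, hC⟩ := D.ωm_le (singleton_subset_iff.2 D.base_mem) isCompact_singleton hw
    exact Measure.integrable_of_le_smul (hC D.w₀ rfl) hlogw
  have hf0' : ∀ᵐ ζ ∂D.ω, f ζ ≠ 0 := D.absolutelyContinuous D.base_mem hw hf0
  refine ⟨hf0', hlog, fun z hz hz0 => ?_⟩
  have hl : Tendsto (fun i : ℕ => D.P (fun ζ => logMax i ‖f ζ‖) z) atTop
      (𝓝 (D.P (fun ζ => Real.log ‖f ζ‖) z)) := by
    refine tendsto_integral_of_dominated_convergence
      (fun ζ => |Real.log ‖f ζ‖| + ‖f ζ‖) (fun i => (D.integrable_ωm hz (hM i).1).1)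
      ((D.integrable_ωm hz hlog).abs.add (D.integrable_ωm hz hfi)) (fun i => ?_) ?_
    · filter_upwards [D.absolutelyContinuous hz D.base_mem hf0'] with ζ hζ
      have hp : 0 < ‖f ζ‖ := norm_pos_iff.2 hζ
      have h1 := logMax_le (Nat.cast_nonneg (α := ℝ) i) hp.le
      have h2 : Real.log ‖f ζ‖ ≤ logMax i ‖f ζ‖ := by rw [logMax_eq hp]; exact le_max_left _ _
      rw [Real.norm_eq_abs, abs_le]
      constructor <;> linarith [neg_abs_le (Real.log ‖f ζ‖), abs_nonneg (Real.log ‖f ζ‖)]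
    · filter_upwards [D.absolutelyContinuous hz D.base_mem hf0'] with ζ hζ
      exact tendsto_logMax (norm_pos_iff.2 hζ)
  refine ge_of_tendsto' hl fun i => le_trans ?_ ((hM i).2 z hz)
  rw [logMax_eq (norm_pos_iff.2 hz0)]
  exact le_max_left _ _

end MCDomain

end

section

/-- The analytic derivative `2 ∂u` of a harmonic function `u`. -/
def hderiv (u : ℂ → ℝ) (z : ℂ) : ℂ := (fderiv ℝ u z 1 : ℝ) - I * (fderiv ℝ u z I : ℝ)

theorem hasFDerivAt_re {g : ℂ → ℂ} {g' z : ℂ} (hg : HasDerivAt g g' z) :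
    HasFDerivAt (fun w => (g w).re)
      (reCLM.comp ((ContinuousLinearMap.toSpanSingleton ℂ g').restrictScalars ℝ)) z :=
  reCLM.hasFDerivAt.comp z (hg.hasFDerivAt.restrictScalars ℝ)

theorem hderiv_eq {u : ℂ → ℝ} {g : ℂ → ℂ} {z g' : ℂ} (hg : HasDerivAt g g' z)
    (h : u =ᶠ[𝓝 z] fun w => (g w).re) : hderiv u z = g' := by
  have := (hasFDerivAt_re hg).congr_of_eventuallyEq h
  rw [hderiv, this.fderiv]
  apply Complex.ext <;> simp

theorem IsHarmonicOn.exists_hasDerivAt {u : ℂ → ℝ} {U : Set ℂ} (hu : IsHarmonicOn u U) {z : ℂ}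
    (hz : z ∈ U) : ∃ r > 0, ball z r ⊆ U ∧ ∃ g : ℂ → ℂ, ∀ w ∈ ball z r,
      u w = (g w).re ∧ HasDerivAt g (hderiv u w) w := by
  obtain ⟨r, hr, hsub, g, hg, hug⟩ := hu z hz
  refine ⟨r, hr, hsub, g, fun w hw => ⟨hug w hw, ?_⟩⟩
  have hd := (hg.differentiableAt (isOpen_ball.mem_nhds hw)).hasDerivAt
  rw [hderiv_eq hd (by filter_upwards [isOpen_ball.mem_nhds hw] with x hx using hug x hx)]
  exact hd

theorem IsHarmonicOn.hasFDerivAt {u : ℂ → ℝ} {U : Set ℂ} (hu : IsHarmonicOn u U) {z : ℂ}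
    (hz : z ∈ U) : HasFDerivAt u (reCLM.comp
      ((ContinuousLinearMap.toSpanSingleton ℂ (hderiv u z)).restrictScalars ℝ)) z := by
  obtain ⟨r, hr, -, g, hg⟩ := hu.exists_hasDerivAt hz
  refine (hasFDerivAt_re (hg z (mem_ball_self hr)).2).congr_of_eventuallyEq ?_
  filter_upwards [ball_mem_nhds z hr] with x hx using (hg x hx).1

theorem IsHarmonicOn.differentiableOn_hderiv {u : ℂ → ℝ} {U : Set ℂ} (hu : IsHarmonicOn u U) :
    DifferentiableOn ℂ (hderiv u) U := by
  intro z hz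
  obtain ⟨r, hr, -, g, hg⟩ := hu.exists_hasDerivAt hz
  have hgd : DifferentiableOn ℂ g (ball z r) :=
    fun w hw => (hg w hw).2.differentiableAt.differentiableWithinAt
  refine DifferentiableAt.differentiableWithinAt ?_
  refine ((hgd.deriv isOpen_ball).differentiableAt (ball_mem_nhds z hr)).congr_of_eventuallyEq ?_
  filter_upwards [ball_mem_nhds z hr] with x hx using (hg x hx).2.deriv.symm

theorem IsHarmonicOn.exists_re_eq {u : ℂ → ℝ} {U : Set ℂ} (hU : IsOpen U)
    (hconn : IsPreconnected U) (hu : IsHarmonicOn u U) {G : ℂ → ℂ}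
    (hG : ∀ z ∈ U, HasDerivAt G (hderiv u z) z) :
    ∃ g : ℂ → ℂ, (∀ z ∈ U, HasDerivAt g (hderiv u z) z) ∧ ∀ z ∈ U, u z = (g z).re := by
  have hd : ∀ z ∈ U, HasFDerivAt (fun w => u w - (G w).re) (0 : ℂ →L[ℝ] ℝ) z := fun z hz => by
    have := (hu.hasFDerivAt hz).sub (hasFDerivAt_re (hG z hz))
    rw [sub_self] at this
    exact this
  obtain ⟨a, ha⟩ := hU.exists_is_const_of_fderiv_eq_zero (𝕜 := ℝ) hconn
    (fun z hz => (hd z hz).differentiableAt.differentiableWithinAt) (fun z hz => (hd z hz).fderiv)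
  refine ⟨fun z => G z + (a : ℂ), fun z hz => (hG z hz).add_const _, fun z hz => ?_⟩
  have := ha z hz
  simp only [add_re, ofReal_re]
  linarith

theorem IsHarmonicOn.exists_re_of_convex {u : ℂ → ℝ} {U : Set ℂ} (hU : IsOpen U)
    (hconv : Convex ℝ U) (hu : IsHarmonicOn u U) :
    ∃ g : ℂ → ℂ, (∀ z ∈ U, HasDerivAt g (hderiv u z) z) ∧ ∀ z ∈ U, u z = (g z).re := by
  obtain ⟨G, hG⟩ := hconv.exists_forall_hasDerivWithinAt hu.differentiableOn_hderiv
  exact hu.exists_re_eq hU hconv.isPreconnected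
    fun z hz => (hG z hz).hasDerivAt (hU.mem_nhds hz)

theorem exists_annulus_rep {u : ℂ → ℝ} {r : ℝ} (hr : 0 < r)
    (hu : IsHarmonicOn u (annulus r 1)) :
    ∃ (p : ℝ) (K : ℂ → ℂ), DifferentiableOn ℂ K (annulus r 1) ∧
      ∀ t ∈ annulus r 1, u t = p * Real.log ‖t‖ + (K t).re := by
  set S : Set ℂ := {w | exp w ∈ annulus r 1} with hS
  have hSo : IsOpen S := (isOpen_annulus r 1).preimage continuous_exp
  have hSc : Convex ℝ S := by
    have : S = reCLM ⁻¹' Ioo (Real.log r) 0 := by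
      ext w
      simp only [hS, annulus, mem_ofPred_eq, norm_exp, mem_preimage, mem_Ioo, reCLM_apply,
        Real.exp_lt_one_iff, Real.log_lt_iff_lt_exp hr]
    rw [this]
    exact (convex_Ioo _ _).linear_preimage reCLM.toLinearMap
  obtain ⟨Q, hQ, hQu⟩ := (hu.comp hSo differentiable_exp.differentiableOn
    (fun w hw => hw)).exists_re_of_convex hSo hSc
  have hper : ∀ w, w + 2 * Real.pi * I ∈ S ↔ w ∈ S := fun w => by
    simp only [hS, mem_ofPred_eq, exp_periodic w]
  have hshift : ∀ w ∈ S, u (exp (w + 2 * Real.pi * I)) = u (exp w) := fun w _ => by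
    rw [exp_periodic w]
  have hQd : ∀ w ∈ S, HasDerivAt (fun w => Q (w + 2 * Real.pi * I) - Q w) 0 w := by
    intro w hw
    have h1 : HasDerivAt (fun w => Q (w + 2 * Real.pi * I)) (hderiv (fun z => u (exp z))
        (w + 2 * Real.pi * I)) w :=
      (hQ _ ((hper w).2 hw)).comp_add_const w (2 * Real.pi * I)
    have h2 : hderiv (fun z => u (exp z)) w
        = hderiv (fun z => u (exp z)) (w + 2 * Real.pi * I) := by
      refine hderiv_eq h1 ?_
      filter_upwards [hSo.mem_nhds hw] with x hx
      rw [← hQu _ ((hper x).2 hx), hshift x hx]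
    have := h1.sub (hQ w hw)
    rwa [h2, sub_self] at this
  obtain ⟨a, ha⟩ := hSo.exists_is_const_of_deriv_eq_zero hSc.isPreconnected
    (fun z hz => (hQd z hz).differentiableAt.differentiableWithinAt) (fun z hz => (hQd z hz).deriv)
  set p : ℝ := a.im / (2 * Real.pi) with hp
  have hK : ∀ w ∈ S, Q (w + 2 * Real.pi * I) - p * (w + 2 * Real.pi * I) = Q w - p * w := by
    intro w hw
    have h1 := ha w hw
    have h2 : a.re = 0 := by
      rw [← h1, sub_re, ← hQu _ hw, ← hQu _ ((hper w).2 hw), hshift w hw, sub_self]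
    have h3 : (p : ℂ) * (2 * Real.pi * I) = a := by
      apply Complex.ext
      · simp [h2]
      · have : ((2:ℂ) * Real.pi * I).im = 2 * Real.pi := by simp
        rw [im_ofReal_mul, this, hp]
        field_simp
    linear_combination h1 - h3
  classical
  set T : ℂ → ℂ := fun w => if w ∈ S then Q w - p * w else 0 with hT
  have hTp : Function.Periodic T (2 * Real.pi * I) := by
    intro w
    simp only [hT, hper]
    split_ifs with h
    · exact hK w h
    · rfl
  have hTe : ∀ w w', exp w = exp w' → T w = T w' := by
    intro w w' h
    obtain ⟨k, hk⟩ := exp_eq_exp_iff_exists_int.1 h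
    rw [hk]
    exact (hTp.int_mul k) w'
  have hTS : ∀ w ∈ S, T w = Q w - p * w := fun w hw => if_pos hw
  have hne : ∀ t ∈ annulus r 1, t ≠ 0 := fun t ht h => by
    have := ht.1
    rw [h, norm_zero] at this
    exact hr.not_gt this
  have hlog : ∀ t ∈ annulus r 1, log t ∈ S := fun t ht => by
    rw [hS, mem_ofPred_eq, exp_log (hne t ht)]; exact ht
  refine ⟨p, fun t => T (log t), fun t ht => DifferentiableAt.differentiableWithinAt ?_,
    fun t ht => ?_⟩
  · set L : ℂ → ℂ := fun s => log (s / t) + log t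
    have hL : DifferentiableAt ℂ L t := by
      have : t / t ∈ slitPlane := by rw [div_self (hne t ht)]; exact one_mem_slitPlane
      exact ((differentiableAt_id.div_const t).clog this).add_const _
    have hLt : L t = log t := by simp [L, div_self (hne t ht)]
    have hTd : DifferentiableAt ℂ T (L t) := by
      have h1 : DifferentiableAt ℂ (fun w => Q w - p * w) (L t) :=
        (hLt ▸ (hQ _ (hlog t ht)).differentiableAt).sub (by fun_prop)
      refine h1.congr_of_eventuallyEq ?_
      rw [hLt]
      filter_upwards [hSo.mem_nhds (hlog t ht)] with w hw using hTS w hw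
    refine (hTd.comp t hL).congr_of_eventuallyEq ?_
    filter_upwards [isOpen_ne.mem_nhds (hne t ht)] with s hs
    refine hTe _ _ ?_
    simp only [L]
    rw [exp_log hs, exp_add, exp_log (hne t ht), exp_log (div_ne_zero hs (hne t ht)),
      div_mul_cancel₀ _ (hne t ht)]
  · simp only
    rw [hTS _ (hlog t ht), sub_re, ← hQu _ (hlog t ht), exp_log (hne t ht), re_ofReal_mul, log_re]
    ring

end

section

theorem integral_fderiv_eq_zero {g : ℂ → ℂ} (hg : ContDiff ℝ 1 g) (hc : HasCompactSupport g)
    (v : ℂ) : ∫ z, fderiv ℝ g z v = 0 := by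
  have hd : Continuous fun z => fderiv ℝ g z v :=
    (hg.continuous_fderiv one_ne_zero).clm_apply continuous_const
  have hdc : HasCompactSupport fun z => fderiv ℝ g z v := hc.fderiv_apply ℝ v
  have := integral_mul_fderiv_eq_neg_fderiv_mul_of_integrable (μ := (volume : Measure ℂ))
    (f := fun _ : ℂ => (1:ℂ)) (g := g) (v := v) (by simp)
    (by simpa using hd.integrable_of_hasCompactSupport hdc)
    (by simpa using hg.continuous.integrable_of_hasCompactSupport hc)
    (fun _ _ => differentiableAt_const _)
    (fun x _ => (hg.differentiable one_ne_zero) x)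
  simpa using this

theorem integral_curl_eq_zero {α : ℂ → ℂ →L[ℝ] ℂ} (hα : ContDiff ℝ 1 α)
    (hc : HasCompactSupport α) :
    ∫ z, (fderiv ℝ α z 1 I - fderiv ℝ α z I 1) = 0 := by
  have hint : ∀ v w : ℂ, Integrable fun z => fderiv ℝ α z v w := fun v w => by
    refine Continuous.integrable_of_hasCompactSupport ?_ ?_
    · exact ((hα.continuous_fderiv one_ne_zero).clm_apply continuous_const).clm_apply
        continuous_const
    · refine (hc.fderiv_apply ℝ v).mono' fun z hz => subset_closure fun h => hz ?_
      simp [h]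
  have hz : ∀ v w : ℂ, ∫ z, fderiv ℝ α z v w = 0 := fun v w => by
    rw [← integral_fderiv_eq_zero (g := fun z => α z w) (hα.clm_apply contDiff_const)
      (hc.mono fun z hz h => hz (by simp [h])) v]
    congr 1 with z
    have h1 := ((hα.differentiable one_ne_zero) z).hasFDerivAt.clm_apply (hasFDerivAt_const w z)
    rw [h1.fderiv]
    simp
  rw [integral_sub (hint _ _) (hint _ _), hz, hz, sub_zero]

theorem exists_transition {x y : ℝ} (hxy : x < y) : ∃ θ : ℝ → ℝ, ContDiff ℝ 3 θ ∧ Monotone θ ∧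
    (∀ s ≤ x, θ s = 0) ∧ (∀ s, y ≤ s → θ s = 1) ∧ ∃ s, x < s ∧ s < y ∧ 0 < deriv θ s := by
  have hpos : 0 < y - x := sub_pos.2 hxy
  set θ : ℝ → ℝ := fun s => Real.smoothTransition ((s - x) / (y - x)) with hθ
  have hd : ContDiff ℝ 3 θ :=
    (Real.smoothTransition.contDiff).comp ((contDiff_id.sub contDiff_const).div_const _)
  have hm : Monotone θ := fun s t hst => Real.smoothTransition.monotone (by gcongr)
  have h0 : ∀ s ≤ x, θ s = 0 := fun s hs =>
    Real.smoothTransition.zero_of_nonpos (div_nonpos_of_nonpos_of_nonneg (by linarith) hpos.le)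
  have h1 : ∀ s, y ≤ s → θ s = 1 := fun s hs =>
    Real.smoothTransition.one_of_one_le ((one_le_div hpos).2 (by linarith))
  refine ⟨θ, hd, hm, h0, h1, ?_⟩
  obtain ⟨s, hs, hs'⟩ := exists_deriv_eq_slope θ hxy hd.continuous.continuousOn
    (hd.differentiable (by norm_num)).differentiableOn
  refine ⟨s, hs.1, hs.2, ?_⟩
  rw [hs', h0 x le_rfl, h1 y le_rfl]
  positivity

namespace Collars

variable {D : MCDomain n} (c : Collars D)

/-- The inverse of the `j`-th collar chart. -/
def ψ (j : Fin (n+1)) : ℂ → ℂ := (c.collar j).exists_inverse.choose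

theorem ψ_γ {j : Fin (n+1)} {t : ℂ} (ht : t ∈ annulus c.r c.r⁻¹) : c.ψ j (c.γ j t) = t :=
  (c.collar j).exists_inverse.choose_spec.2 t ht

theorem inner_subset : annulus c.r 1 ⊆ annulus c.r c.r⁻¹ := (c.collar 0).inner_subset

theorem isOpen_image_inner (j : Fin (n+1)) : IsOpen (c.γ j '' annulus c.r 1) :=
  (c.collar j).isOpen_image (isOpen_annulus _ _) c.inner_subset

theorem analyticAt_ψ {j : Fin (n+1)} {t : ℂ} (ht : t ∈ annulus c.r 1) :
    AnalyticAt ℂ (c.ψ j) (c.γ j t) := by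
  have h := (c.collar j).exists_inverse.choose_spec.1
  exact (h.mono (image_mono c.inner_subset)).analyticAt
    ((c.isOpen_image_inner j).mem_nhds (mem_image_of_mem _ ht))

theorem hasDerivAt_γ {j : Fin (n+1)} {t : ℂ} (ht : t ∈ annulus c.r 1) :
    HasDerivAt (c.γ j) (deriv (c.γ j) t) t :=
  ((c.collar j).analyticAt (c.inner_subset ht)).differentiableAt.hasDerivAt

theorem deriv_γ_ne {j : Fin (n+1)} {t : ℂ} (ht : t ∈ annulus c.r 1) : deriv (c.γ j) t ≠ 0 :=
  (c.collar j).deriv_ne t (c.inner_subset ht)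

theorem hasDerivAt_ψ {j : Fin (n+1)} {t : ℂ} (ht : t ∈ annulus c.r 1) :
    HasDerivAt (c.ψ j) (deriv (c.γ j) t)⁻¹ (c.γ j t) := by
  have h1 := (c.analyticAt_ψ (j := j) ht).differentiableAt.hasDerivAt
  have h2 := h1.comp t (c.hasDerivAt_γ ht)
  have h3 : HasDerivAt (fun s : ℂ => s) 1 t := hasDerivAt_id t
  have h4 : (c.ψ j ∘ c.γ j) =ᶠ[𝓝 t] fun s => s := by
    filter_upwards [(isOpen_annulus _ _).mem_nhds ht] with s hs using c.ψ_γ (c.inner_subset hs)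
  have h5 := (h3.congr_of_eventuallyEq h4).unique h2
  rw [eq_comm, mul_eq_one_iff_eq_inv₀ (c.deriv_γ_ne ht)] at h5
  rw [h5] at h1
  exact h1

variable {E : Type*} [NormedAddCommGroup E]

open Classical in
/-- A function on the annulus transported to the `j`-th collar, extended by zero. -/
def push (j : Fin (n+1)) (Q : ℂ → E) (z : ℂ) : E :=
  if z ∈ c.γ j '' annulus c.r 1 then Q (c.ψ j z) else 0

theorem push_γ {j : Fin (n+1)} (Q : ℂ → E) {t : ℂ} (ht : t ∈ annulus c.r 1) :
    c.push j Q (c.γ j t) = Q t := by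
  rw [push, if_pos (mem_image_of_mem _ ht), c.ψ_γ (c.inner_subset ht)]

theorem push_of_notMem {j : Fin (n+1)} (Q : ℂ → E) {z : ℂ} (hz : z ∉ c.γ j '' annulus c.r 1) :
    c.push j Q z = 0 := if_neg hz

theorem push_γ_ne {j k : Fin (n+1)} (hjk : j ≠ k) (Q : ℂ → E) {t : ℂ} (ht : t ∈ annulus c.r 1) :
    c.push j Q (c.γ k t) = 0 := by
  refine c.push_of_notMem Q ?_
  rintro ⟨s, hs, h⟩
  exact hjk (c.inj (c.inner_subset hs) (c.inner_subset ht) h).1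

theorem push_eventuallyEq {j : Fin (n+1)} (Q : ℂ → E) {t : ℂ} (ht : t ∈ annulus c.r 1) :
    c.push j Q =ᶠ[𝓝 (c.γ j t)] fun z => Q (c.ψ j z) := by
  filter_upwards [(c.isOpen_image_inner j).mem_nhds (mem_image_of_mem _ ht)] with z hz
    using if_pos hz

theorem push_eventually_zero {j : Fin (n+1)} {Q : ℂ → E} {a b : ℝ} (ha : c.r < a)
    (hb : b < c.r⁻¹) (hQa : ∀ t, ‖t‖ ≤ a → Q t = 0) (hQb : ∀ t ∈ annulus c.r 1, b < ‖t‖ → Q t = 0)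
    {z : ℂ} (hz : z ∉ c.γ j '' cannulus a b) : ∀ᶠ w in 𝓝 z, c.push j Q w = 0 := by
  have hK : IsCompact (c.γ j '' cannulus a b) := by
    refine (isCompact_cannulus a b).image_of_continuousOn ?_
    exact (c.collar j).diff.continuousOn.mono fun t ht => ⟨ha.trans_le ht.1, ht.2.trans_lt hb⟩
  filter_upwards [hK.isClosed.isOpen_compl.mem_nhds hz] with w hw
  by_cases h : w ∈ c.γ j '' annulus c.r 1
  · obtain ⟨t, ht, rfl⟩ := h
    rw [c.push_γ Q ht]
    rcases le_or_gt ‖t‖ a with h1 | h1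
    · exact hQa t h1
    rcases le_or_gt ‖t‖ b with h2 | h2
    · exact (hw ⟨t, ⟨h1.le, h2⟩, rfl⟩).elim
    · exact hQb t ht h2
  · exact c.push_of_notMem Q h

theorem push_eventually_zero_of_notMem {j : Fin (n+1)} {Q : ℂ → E} {a : ℝ} (ha : c.r < a)
    (hQa : ∀ t, ‖t‖ ≤ a → Q t = 0) {z : ℂ} (hz : z ∈ D.Ω) (h : z ∉ c.γ j '' annulus c.r 1) :
    ∀ᶠ w in 𝓝 z, c.push j Q w = 0 := by
  refine c.push_eventually_zero (b := 1) ha (c.collar j).one_lt_inv hQa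
    (fun t ht h => absurd ht.2 h.not_gt) ?_
  rintro ⟨t, ht, rfl⟩
  have htA : t ∈ annulus c.r c.r⁻¹ :=
    ⟨ha.trans_le ht.1, ht.2.trans_lt (c.collar j).one_lt_inv⟩
  exact h (mem_image_of_mem _
    (⟨htA.1, (c.collar j).lt_one_of_mem D.isOpen htA hz⟩ : t ∈ annulus c.r 1))

theorem contDiffAt_push [NormedSpace ℝ E] {j : Fin (n+1)} {Q : ℂ → E} {a : ℝ} {m : WithTop ℕ∞} (ha : c.r < a)
    (hQ : ContDiffOn ℝ m Q (annulus c.r 1)) (hQa : ∀ t, ‖t‖ ≤ a → Q t = 0)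
    {z : ℂ} (hz : z ∈ D.Ω) : ContDiffAt ℝ m (c.push j Q) z := by
  by_cases h : z ∈ c.γ j '' annulus c.r 1
  · obtain ⟨t, ht, rfl⟩ := h
    refine ContDiffAt.congr_of_eventuallyEq ?_ (c.push_eventuallyEq Q ht)
    have h1 : ContDiffAt ℝ m (c.ψ j) (c.γ j t) := (c.analyticAt_ψ ht).contDiffAt.restrict_scalars ℝ
    have h2 : ContDiffAt ℝ m Q (c.ψ j (c.γ j t)) := by
      rw [c.ψ_γ (c.inner_subset ht)]
      exact hQ.contDiffAt ((isOpen_annulus _ _).mem_nhds ht)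
    exact h2.comp _ h1
  · refine (contDiffAt_const (c := (0:E))).congr_of_eventuallyEq (f₁ := c.push j Q) ?_
    exact c.push_eventually_zero_of_notMem ha hQa hz h

end Collars

end

section

/-- A smooth monotone function used to cut off near the boundary circle, in the variable `|t|²`. -/
structure Cutoff (r : ℝ) where
  a : ℝ
  b : ℝ
  θ : ℝ → ℝ
  pos : 0 < r
  ra : r < a
  ab : a < b
  b1 : b < 1
  contDiff : ContDiff ℝ 3 θ
  mono : Monotone θ
  zero : ∀ s ≤ a ^ 2, θ s = 0
  one : ∀ s, b ^ 2 ≤ s → θ s = 1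
  deriv_pos : ∃ s, a ^ 2 < s ∧ s < b ^ 2 ∧ 0 < deriv θ s

theorem exists_cutoff {r : ℝ} (hr : 0 < r) (hr1 : r < 1) : Nonempty (Cutoff r) := by
  have h : ((2 * r + 1) / 3) ^ 2 < ((r + 2) / 3) ^ 2 := by
    exact pow_lt_pow_left₀ (by linarith) (by positivity) two_ne_zero
  obtain ⟨θ, h1, h2, h3, h4, h5⟩ := exists_transition h
  exact ⟨⟨_, _, θ, hr, by linarith, by linarith, by linarith, h1, h2, h3, h4, h5⟩⟩

namespace Cutoff

variable {r : ℝ} (χ : Cutoff r)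

theorem a_pos : 0 < χ.a := χ.pos.trans χ.ra

theorem zero_of_norm_le {t : ℂ} (ht : ‖t‖ ≤ χ.a) : χ.θ (‖t‖ ^ 2) = 0 :=
  χ.zero _ (pow_le_pow_left₀ (norm_nonneg t) ht 2)

theorem one_of_le_norm {t : ℂ} (ht : χ.b ≤ ‖t‖) : χ.θ (‖t‖ ^ 2) = 1 :=
  χ.one _ (pow_le_pow_left₀ (χ.a_pos.trans χ.ab).le ht 2)

theorem contDiff_norm : ContDiff ℝ 3 fun t : ℂ => χ.θ (‖t‖ ^ 2) :=
  χ.contDiff.comp (contDiff_norm_sq ℝ)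

theorem continuous_deriv : Continuous (deriv χ.θ) := χ.contDiff.continuous_deriv (by norm_num)

theorem deriv_zero {s : ℝ} (hs : s ≤ χ.a ^ 2) : deriv χ.θ s = 0 := by
  have h : Set.EqOn (deriv χ.θ) (fun _ => 0) (closure (Iio (χ.a ^ 2))) := by
    refine Set.EqOn.closure (fun s hs => ?_) χ.continuous_deriv continuous_const
    have : χ.θ =ᶠ[𝓝 s] fun _ => 0 := by
      filter_upwards [isOpen_Iio.mem_nhds hs] with x hx using χ.zero x (le_of_lt hx)
    rw [this.deriv_eq, deriv_const]
  exact h (by rwa [closure_Iio])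

theorem deriv_one {s : ℝ} (hs : χ.b ^ 2 < s) : deriv χ.θ s = 0 := by
  have : χ.θ =ᶠ[𝓝 s] fun _ => 1 := by
    filter_upwards [isOpen_Ioi.mem_nhds hs] with x hx using χ.one x (le_of_lt hx)
  rw [this.deriv_eq, deriv_const]

end Cutoff

namespace Collars

variable {D : MCDomain n} (c : Collars D) (χ : Cutoff c.r)

/-- The density of the curl of the cut-off form `dψ/ψ`. -/
def dens (j : Fin (n+1)) : ℂ → ℝ :=
  c.push j fun t => 2 * deriv χ.θ (‖t‖ ^ 2) / ‖deriv (c.γ j) t‖ ^ 2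

theorem dens_nonneg (j : Fin (n+1)) (z : ℂ) : 0 ≤ c.dens χ j z := by
  rw [dens, push]
  split_ifs
  · have := χ.mono.deriv_nonneg (x := ‖c.ψ j z‖ ^ 2)
    positivity
  · exact le_rfl

theorem differentiableOn_deriv_γ (j : Fin (n+1)) :
    DifferentiableOn ℂ (deriv (c.γ j)) (annulus c.r 1) :=
  ((c.collar j).diff.mono c.inner_subset).deriv (isOpen_annulus _ _)

theorem dens_zero_of_le {j : Fin (n+1)} (t : ℂ) (ht : ‖t‖ ≤ χ.a) :
    2 * deriv χ.θ (‖t‖ ^ 2) / ‖deriv (c.γ j) t‖ ^ 2 = 0 := by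
  rw [χ.deriv_zero (pow_le_pow_left₀ (norm_nonneg t) ht 2)]; simp

theorem dens_zero_of_lt {j : Fin (n+1)} (t : ℂ) (ht : χ.b < ‖t‖) :
    2 * deriv χ.θ (‖t‖ ^ 2) / ‖deriv (c.γ j) t‖ ^ 2 = 0 := by
  rw [χ.deriv_one (pow_lt_pow_left₀ ht (χ.a_pos.trans χ.ab).le two_ne_zero)]; simp

theorem image_cannulus_subset (j : Fin (n+1)) :
    c.γ j '' cannulus χ.a χ.b ⊆ c.γ j '' annulus c.r 1 :=
  image_mono fun _ ht => ⟨χ.ra.trans_le ht.1, ht.2.trans_lt χ.b1⟩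

theorem dens_eventually_zero {j : Fin (n+1)} {z : ℂ} (hz : z ∉ c.γ j '' cannulus χ.a χ.b) :
    ∀ᶠ w in 𝓝 z, c.dens χ j w = 0 :=
  c.push_eventually_zero χ.ra (χ.b1.trans (c.collar j).one_lt_inv) (c.dens_zero_of_le χ)
    (fun t _ => c.dens_zero_of_lt χ t) hz

theorem continuous_dens (j : Fin (n+1)) : Continuous (c.dens χ j) := by
  rw [continuous_iff_continuousAt]
  intro z
  by_cases hz : z ∈ c.γ j '' cannulus χ.a χ.b
  · obtain ⟨t, ht, rfl⟩ := c.image_cannulus_subset χ j hz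
    refine ContinuousAt.congr ?_ (c.push_eventuallyEq _ ht).symm
    have h1 : ContinuousAt (c.ψ j) (c.γ j t) := (c.analyticAt_ψ ht).continuousAt
    have h2 : ContinuousAt (fun t => 2 * deriv χ.θ (‖t‖ ^ 2) / ‖deriv (c.γ j) t‖ ^ 2)
        (c.ψ j (c.γ j t)) := by
      rw [c.ψ_γ (c.inner_subset ht)]
      have h3 : ContinuousAt (deriv (c.γ j)) t :=
        ((c.differentiableOn_deriv_γ j).differentiableAt
          ((isOpen_annulus _ _).mem_nhds ht)).continuousAt
      have h4 : Continuous fun t : ℂ => 2 * deriv χ.θ (‖t‖ ^ 2) :=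
        continuous_const.mul (χ.continuous_deriv.comp (continuous_norm.pow 2))
      exact h4.continuousAt.div (h3.norm.pow 2)
        (pow_ne_zero 2 (norm_ne_zero_iff.2 (c.deriv_γ_ne ht)))
    exact ContinuousAt.comp (g := fun t => 2 * deriv χ.θ (‖t‖ ^ 2) / ‖deriv (c.γ j) t‖ ^ 2) h2 h1
  · exact continuousAt_const.congr
      ((c.dens_eventually_zero χ hz).mono fun w hw => hw.symm)

theorem hasCompactSupport_dens (j : Fin (n+1)) : HasCompactSupport (c.dens χ j) := by
  refine HasCompactSupport.intro (K := c.γ j '' cannulus χ.a χ.b) ?_ fun z hz =>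
    (c.dens_eventually_zero χ hz).self_of_nhds
  refine (isCompact_cannulus _ _).image_of_continuousOn ?_
  exact (c.collar j).diff.continuousOn.mono fun t ht =>
    ⟨χ.ra.trans_le ht.1, (ht.2.trans_lt χ.b1).trans (c.collar j).one_lt_inv⟩

theorem integral_dens_pos (j : Fin (n+1)) : 0 < ∫ z, c.dens χ j z := by
  obtain ⟨s, hs1, hs2, hs⟩ := χ.deriv_pos
  have hs0 : 0 ≤ s := (sq_nonneg _).trans hs1.le
  have hn : ‖((√s : ℝ) : ℂ)‖ = √s := by
    rw [Complex.norm_real, Real.norm_eq_abs, abs_of_nonneg (Real.sqrt_nonneg s)]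
  have ht : ((√s : ℝ) : ℂ) ∈ annulus c.r 1 := by
    refine ⟨?_, ?_⟩
    · rw [hn]; exact χ.ra.trans (Real.lt_sqrt_of_sq_lt hs1)
    · rw [hn]
      exact ((Real.sqrt_lt' (χ.a_pos.trans χ.ab)).2 hs2).trans χ.b1
  refine (c.continuous_dens χ j).integral_pos_of_hasCompactSupport_nonneg_nonzero
    (c.hasCompactSupport_dens χ j) (c.dens_nonneg χ j) (x := c.γ j (√s : ℝ)) ?_
  rw [dens, c.push_γ _ ht, hn, Real.sq_sqrt hs0]
  have := norm_ne_zero_iff.2 (c.deriv_γ_ne (j := j) ht)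
  positivity

/-- The cut-off of the logarithmic derivative of the inverse of a collar chart. -/
def logForm (j : Fin (n+1)) : ℂ → ℂ :=
  c.push j fun t => χ.θ (‖t‖ ^ 2) • (t * deriv (c.γ j) t)⁻¹

theorem ne_zero_of_mem {t : ℂ} (ht : t ∈ annulus c.r 1) : t ≠ 0 := fun h => by
  have := ht.1
  rw [h, norm_zero] at this
  exact c.r_pos.not_gt this

theorem contDiffAt_logForm (j : Fin (n+1)) {z : ℂ} (hz : z ∈ D.Ω) :
    ContDiffAt ℝ 3 (c.logForm χ j) z := by
  refine c.contDiffAt_push χ.ra ?_ (fun t ht => by rw [χ.zero_of_norm_le ht, zero_smul]) hz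
  refine χ.contDiff_norm.contDiffOn.smul ?_
  have h : DifferentiableOn ℂ (fun t => (t * deriv (c.γ j) t)⁻¹) (annulus c.r 1) :=
    (differentiableOn_id.mul (c.differentiableOn_deriv_γ j)).inv fun t ht =>
      mul_ne_zero (c.ne_zero_of_mem ht) (c.deriv_γ_ne ht)
  exact (h.contDiffOn (isOpen_annulus _ _)).restrict_scalars ℝ

theorem curl_logForm (j : Fin (n+1)) {z : ℂ} (hz : z ∈ D.Ω) :
    fderiv ℝ (c.logForm χ j) z 1 * I - fderiv ℝ (c.logForm χ j) z I = I * c.dens χ j z := by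
  by_cases h : z ∈ c.γ j '' annulus c.r 1
  · obtain ⟨t, ht, rfl⟩ := h
    have hψt := c.ψ_γ (j := j) (c.inner_subset ht)
    have hψ := c.hasDerivAt_ψ (j := j) ht
    set p := (deriv (c.γ j) t)⁻¹ with hp
    have hψR : HasFDerivAt (c.ψ j)
      ((ContinuousLinearMap.toSpanSingleton ℂ p).restrictScalars ℝ) (c.γ j t) :=
      hψ.hasFDerivAt.restrictScalars ℝ
    have hγ' : DifferentiableAt ℂ (deriv (c.γ j)) (c.ψ j (c.γ j t)) := by
      rw [hψt]
      exact (c.differentiableOn_deriv_γ j).differentiableAt ((isOpen_annulus _ _).mem_nhds ht)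
    have hq : DifferentiableAt ℂ (fun z => (c.ψ j z * deriv (c.γ j) (c.ψ j z))⁻¹) (c.γ j t) := by
      refine (hψ.differentiableAt.mul (hγ'.comp _ hψ.differentiableAt)).inv ?_
      change c.ψ j (c.γ j t) * deriv (c.γ j) (c.ψ j (c.γ j t)) ≠ 0
      rw [hψt]
      exact mul_ne_zero (c.ne_zero_of_mem ht) (c.deriv_γ_ne ht)
    have hqR := hq.hasDerivAt.hasFDerivAt.restrictScalars ℝ
    set q' := deriv (fun z => (c.ψ j z * deriv (c.γ j) (c.ψ j z))⁻¹) (c.γ j t)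
    have hθ : HasDerivAt χ.θ (deriv χ.θ (‖t‖ ^ 2)) (‖c.ψ j (c.γ j t)‖ ^ 2) := by
      rw [hψt]
      exact (χ.contDiff.differentiable (by norm_num) _).hasDerivAt
    have hθR := hθ.comp_hasFDerivAt (c.γ j t) hψR.norm_sq
    have hP := (hθR.smul hqR).congr_of_eventuallyEq (f₁ := c.logForm χ j)
      (c.push_eventuallyEq (j := j) (fun t => χ.θ (‖t‖ ^ 2) • (t * deriv (c.γ j) t)⁻¹) ht)
    rw [hP.fderiv, dens, c.push_γ _ ht]
    simp only [hψt]
    have e1 : ∀ v : ℂ, (inner ℝ t v : ℝ) = (v * (starRingEnd ℂ) t).re := fun v =>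
      Complex.inner t v
    have hne := c.deriv_γ_ne (j := j) ht
    have ht0 := c.ne_zero_of_mem ht
    simp [e1, Complex.real_smul, -map_mul]
    have k1 : ((p.re : ℂ) * t.re + p.im * t.im) * I - (-(p.im * t.re) + p.re * t.im)
        = I * ((starRingEnd ℂ) p * t) := by
      apply Complex.ext <;> simp <;> ring
    have k2 : (starRingEnd ℂ) p * p * (‖deriv (c.γ j) t‖ : ℂ) ^ 2 = 1 := by
      rw [Complex.conj_mul', ← mul_pow, ← Complex.ofReal_mul, hp, norm_inv,
        inv_mul_cancel₀ (norm_ne_zero_iff.2 hne)]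
      simp
    have hn : (‖deriv (c.γ j) t‖ : ℂ) ≠ 0 := by exact_mod_cast norm_ne_zero_iff.2 hne
    rw [← hp, mul_div_assoc', eq_div_iff (pow_ne_zero 2 hn)]
    have k3 : t * t⁻¹ = 1 := mul_inv_cancel₀ ht0
    linear_combination (2 * ((deriv χ.θ (‖t‖ ^ 2) : ℝ) : ℂ) * (p * t⁻¹) * (‖deriv (c.γ j) t‖ : ℂ) ^ 2) * k1
      + (2 * ((deriv χ.θ (‖t‖ ^ 2) : ℝ) : ℂ) * I) * k2
      + (2 * ((deriv χ.θ (‖t‖ ^ 2) : ℝ) : ℂ) * I * ((starRingEnd ℂ) p * p * (‖deriv (c.γ j) t‖ : ℂ) ^ 2)) * k3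
  · have h0 := c.push_eventually_zero_of_notMem (j := j)
      (Q := fun t => χ.θ (‖t‖ ^ 2) • (t * deriv (c.γ j) t)⁻¹) χ.ra
      (fun t ht => by rw [χ.zero_of_norm_le ht, zero_smul]) hz h
    have h1 : c.logForm χ j =ᶠ[𝓝 z] fun _ => 0 := h0
    rw [h1.fderiv_eq, dens, c.push_of_notMem _ h]
    simp

end Collars

end

section

namespace Collars

variable {D : MCDomain n} (c : Collars D)

/-- `u` is harmonic and has the logarithmic representation `p j * log |t| + Re (K j t)` in the
`j`-th collar. -/
structure IsRep (u : ℂ → ℝ) (p : Fin (n+1) → ℝ) (K : Fin (n+1) → ℂ → ℂ) : Prop where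
  harm : IsHarmonicOn u D.Ω
  diff : ∀ j, DifferentiableOn ℂ (K j) (annulus c.r 1)
  eq : ∀ j, ∀ t ∈ annulus c.r 1, u (c.γ j t) = p j * Real.log ‖t‖ + (K j t).re

variable {c} {u : ℂ → ℝ} {p : Fin (n+1) → ℝ} {K : Fin (n+1) → ℂ → ℂ}

theorem IsRep.hasDerivAt_K (h : c.IsRep u p K) {j : Fin (n+1)} {t : ℂ} (ht : t ∈ annulus c.r 1) :
    HasDerivAt (K j) (hderiv u (c.γ j t) * deriv (c.γ j) t - p j / t) t := by
  have hK := ((h.diff j).differentiableAt ((isOpen_annulus _ _).mem_nhds ht)).hasDerivAt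
  have ht0 := c.ne_zero_of_mem ht
  obtain ⟨r, hr, -, g, hg⟩ := h.harm.exists_hasDerivAt ((c.collar j).inner t ht)
  have h1 : HasDerivAt (fun s => g (c.γ j s)) (hderiv u (c.γ j t) * deriv (c.γ j) t) t :=
    (hg _ (mem_ball_self hr)).2.comp t (c.hasDerivAt_γ ht)
  have h2 : HasDerivAt (fun s => (p j : ℂ) * (log (s / t) + Real.log ‖t‖) + K j s)
      (p j * t⁻¹ + deriv (K j) t) t := by
    refine HasDerivAt.add ?_ hK
    refine HasDerivAt.const_mul _ (HasDerivAt.add_const _ ?_)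
    have hs : t / t ∈ slitPlane := by rw [div_self ht0]; exact one_mem_slitPlane
    have := ((hasDerivAt_id t).div_const t).clog hs
    simpa [div_self ht0] using this
  have e1 : (fun s => u (c.γ j s)) =ᶠ[𝓝 t] fun s => (g (c.γ j s)).re := by
    have := (c.hasDerivAt_γ (j := j) ht).continuousAt.preimage_mem_nhds (ball_mem_nhds _ hr)
    filter_upwards [this] with s hs using (hg _ hs).1
  have e2 : (fun s => u (c.γ j s)) =ᶠ[𝓝 t]
      fun s => ((p j : ℂ) * (log (s / t) + Real.log ‖t‖) + K j s).re := by
    filter_upwards [(isOpen_annulus _ _).mem_nhds ht] with s hs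
    have hs0 := c.ne_zero_of_mem hs
    rw [h.eq j s hs, add_re, re_ofReal_mul, add_re, log_re, norm_div, ofReal_re,
      Real.log_div (norm_ne_zero_iff.2 hs0) (norm_ne_zero_iff.2 ht0)]
    ring
  have h3 := (hderiv_eq h1 e1).symm.trans (hderiv_eq h2 e2)
  have h4 : hderiv u (c.γ j t) * deriv (c.γ j) t - p j / t = deriv (K j) t := by
    rw [h3]; ring
  rwa [h4]

variable (c) (χ : Cutoff c.r)

/-- The cut-off of the analytic parts of a logarithmic representation. -/
def cutK (K : Fin (n+1) → ℂ → ℂ) (z : ℂ) : ℂ :=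
  ∑ j, c.push j (fun t => χ.θ (‖t‖ ^ 2) • K j t) z

/-- The derivative of `u` with the cut-off logarithmic poles removed. -/
def regDeriv (u : ℂ → ℝ) (p : Fin (n+1) → ℝ) (z : ℂ) : ℂ :=
  hderiv u z - ∑ j, p j * c.logForm χ j z

open Classical in
/-- The compactly supported form obtained from `2 ∂u dz` by removing its boundary part. -/
def form (u : ℂ → ℝ) (p : Fin (n+1) → ℝ) (K : Fin (n+1) → ℂ → ℂ) (z : ℂ) : ℂ →L[ℝ] ℂ :=
  if z ∈ D.Ω then ContinuousLinearMap.mul ℝ ℂ (c.regDeriv χ u p z) - fderiv ℝ (c.cutK χ K) z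
  else 0

variable {c}

theorem IsRep.contDiffAt_cutK (h : c.IsRep u p K) {z : ℂ} (hz : z ∈ D.Ω) :
    ContDiffAt ℝ 3 (c.cutK χ K) z := by
  refine ContDiffAt.sum fun j _ => ?_
  refine c.contDiffAt_push χ.ra ?_ (fun t ht => by rw [χ.zero_of_norm_le ht, zero_smul]) hz
  exact χ.contDiff_norm.contDiffOn.smul
    (((h.diff j).contDiffOn (isOpen_annulus _ _)).restrict_scalars ℝ)

theorem IsRep.differentiableAt_hderiv (h : c.IsRep u p K) {z : ℂ} (hz : z ∈ D.Ω) :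
    DifferentiableAt ℂ (hderiv u) z :=
  h.harm.differentiableOn_hderiv.differentiableAt (D.isOpen.mem_nhds hz)

theorem IsRep.contDiffAt_regDeriv (h : c.IsRep u p K) {z : ℂ} (hz : z ∈ D.Ω) :
    ContDiffAt ℝ 3 (c.regDeriv χ u p) z := by
  refine ContDiffAt.sub ?_ (ContDiffAt.sum fun j _ => contDiffAt_const.mul
    (c.contDiffAt_logForm χ j hz))
  exact ((h.harm.differentiableOn_hderiv.contDiffOn D.isOpen).contDiffAt
    (D.isOpen.mem_nhds hz)).restrict_scalars ℝ

theorem IsRep.curl_regDeriv (h : c.IsRep u p K) {z : ℂ} (hz : z ∈ D.Ω) :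
    fderiv ℝ (c.regDeriv χ u p) z 1 * I - fderiv ℝ (c.regDeriv χ u p) z I
      = -I * ∑ j, p j * (c.dens χ j z : ℂ) := by
  have h1 := (h.differentiableAt_hderiv hz).hasDerivAt.hasFDerivAt.restrictScalars ℝ
  have h2 : ∀ j, HasFDerivAt (fun z => (p j : ℂ) * c.logForm χ j z)
      ((p j : ℂ) • fderiv ℝ (c.logForm χ j) z) z := fun j =>
    (((c.contDiffAt_logForm χ j hz).differentiableAt (by norm_num)).hasFDerivAt).const_mul _
  have h3 : HasFDerivAt (c.regDeriv χ u p) _ z := h1.sub (HasFDerivAt.fun_sum fun j _ => h2 j)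
  rw [h3.fderiv]
  simp only [_root_.sub_apply, _root_.sum_apply,
    _root_.smul_apply, ContinuousLinearMap.coe_restrictScalars',
    ContinuousLinearMap.toSpanSingleton_apply, smul_eq_mul]
  have h4 : ∀ j, (p j : ℂ) * (c.dens χ j z : ℂ) * I =
      p j * (fderiv ℝ (c.logForm χ j) z 1 * I) - p j * fderiv ℝ (c.logForm χ j) z I := fun j => by
    rw [← mul_sub, c.curl_logForm χ j hz]; ring
  have h5 : (∑ j, (p j : ℂ) * (c.dens χ j z : ℂ)) * I =
      (∑ j, (p j : ℂ) * fderiv ℝ (c.logForm χ j) z 1) * I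
        - ∑ j, p j * fderiv ℝ (c.logForm χ j) z I := by
    rw [Finset.sum_mul, Finset.sum_mul, ← Finset.sum_sub_distrib]
    exact Finset.sum_congr rfl fun j _ => by rw [h4 j]; ring
  linear_combination h5

theorem IsRep.form_eventuallyEq {z : ℂ} (hz : z ∈ D.Ω) : c.form χ u p K =ᶠ[𝓝 z] fun z =>
    ContinuousLinearMap.mul ℝ ℂ (c.regDeriv χ u p z) - fderiv ℝ (c.cutK χ K) z := by
  filter_upwards [D.isOpen.mem_nhds hz] with w hw using if_pos hw

theorem IsRep.form_eq_zero (h : c.IsRep u p K) {z : ℂ} (hz : z ∉ c.core χ.b) :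
    c.form χ u p K z = 0 := by
  by_cases hΩ : z ∈ D.Ω
  swap
  · exact if_neg hΩ
  have hmem : z ∈ ⋃ j, c.γ j '' annulus χ.b c.r⁻¹ := by
    by_contra h'
    exact hz ⟨subset_closure hΩ, h'⟩
  obtain ⟨j, t, ht, rfl⟩ := mem_iUnion.1 hmem
  have hrb : c.r < χ.b := χ.ra.trans χ.ab
  have ht1 : ‖t‖ < 1 := (c.collar j).lt_one_of_mem D.isOpen ⟨hrb.trans ht.1, ht.2⟩ hΩ
  have htA : t ∈ annulus c.r 1 := ⟨hrb.trans ht.1, ht1⟩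
  rw [form, if_pos hΩ, sub_eq_zero]
  have hK := h.hasDerivAt_K (j := j) htA
  have hψt := c.ψ_γ (j := j) (c.inner_subset htA)
  have hKψ : HasDerivAt (fun z => K j (c.ψ j z))
      ((hderiv u (c.γ j t) * deriv (c.γ j) t - p j / t) * (deriv (c.γ j) t)⁻¹) (c.γ j t) := by
    refine HasDerivAt.comp (h₂ := K j) (c.γ j t) ?_ (c.hasDerivAt_ψ htA)
    rwa [hψt]
  have he : c.cutK χ K =ᶠ[𝓝 (c.γ j t)] fun z => K j (c.ψ j z) := by
    have hop : IsOpen (c.γ j '' annulus χ.b 1) :=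
      (c.collar j).isOpen_image (isOpen_annulus _ _)
        ((annulus_mono hrb.le le_rfl).trans c.inner_subset)
    filter_upwards [hop.mem_nhds (mem_image_of_mem _ (⟨ht.1, ht1⟩ : t ∈ annulus χ.b 1))] with w hw
    obtain ⟨s, hs, rfl⟩ := hw
    have hsA : s ∈ annulus c.r 1 := ⟨hrb.trans hs.1, hs.2⟩
    rw [cutK, Finset.sum_eq_single j]
    · rw [c.push_γ _ hsA, c.ψ_γ (c.inner_subset hsA), χ.one_of_le_norm hs.1.le, one_smul]
    · exact fun k _ hk => c.push_γ_ne hk _ hsA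
    · simp
  have hreg : c.regDeriv χ u p (c.γ j t)
      = (hderiv u (c.γ j t) * deriv (c.γ j) t - p j / t) * (deriv (c.γ j) t)⁻¹ := by
    rw [regDeriv, Finset.sum_eq_single j]
    · rw [logForm, c.push_γ _ htA, χ.one_of_le_norm ht.1.le, one_smul]
      have := c.deriv_γ_ne (j := j) htA
      have := c.ne_zero_of_mem htA
      field_simp
    · exact fun k _ hk => by rw [logForm, c.push_γ_ne hk _ htA, mul_zero]
    · simp
  rw [((hKψ.hasFDerivAt.restrictScalars ℝ).congr_of_eventuallyEq he).fderiv, hreg]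
  ext <;> simp [mul_comm]

theorem IsRep.hasCompactSupport_form (h : c.IsRep u p K) :
    HasCompactSupport (c.form χ u p K) :=
  HasCompactSupport.intro (c.isCompact_core (χ.ra.trans χ.ab).le) fun _ hz => h.form_eq_zero χ hz

theorem IsRep.form_eventually_zero (h : c.IsRep u p K) {z : ℂ} (hz : z ∉ D.Ω) :
    c.form χ u p K =ᶠ[𝓝 z] fun _ => 0 := by
  have : z ∈ (c.core χ.b)ᶜ := fun h' => hz (c.core_subset χ.b1 h')
  filter_upwards [(c.isCompact_core (χ.ra.trans χ.ab).le).isClosed.isOpen_compl.mem_nhds this]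
    with w hw using h.form_eq_zero χ hw

theorem IsRep.contDiff_form (h : c.IsRep u p K) : ContDiff ℝ 1 (c.form χ u p K) := by
  rw [contDiff_iff_contDiffAt]
  intro z
  by_cases hz : z ∈ D.Ω
  · refine ContDiffAt.congr_of_eventuallyEq ?_ (IsRep.form_eventuallyEq χ hz)
    refine ContDiffAt.sub ?_ ?_
    · exact (ContinuousLinearMap.mul ℝ ℂ).contDiff.contDiffAt.comp z
        ((h.contDiffAt_regDeriv χ hz).of_le (by norm_num))
    · exact (h.contDiffAt_cutK χ hz).fderiv_right (by norm_num)
  · exact contDiffAt_const.congr_of_eventuallyEq (h.form_eventually_zero χ hz)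

theorem IsRep.curl_form (h : c.IsRep u p K) (z : ℂ) :
    fderiv ℝ (c.form χ u p K) z 1 I - fderiv ℝ (c.form χ u p K) z I 1
      = -I * ∑ j, p j * (c.dens χ j z : ℂ) := by
  by_cases hz : z ∈ D.Ω
  · have h1 := ((h.contDiffAt_regDeriv χ hz).differentiableAt (by norm_num)).hasFDerivAt
    have h2 := ((h.contDiffAt_cutK χ hz).fderiv_right (m := 2) (by norm_num)).differentiableAt
      (by norm_num)
    have h3 := (((ContinuousLinearMap.mul ℝ ℂ).hasFDerivAt.comp z h1).sub
      h2.hasFDerivAt).congr_of_eventuallyEq (IsRep.form_eventuallyEq χ hz)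
    have h4 := ((h.contDiffAt_cutK χ hz).isSymmSndFDerivAt (by simp; norm_num)) 1 I
    rw [h3.fderiv, ← h.curl_regDeriv χ hz]
    simp [h4]
  · rw [(h.form_eventually_zero χ hz).fderiv_eq]
    have : ∀ j, c.dens χ j z = 0 := fun j => c.push_of_notMem _ fun ⟨t, ht, h'⟩ =>
      hz (h' ▸ (c.collar j).inner t ht)
    simp [this]

/-- The residues of a harmonic function satisfy a universal linear relation. -/
theorem IsRep.sum_eq_zero (h : c.IsRep u p K) : ∑ j, (∫ z, c.dens χ j z) * p j = 0 := by
  have h1 := integral_curl_eq_zero (h.contDiff_form χ) (h.hasCompactSupport_form χ)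
  simp only [h.curl_form χ] at h1
  have hint : ∀ j, Integrable (c.dens χ j) := fun j =>
    (c.continuous_dens χ j).integrable_of_hasCompactSupport (c.hasCompactSupport_dens χ j)
  rw [MeasureTheory.integral_const_mul, integral_finsetSum Finset.univ
    (f := fun j z => (p j : ℂ) * ((c.dens χ j z : ℝ) : ℂ)) fun j _ =>
    ((hint j).ofReal (𝕜 := ℂ)).const_mul _] at h1
  simp only [MeasureTheory.integral_const_mul] at h1
  have h2 := (mul_eq_zero.1 h1).resolve_left (by simp)
  have h3 : ∀ j, ∫ z, ((c.dens χ j z : ℝ) : ℂ) = ((∫ z, c.dens χ j z : ℝ) : ℂ) := fun j =>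
    integral_ofReal
  simp only [h3] at h2
  have h4 : ((∑ j, (∫ z, c.dens χ j z) * p j : ℝ) : ℂ) = 0 := by
    rw [← h2]; push_cast
    exact Finset.sum_congr rfl fun j _ => mul_comm _ _
  exact_mod_cast h4

/-- A harmonic function without residues is the real part of an analytic function. -/
theorem IsRep.exists_re (h : c.IsRep u 0 K) :
    ∃ G : ℂ → ℂ, DifferentiableOn ℂ G D.Ω ∧ ∀ z ∈ D.Ω, u z = (G z).re := by
  obtain ⟨χ⟩ := exists_cutoff c.r_pos c.r_lt
  have hsymm : ∀ a ∈ (univ : Set ℂ), ∀ x y : ℂ,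
      fderiv ℝ (c.form χ u 0 K) a x y = fderiv ℝ (c.form χ u 0 K) a y x := by
    intro a _ x y
    have h1 := h.curl_form χ a
    simp only [Pi.zero_apply, ofReal_zero, zero_mul, Finset.sum_const_zero, mul_zero] at h1
    set T := fderiv ℝ (c.form χ u 0 K) a
    have hx : ∀ w : ℂ, w = w.re • (1:ℂ) + w.im • I := fun w => by simp
    have h2 : T 1 I = T I 1 := sub_eq_zero.1 h1
    rw [hx x, hx y]
    simp only [map_add, map_smul, _root_.add_apply, _root_.smul_apply, h2]
    simp only [smul_add, smul_smul, mul_comm y.re, mul_comm y.im]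
    abel
  obtain ⟨A, hA⟩ := convex_univ.exists_forall_hasFDerivAt_of_fderiv_symmetric isOpen_univ
    ((h.contDiff_form χ).differentiable one_ne_zero).differentiableOn hsymm
  have hG : ∀ z ∈ D.Ω, HasDerivAt (fun z => A z + c.cutK χ K z) (hderiv u z) z := by
    intro z hz
    have h1 := (hA z trivial).add
      ((h.contDiffAt_cutK χ hz).differentiableAt (by norm_num)).hasFDerivAt
    have h2 : c.form χ u 0 K z + fderiv ℝ (c.cutK χ K) z
        = ContinuousLinearMap.mul ℝ ℂ (hderiv u z) := by
      rw [form, if_pos hz, sub_add_cancel, regDeriv]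
      simp
    rw [h2] at h1
    refine (hasFDerivAt_of_restrictScalars ℝ h1 ?_)
    ext <;> simp [mul_comm]
  obtain ⟨g, hg, hug⟩ := h.harm.exists_re_eq D.isOpen D.conn.isPreconnected hG
  exact ⟨g, fun z hz => (hg z hz).differentiableAt.differentiableWithinAt, hug⟩

end Collars

end

section

namespace MCDomain
variable (D : MCDomain n)

/-- The function on the boundary equal to `a j` on the `j`-th component. -/
def step (a : Fin (n+1) → ℝ) (ζ : ℂ) : ℝ := ∑ j, (D.Γ j).indicator (fun _ => a j) ζ

variable {D}

theorem step_of_mem (a : Fin (n+1) → ℝ) {j : Fin (n+1)} {ζ : ℂ} (hζ : ζ ∈ D.Γ j) :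
    D.step a ζ = a j := by
  rw [step, Finset.sum_eq_single j]
  · simp [hζ]
  · intro k _ hk
    exact indicator_of_notMem (fun h => (D.disj k j hk).le_bot ⟨h, hζ⟩) _
  · simp

theorem isCompact_Γ (j : Fin (n+1)) : IsCompact (D.Γ j) := (D.curve j).isCompact

theorem integrable_step (a : Fin (n+1) → ℝ) : Integrable (D.step a) D.ω :=
  integrable_finsetSum _ fun j _ =>
    (integrable_const (a j)).indicator (isCompact_Γ j).isClosed.measurableSet

theorem exists_mem_Γ {ζ : ℂ} (hζ : ζ ∈ frontier D.Ω) : ∃ j, ζ ∈ D.Γ j := by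
  rw [D.frontier_eq] at hζ; exact mem_iUnion.1 hζ

theorem Γ_subset (j : Fin (n+1)) : D.Γ j ⊆ frontier D.Ω :=
  D.frontier_eq ▸ subset_iUnion D.Γ j

theorem ae_exists_mem_Γ : ∀ᵐ ζ ∂D.ω, ∃ j, ζ ∈ D.Γ j := by
  filter_upwards [D.ae_mem_frontier D.base_mem] with ζ hζ using exists_mem_Γ hζ

theorem continuousOn_step (a : Fin (n+1) → ℝ) : ContinuousOn (D.step a) (frontier D.Ω) := by
  intro ζ hζ
  obtain ⟨j, hj⟩ := exists_mem_Γ hζ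
  have h1 : ∀ k, k ≠ j → ∀ᶠ z in 𝓝 ζ, z ∉ D.Γ k := fun k hk =>
    (isCompact_Γ k).isClosed.isOpen_compl.mem_nhds fun h => (D.disj k j hk).le_bot ⟨h, hj⟩
  have h2 : ∀ᶠ z in 𝓝 ζ, ∀ k, k ≠ j → z ∉ D.Γ k := by
    refine eventually_all.2 fun k => ?_
    by_cases hk : k = j
    · simp [hk]
    · filter_upwards [h1 k hk] with z hz _ using hz
  have h3 : D.step a =ᶠ[𝓝[frontier D.Ω] ζ] fun _ => a j := by
    filter_upwards [nhdsWithin_le_nhds h2, self_mem_nhdsWithin] with z hz hz'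
    obtain ⟨k, hk⟩ := exists_mem_Γ hz'
    by_cases hkj : k = j
    · exact step_of_mem a (hkj ▸ hk)
    · exact absurd hk (hz k hkj)
  exact (continuousWithinAt_const).congr_of_eventuallyEq h3 (step_of_mem a hj)

theorem P_step_sum (a : Fin (n+1) → ℝ) {z : ℂ} (hz : z ∈ D.Ω) :
    D.P (D.step a) z = ∑ i, a i * D.P (D.step (Pi.single i 1)) z := by
  have h : ∀ ζ, D.step a ζ = ∑ i, a i * D.step (Pi.single i 1) ζ := by
    intro ζ
    simp only [step, Finset.mul_sum]
    rw [Finset.sum_comm]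
    refine Finset.sum_congr rfl fun j _ => ?_
    by_cases hj : ζ ∈ D.Γ j
    · simp [hj, Pi.single_apply]
    · simp [hj]
  simp only [P, h]
  rw [integral_finsetSum Finset.univ (f := fun i ζ => a i * D.step (Pi.single i 1) ζ)
    fun i _ => (D.integrable_ωm hz (integrable_step _)).const_mul _]
  simp only [MeasureTheory.integral_const_mul]

end MCDomain

namespace Collars
variable {D : MCDomain n} {c : Collars D}

theorem exists_rep {u : ℂ → ℝ} (hu : IsHarmonicOn u D.Ω) : ∃ p K, c.IsRep u p K := by
  choose p K hK h using fun j => exists_annulus_rep c.r_pos (c.isHarmonicOn_comp hu j)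
  exact ⟨p, K, hu, hK, h⟩

theorem IsRep.congr {u v : ℂ → ℝ} {p : Fin (n+1) → ℝ} {K : Fin (n+1) → ℂ → ℂ}
    (h : c.IsRep u p K) (huv : ∀ z ∈ D.Ω, v z = u z) : c.IsRep v p K where
  harm := h.harm.congr huv
  diff := h.diff
  eq j t ht := by rw [huv _ ((c.collar j).inner t ht), h.eq j t ht]

theorem IsRep.sub {u v : ℂ → ℝ} {p q : Fin (n+1) → ℝ} {K L : Fin (n+1) → ℂ → ℂ}
    (h : c.IsRep u p K) (h' : c.IsRep v q L) :
    c.IsRep (fun z => u z - v z) (p - q) (fun j t => K j t - L j t) where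
  harm := h.harm.sub h'.harm
  diff j := (h.diff j).sub (h'.diff j)
  eq j t ht := by
    rw [h.eq j t ht, h'.eq j t ht]; simp; ring

theorem IsRep.linear {ι : Type*} [Fintype ι] {u : ι → ℂ → ℝ} {p : ι → Fin (n+1) → ℝ}
    {K : ι → Fin (n+1) → ℂ → ℂ} (h : ∀ i, c.IsRep (u i) (p i) (K i)) (a : ι → ℝ) :
    c.IsRep (fun z => ∑ i, a i * u i z) (∑ i, a i • p i)
      (fun j t => ∑ i, (a i : ℂ) * K i j t) where
  harm := IsHarmonicOn.sum D.isOpen _ fun i _ => (h i).harm.const_mul (a i)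
  diff j := DifferentiableOn.fun_sum fun i _ => ((h i).diff j).const_mul _
  eq j t ht := by
    simp only [(h _).eq j t ht, re_sum, Finset.sum_apply, Pi.smul_apply, smul_eq_mul,
      Finset.sum_mul, ← Finset.sum_add_distrib, re_ofReal_mul]
    exact Finset.sum_congr rfl fun i _ => by ring

theorem _root_.circleAverage_re_eq {K : ℂ → ℂ} {r ρ s : ℝ} (hr : 0 < r)
    (hK : DifferentiableOn ℂ K (annulus r 1)) (hρ : r < ρ) (hρs : ρ ≤ s) (hs : s < 1) :
    Real.circleAverage (fun t => (K t).re) 0 s = Real.circleAverage (fun t => (K t).re) 0 ρ := by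
  have hρ0 : 0 < ρ := hr.trans hρ
  have hd : ∀ z, ρ ≤ ‖z‖ → ‖z‖ ≤ s → DifferentiableAt ℂ K z := fun z h1 h2 =>
    hK.differentiableAt ((isOpen_annulus r 1).mem_nhds ⟨by linarith, by linarith⟩)
  have key := Complex.circleIntegral_sub_center_inv_smul_eq_of_differentiable_on_annulus_off_countable
    (c := 0) (f := K) (s := ∅) hρ0 hρs countable_empty
    (fun z hz => (hd z (by simpa using hz.2) (by simpa using hz.1)).continuousAt.continuousWithinAt)
    (fun z hz => hd z (by simpa using hz.1.2 : ρ < ‖z‖).le (by simpa using hz.1.1 : ‖z‖ < s).le)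
  have h1 : ∀ x, ρ ≤ x → x ≤ s → Real.circleAverage (fun t => (K t).re) 0 x
      = (Real.circleAverage K 0 x).re := by
    intro x hx hxs
    have hi : CircleIntegrable K 0 x := ContinuousOn.circleIntegrable (hρ0.le.trans hx) fun z hz => by
      have : ‖z‖ = x := by simpa using hz
      exact (hd z (by linarith) (by linarith)).continuousAt.continuousWithinAt
    exact (reCLM.circleAverage_comp_comm hi)
  rw [h1 s hρs le_rfl, h1 ρ le_rfl hρs, Real.circleAverage_eq_circleIntegral (by linarith),
    Real.circleAverage_eq_circleIntegral hρ0.ne', key]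

/-- A locally constant boundary function whose harmonic extension has no residues is constant. -/
theorem IsRep.eq_const {a : Fin (n+1) → ℝ} {K : Fin (n+1) → ℂ → ℂ}
    (h : c.IsRep (D.P (D.step a)) 0 K) : ∃ m, ∀ i, a i = m := by
  obtain ⟨j, hj⟩ := Finite.exists_max a
  set m := a j with hm
  obtain ⟨u, huc, huh, hub, huP⟩ := D.exists_solution (MCDomain.continuousOn_step a)
  have hle : ∀ z ∈ D.Ω, u z ≤ m := by
    intro z hz
    rw [huP z hz]
    refine (MCDomain.P_mono (MCDomain.integrable_step a) (integrable_const m) ?_ hz).trans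
      (MCDomain.P_const m hz).le
    filter_upwards [MCDomain.ae_exists_mem_Γ] with ζ ⟨k, hk⟩
    rw [MCDomain.step_of_mem a hk]; exact hj k
  set r := (c.r + 1) / 2 with hr
  have hr1 : c.r < r := by have := c.r_lt; linarith
  have hr2 : r < 1 := by have := c.r_lt; linarith
  have hr0 : 0 < r := c.r_pos.trans hr1
  set v : ℂ → ℝ := fun t => u (c.γ j t) with hv
  have hvc : ContinuousOn v (cannulus r 1) := c.continuousOn_comp huc hr1 j
  have hvK : ∀ t ∈ annulus c.r 1, v t = (K j t).re := fun t ht => by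
    have h1 := h.eq j t ht
    simp only [Pi.zero_apply, zero_mul, zero_add] at h1
    rw [← h1]; exact huP _ ((c.collar j).inner t ht)
  have hvavg : ∀ s, r ≤ s → s < 1 → Real.circleAverage v 0 s = Real.circleAverage v 0 r := by
    intro s hs hs1
    have hcg : ∀ x, r ≤ x → x < 1 → Real.circleAverage v 0 x
        = Real.circleAverage (fun t => (K j t).re) 0 x := fun x hx hx1 =>
      Real.circleAverage_congr_sphere fun t ht => hvK t (by
        have : ‖t‖ = x := by simpa [abs_of_pos (hr0.trans_le hx)] using ht
        exact ⟨by linarith, by linarith⟩)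
    rw [hcg s hs hs1, hcg r le_rfl hr2, circleAverage_re_eq c.r_pos (h.diff j) hr1 hs hs1]
  have hv1 : ∀ t ∈ sphere (0:ℂ) 1, v t = m := fun t ht => by
    rw [hv]; simp only
    rw [hub _ (c.γ_mem_frontier j ht)]
    exact MCDomain.step_of_mem a (c.image j ▸ ⟨t, ht, rfl⟩)
  have hscale : ∀ s, r ≤ s → s < 1 → ContinuousOn (fun ζ : ℂ => v (s * ζ)) (sphere 0 1) := by
    intro s hs hs1
    refine hvc.comp (by fun_prop) fun ζ hζ => ?_
    have : ‖ζ‖ = 1 := by simpa using hζ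
    have h2 : ‖(s:ℂ) * ζ‖ = s := by simp [this, abs_of_pos (hr0.trans_le hs)]
    exact ⟨by rw [h2]; exact hs, by rw [h2]; exact hs1.le⟩
  obtain ⟨B, hB⟩ := (isCompact_cannulus r 1).exists_bound_of_continuousOn hvc
  have hev : ∀ᶠ s : ℝ in 𝓝[<] 1, r ≤ s ∧ s < 1 := by
    filter_upwards [Ioo_mem_nhdsLT hr2] with s hs using ⟨hs.1.le, hs.2⟩
  have hlim : Tendsto (fun s : ℝ => ∫ ζ, v (s * ζ) ∂circ) (𝓝[<] 1) (𝓝 (∫ _, m ∂circ)) := by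
    refine tendsto_integral_filter_of_dominated_convergence (fun _ => B) ?_ ?_
      (integrable_const _) ?_
    · filter_upwards [hev] with s hs using
        (integrable_circ_of_continuousOn (hscale s hs.1 hs.2)).aestronglyMeasurable
    · filter_upwards [hev] with s hs
      filter_upwards [circ_sphere] with ζ hζ
      have : ‖ζ‖ = 1 := by simpa using hζ
      have h2 : ‖(s:ℂ) * ζ‖ = s := by simp [this, abs_of_pos (hr0.trans_le hs.1)]
      exact hB _ ⟨by rw [h2]; exact hs.1, by rw [h2]; exact hs.2.le⟩
    · filter_upwards [circ_sphere] with ζ hζ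
      have hn : ‖ζ‖ = 1 := by simpa using hζ
      rw [← hv1 ζ hζ]
      refine (hvc ζ ⟨by rw [hn]; exact hr2.le, hn.le⟩).tendsto.comp
        (tendsto_nhdsWithin_iff.2 ⟨(tendsto_radial hζ).mono_right nhdsWithin_le_nhds, ?_⟩)
      filter_upwards [hev] with s hs
      have h2 : ‖(s:ℂ) * ζ‖ = s := by simp [hn, abs_of_pos (hr0.trans_le hs.1)]
      exact ⟨by rw [h2]; exact hs.1, by rw [h2]; exact hs.2.le⟩
  have hq : Real.circleAverage v 0 r = m := by
    have h3 : (fun s : ℝ => ∫ ζ, v (s * ζ) ∂circ) =ᶠ[𝓝[<] 1]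
        fun _ => Real.circleAverage v 0 r := by
      filter_upwards [hev] with s hs
      rw [integral_circ (integrable_circ_of_continuousOn (hscale s hs.1 hs.2)).aestronglyMeasurable,
        circleAverage_scale, hvavg s hs.1 hs.2]
    have h4 := tendsto_nhds_unique (tendsto_const_nhds.congr' h3.symm) hlim
    simpa using h4
  have hsph : ∀ t ∈ sphere (0:ℂ) r, t ∈ annulus c.r 1 := fun t ht => by
    have : ‖t‖ = r := by simpa using ht
    exact ⟨by rw [this]; exact hr1, by rw [this]; exact hr2⟩
  have hvr : v (0 + r) = m := circleAverage_eq_bound hr0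
    (hvc.mono fun t ht => ⟨by simpa using (mem_sphere_zero_iff_norm.1 ht).ge,
      (mem_sphere_zero_iff_norm.1 ht).le.trans hr2.le⟩)
    (fun t ht => hle _ ((c.collar j).inner t (hsph t ht))) hq.ge
  set w := c.γ j (0 + r) with hw
  have hwΩ : w ∈ D.Ω := (c.collar j).inner _ (hsph _ (by simp [abs_of_pos hr0]))
  have hum : ∀ z ∈ D.Ω, u z = m := by
    intro z hz
    obtain ⟨C, hC, hH⟩ := harnack D.isOpen D.conn.isPreconnected (singleton_subset_iff.2 hz)
      isCompact_singleton hwΩ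
    have h5 := hH (fun z => m - u z) ((isHarmonicOn_const D.isOpen m).sub huh)
      (fun z hz => sub_nonneg.2 (hle z hz)) z rfl
    have h6 : u w = m := hvr
    simp only [h6, sub_self, mul_zero] at h5
    exact le_antisymm (hle z hz) (by linarith)
  have hcl : EqOn u (fun _ => m) (closure D.Ω) :=
    EqOn.of_subset_closure hum huc continuousOn_const subset_closure subset_rfl
  refine ⟨m, fun i => ?_⟩
  obtain ⟨ζ, hζ⟩ := (D.curve i).nonempty
  rw [← MCDomain.step_of_mem a hζ, ← hub ζ (MCDomain.Γ_subset i hζ)]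
  exact hcl (frontier_subset_closure (MCDomain.Γ_subset i hζ))

end Collars

/-- Up to the harmonic extension of a locally constant boundary function, every harmonic function
is the real part of an analytic function. -/
theorem MCDomain.exists_re_add_P_step {D : MCDomain n} {u : ℂ → ℝ} (hu : IsHarmonicOn u D.Ω) :
    ∃ (a : Fin (n+1) → ℝ) (G : ℂ → ℂ), DifferentiableOn ℂ G D.Ω ∧
      ∀ z ∈ D.Ω, (G z).re = u z - D.P (D.step a) z := by
  obtain ⟨c⟩ := D.exists_collars
  obtain ⟨χ⟩ := exists_cutoff c.r_pos c.r_lt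
  choose p K hK using fun i : Fin (n+1) =>
    c.exists_rep (isHarmonicOn_P (D := D) (integrable_step (Pi.single i 1)))
  have hlin : ∀ a : Fin (n+1) → ℝ, c.IsRep (D.P (D.step a)) (∑ i, a i • p i)
      (fun j t => ∑ i, (a i : ℂ) * K i j t) := fun a =>
    (Collars.IsRep.linear hK a).congr fun z hz => P_step_sum a hz
  let T : (Fin (n+1) → ℝ) →ₗ[ℝ] (Fin (n+1) → ℝ) := Fintype.linearCombination ℝ p
  have hT : ∀ a, T a = ∑ i, a i • p i := fun a => Fintype.linearCombination_apply ℝ p a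
  let L : (Fin (n+1) → ℝ) →ₗ[ℝ] ℝ :=
    ∑ j, (∫ z, c.dens χ j z) • LinearMap.proj (R := ℝ) (φ := fun _ : Fin (n+1) => ℝ) j
  have hL : ∀ q, L q = ∑ j, (∫ z, c.dens χ j z) * q j := fun q => by
    simp [L, LinearMap.sum_apply]
  have hle : LinearMap.range T ≤ LinearMap.ker L := by
    rintro _ ⟨a, rfl⟩
    rw [LinearMap.mem_ker, hL, hT]
    exact (hlin a).sum_eq_zero χ
  have hker : LinearMap.ker T ≤ Submodule.span ℝ {fun _ => (1:ℝ)} := by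
    intro a ha
    rw [LinearMap.mem_ker, hT] at ha
    obtain ⟨m, hm⟩ := (ha ▸ hlin a).eq_const
    exact Submodule.mem_span_singleton.2 ⟨m, funext fun i => by simp [hm i]⟩
  have hk1 : Module.finrank ℝ (LinearMap.ker T) ≤ 1 :=
    (Submodule.finrank_mono hker).trans (by
      simpa using finrank_span_le_card (R := ℝ) ({fun _ => (1:ℝ)} : Set (Fin (n+1) → ℝ)))
  have h1 := T.finrank_range_add_finrank_ker
  have h2 := L.finrank_range_add_finrank_ker
  have h3 : LinearMap.range L = ⊤ := by
    refine LinearMap.range_eq_top.2 (LinearMap.surjective fun h0 => ?_)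
    have h4 := hL (Pi.single 0 1)
    rw [h0] at h4
    simp [Pi.single_apply] at h4
    exact (c.integral_dens_pos χ 0).ne h4
  rw [h3, finrank_top, Module.finrank_self] at h2
  have hrange : LinearMap.range T = LinearMap.ker L :=
    Submodule.eq_of_le_of_finrank_le hle (by omega)
  obtain ⟨q, M, hM⟩ := c.exists_rep hu
  have hq : q ∈ LinearMap.ker L := by
    rw [LinearMap.mem_ker, hL]; exact hM.sum_eq_zero χ
  rw [← hrange] at hq
  obtain ⟨a, rfl⟩ := hq
  have h5 := hM.sub (hlin a)
  rw [hT, sub_self] at h5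
  obtain ⟨G, hG, hGu⟩ := h5.exists_re
  exact ⟨a, G, hG, fun z hz => (hGu z hz).symm⟩

end

section

namespace MCDomain
variable {D : MCDomain n}

theorem step_sub (a b : Fin (n+1) → ℝ) (ζ : ℂ) :
    D.step (a - b) ζ = D.step a ζ - D.step b ζ := by
  simp only [step, ← Finset.sum_sub_distrib]
  refine Finset.sum_congr rfl fun j _ => ?_
  by_cases hj : ζ ∈ D.Γ j <;> simp [hj]

theorem exists_P_step_le (a : Fin (n+1) → ℝ) : ∃ m, ∀ z ∈ D.Ω, D.P (D.step a) z ≤ m := by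
  obtain ⟨j, hj⟩ := Finite.exists_max a
  refine ⟨a j, fun z hz => (P_mono (integrable_step a) (integrable_const (a j)) ?_ hz).trans
    (P_const _ hz).le⟩
  filter_upwards [ae_exists_mem_Γ] with ζ ⟨k, hk⟩
  rw [step_of_mem a hk]; exact hj k

/-- Boundary modulus of a zero-free analytic function with integrable boundary logarithm. -/
theorem ae_norm_eq_exp {F f : ℂ → ℂ} {k : ℂ → ℝ} (hk : Integrable k D.ω)
    (hF : ∀ z ∈ D.Ω, ‖F z‖ = Real.exp (D.P k z)) (hlim : ∀ᵐ ζ ∂D.ω, NTLim D.Ω F ζ (f ζ)) :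
    ∀ᵐ ζ ∂D.ω, ‖f ζ‖ = Real.exp (k ζ) := by
  obtain ⟨c⟩ := D.exists_collars
  refine c.ae_ω (c.ae_of_comp fun j => ?_)
  filter_upwards [circ_sphere, c.ae_tendsto_stolz hlim j, c.ae_tendsto_P hk j] with ζ hζ h1 h2
  have := stolz_neBot hζ
  refine tendsto_nhds_unique ((h1 1).norm.congr' ?_) ((Real.continuous_exp.tendsto _).comp (h2 1))
  have hr : ∀ᶠ t : ℂ in 𝓝 ζ, c.r < ‖t‖ :=
    continuous_norm.continuousAt.eventually (lt_mem_nhds (by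
      show c.r < ‖ζ‖
      rw [mem_sphere_zero_iff_norm.1 hζ]; exact c.r_lt))
  filter_upwards [nhdsWithin_le_nhds hr, self_mem_nhdsWithin] with t ht ht'
  exact hF _ ((c.collar j).inner t ⟨ht, mem_ball_zero_iff.1 ht'.1⟩)

theorem exists_bounded_exp {k : ℂ → ℝ} (hk : Integrable k D.ω) (h0 : ∀ ζ, 0 ≤ k ζ) :
    ∃ (a : Fin (n+1) → ℝ) (G f : ℂ → ℂ), DifferentiableOn ℂ G D.Ω ∧
      (∀ z ∈ D.Ω, (G z).re = D.P k z - D.P (D.step a) z) ∧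
      (∀ᵐ ζ ∂D.ω, NTLim D.Ω (fun z => exp (-G z)) ζ (f ζ)) ∧ ∀ᵐ ζ ∂D.ω, f ζ ≠ 0 := by
  obtain ⟨a, G, hG, hre⟩ := exists_re_add_P_step (isHarmonicOn_P hk)
  obtain ⟨m, hm⟩ := exists_P_step_le (D := D) a
  have hd : DifferentiableOn ℂ (fun z => exp (-G z)) D.Ω := hG.neg.cexp
  have hb : ∀ z ∈ D.Ω, ‖exp (-G z)‖ ≤ Real.exp m := fun z hz => by
    rw [norm_exp, neg_re, hre z hz, Real.exp_le_exp]
    have h1 : 0 ≤ D.P k z := integral_nonneg h0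
    have h2 := hm z hz
    linarith
  have hL := D.ae_exists_ntLim hd hb
  classical
  set f : ℂ → ℂ := fun ζ => if h : ∃ L, NTLim D.Ω (fun z => exp (-G z)) ζ L then h.choose else 0
  have hf : ∀ᵐ ζ ∂D.ω, NTLim D.Ω (fun z => exp (-G z)) ζ (f ζ) := by
    filter_upwards [hL] with ζ h
    simp only [f, dif_pos h]; exact h.choose_spec
  refine ⟨a, G, f, hG, hre, hf, ?_⟩
  have h3 := ae_norm_eq_exp (k := fun ζ => D.step a ζ - k ζ) ((integrable_step a).sub hk)
    (fun z hz => by rw [norm_exp, neg_re, hre z hz, P_sub (integrable_step a) hk hz]; ring_nf) hf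
  filter_upwards [h3] with ζ h
  exact norm_pos_iff.1 (h ▸ Real.exp_pos _)

/-- Up to a locally constant correction, an integrable function is the boundary log-modulus of a
zero-free analytic function represented by its boundary values. -/
theorem exists_exp {k : ℂ → ℝ} (hk : Integrable k D.ω) :
    ∃ (a : Fin (n+1) → ℝ) (G g : ℂ → ℂ), DifferentiableOn ℂ G D.Ω ∧
      (∀ z ∈ D.Ω, (G z).re = D.P (fun ζ => k ζ - D.step a ζ) z) ∧
      (∀ᵐ ζ ∂D.ω, NTLim D.Ω (fun z => exp (G z)) ζ (g ζ)) ∧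
      ∀ᵐ ζ ∂D.ω, ‖g ζ‖ = Real.exp (k ζ - D.step a ζ) := by
  have hp : Integrable (fun ζ => max (k ζ) 0) D.ω := hk.pos_part
  have hm : Integrable (fun ζ => max (-k ζ) 0) D.ω := hk.neg_part
  obtain ⟨a, G, f, hG, hre, hlim, hf0⟩ := exists_bounded_exp hp fun _ => le_max_right _ _
  obtain ⟨b, H, g, hH, hHre, hglim, -⟩ := exists_bounded_exp hm fun _ => le_max_right _ _
  have hre' : ∀ z ∈ D.Ω, (G z - H z).re = D.P (fun ζ => k ζ - D.step (a - b) ζ) z := fun z hz => by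
    rw [sub_re, hre z hz, hHre z hz, P_sub hk (integrable_step _) hz]
    have h1 : D.P k z = D.P (fun ζ => max (k ζ) 0 - max (-k ζ) 0) z := by
      congr 1; ext ζ
      rcases le_total 0 (k ζ) with h | h <;> simp [h]
    have h2 : D.P (D.step (a - b)) z = D.P (fun ζ => D.step a ζ - D.step b ζ) z := by
      congr 1; ext ζ; exact step_sub a b ζ
    rw [h1, h2, P_sub hp hm hz, P_sub (integrable_step _) (integrable_step _) hz]
    ring
  have hl : ∀ᵐ ζ ∂D.ω, NTLim D.Ω (fun z => exp (G z - H z)) ζ (g ζ / f ζ) := by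
    filter_upwards [hlim, hglim, hf0] with ζ h1 h2 h3 A hA
    refine ((h2 A hA).div (h1 A hA) h3).congr fun z => ?_
    change exp (-H z) / exp (-G z) = _
    rw [← Complex.exp_sub]; ring_nf
  exact ⟨a - b, fun z => G z - H z, fun ζ => g ζ / f ζ, hG.sub hH, hre', hl,
    ae_norm_eq_exp (hk.sub (integrable_step _)) (fun z hz => by rw [norm_exp, hre' z hz]) hl⟩

/-- Jensen's inequality for the Poisson operator. -/
theorem exp_P_le {l : ℂ → ℝ} (hl : Integrable l D.ω)
    (he : Integrable (fun ζ => Real.exp (l ζ)) D.ω) {z : ℂ} (hz : z ∈ D.Ω) :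
    Real.exp (D.P l z) ≤ D.P (fun ζ => Real.exp (l ζ)) z := by
  have := D.prob z hz
  exact convexOn_exp.map_integral_le Real.continuous_exp.continuousOn isClosed_univ
    (Eventually.of_forall fun _ => mem_univ _) (D.integrable_ωm hz hl) (D.integrable_ωm hz he)

/-- A quotient of functions with prescribed log-moduli differing by a locally constant function
is inner. -/
theorem isInner_of_log {U u : ℂ → ℂ} {a : Fin (n+1) → ℝ} (hU : DifferentiableOn ℂ U D.Ω)
    (hle : ∀ z ∈ D.Ω, ‖U z‖ ≤ Real.exp (D.P (D.step a) z))
    (hlim : ∀ᵐ ζ ∂D.ω, NTLim D.Ω U ζ (u ζ))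
    (hu : ∀ᵐ ζ ∂D.ω, ‖u ζ‖ = Real.exp (D.step a ζ)) : D.IsInner u := by
  obtain ⟨m, hm⟩ := exists_P_step_le (D := D) a
  refine ⟨⟨U, hU, ⟨Real.exp m, fun z hz => (hle z hz).trans (Real.exp_le_exp.2 (hm z hz))⟩, hlim⟩,
    fun j => ⟨Real.exp (a j), ?_⟩⟩
  filter_upwards [hu] with ζ h hj
  rw [h, step_of_mem a hj]

/-- An outer function is zero-free unless it vanishes identically. -/
theorem ne_zero_of_log_eq {G g : ℂ → ℂ} {l : ℂ → ℝ} (hG : DifferentiableOn ℂ G D.Ω)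
    (hlim : ∀ᵐ ζ ∂D.ω, NTLim D.Ω G ζ (g ζ)) (hl : Integrable l D.ω)
    (hlog : ∀ z ∈ D.Ω, Real.log ‖G z‖ = D.P l z) (hg : ∀ᵐ ζ ∂D.ω, g ζ ≠ 0) {z : ℂ}
    (hz : z ∈ D.Ω) : G z ≠ 0 := by
  intro h0
  have hA : AnalyticOnNhd ℂ G D.Ω := hG.analyticOnNhd D.isOpen
  rcases (hA z hz).eventually_eq_zero_or_eventually_ne_zero with h | h
  · have h1 := hA.eqOn_zero_of_preconnected_of_eventuallyEq_zero D.conn.isPreconnected hz h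
    have h2 := D.ae_eq_zero_of_eq_zero hlim fun w hw => h1 hw
    obtain ⟨ζ, h3, h4⟩ := (h2.and hg).exists
    exact h4 h3
  · have h1 : Tendsto (fun w => ‖G w‖) (𝓝[≠] z) (𝓝[≠] 0) := by
      refine tendsto_nhdsWithin_iff.2 ⟨?_, h.mono fun w hw => norm_ne_zero_iff.2 hw⟩
      have := (hA z hz).continuousAt.norm.tendsto
      rw [h0, norm_zero] at this
      exact this.mono_left nhdsWithin_le_nhds
    have h2 : Tendsto (fun w => D.P l w) (𝓝[≠] z) atBot :=
      (Real.tendsto_log_nhdsNE_zero.comp h1).congr' (by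
        filter_upwards [nhdsWithin_le_nhds (D.isOpen.mem_nhds hz)] with w hw using hlog w hw)
    have h3 : Tendsto (fun w => D.P l w) (𝓝[≠] z) (𝓝 (D.P l z)) :=
      ((isHarmonicOn_P hl).continuousOn.continuousAt (D.isOpen.mem_nhds hz)).tendsto.mono_left
        nhdsWithin_le_nhds
    exact not_tendsto_nhds_of_tendsto_atBot h2 _ h3

end MCDomain

end

/- STATEMENT 17: every nonzero f ∈ H¹(Γ) factors as f = φ g with φ Royden inner and g
outer, uniquely up to an invertible inner factor. -/
theorem inner_outer_factorization {n : ℕ} (D : MCDomain n)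
    (f : ℂ → ℂ) (hf : f ∈ D.H1) (hfm : Measurable f) (hne : ¬ (f =ᵐ[D.ω] 0)) :
    ∃ φ g : ℂ → ℂ, D.IsInner φ ∧ g ∈ D.H1 ∧ D.IsOuter g ∧
      (f =ᵐ[D.ω] fun x => φ x * g x) ∧
      -- uniqueness up to an invertible inner factor
      ∀ φ' g' : ℂ → ℂ, D.IsInner φ' → g' ∈ D.H1 → D.IsOuter g' →
        (f =ᵐ[D.ω] fun x => φ' x * g' x) →
        ∃ u u' : ℂ → ℂ, D.IsInner u ∧ D.IsInner u' ∧
          ((fun x => u x * u' x) =ᵐ[D.ω] fun _ => (1:ℂ)) ∧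
          (φ' =ᵐ[D.ω] fun x => u x * φ x) ∧ (g =ᵐ[D.ω] fun x => u x * g' x) := by
  obtain ⟨F, hF, ⟨h, hh, hFh⟩, hlim⟩ := hf
  obtain ⟨hf0, hk, hFk⟩ := D.log_integrable hF hh hFh hlim hfm hne
  have hfi := D.integrable_norm hF hh hFh hlim hfm
  set k : ℂ → ℝ := fun ζ => Real.log ‖f ζ‖ with hkdef
  obtain ⟨a, G, g, hG, hre, hglim, hgn⟩ := MCDomain.exists_exp hk
  have hl : Integrable (fun ζ => k ζ - D.step a ζ) D.ω := hk.sub (MCDomain.integrable_step a)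
  have hg0 : ∀ᵐ ζ ∂D.ω, g ζ ≠ 0 := by
    filter_upwards [hgn] with ζ h
    exact norm_pos_iff.1 (h ▸ Real.exp_pos _)
  have hPsub : ∀ (b : Fin (n+1) → ℝ), ∀ z ∈ D.Ω,
      D.P (fun ζ => k ζ - D.step b ζ) z = D.P k z - D.P (D.step b) z := fun b z hz =>
    MCDomain.P_sub hk (MCDomain.integrable_step b) hz
  have hstep : ∀ (b : Fin (n+1) → ℝ), ∀ z ∈ D.Ω,
      D.P (D.step (b - a)) z = D.P (D.step b) z - D.P (D.step a) z := fun b z hz => by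
    rw [← MCDomain.P_sub (MCDomain.integrable_step b) (MCDomain.integrable_step a) hz]
    congr 1; ext ζ; exact MCDomain.step_sub b a ζ
  have hstep' : ∀ (b : Fin (n+1) → ℝ), ∀ z ∈ D.Ω,
      D.P (D.step (a - b)) z = D.P (D.step a) z - D.P (D.step b) z := fun b z hz => by
    rw [← MCDomain.P_sub (MCDomain.integrable_step a) (MCDomain.integrable_step b) hz]
    congr 1; ext ζ; exact MCDomain.step_sub a b ζ
  have hexp : Integrable (fun ζ => Real.exp (k ζ - D.step a ζ)) D.ω := by
    obtain ⟨j, hj⟩ := Finite.exists_min a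
    refine (hfi.const_mul (Real.exp (-a j))).mono'
      (Real.continuous_exp.comp_aestronglyMeasurable hl.aestronglyMeasurable) ?_
    filter_upwards [hf0, MCDomain.ae_exists_mem_Γ] with ζ h0 ⟨i, hi⟩
    rw [Real.norm_eq_abs, Real.abs_exp, MCDomain.step_of_mem a hi, sub_eq_neg_add, Real.exp_add,
      hkdef, Real.exp_log (norm_pos_iff.2 h0)]
    gcongr
    exact hj i
  refine ⟨fun ζ => f ζ / g ζ, g, ?_, ?_, ?_, ?_, ?_⟩
  · refine MCDomain.isInner_of_log (U := fun z => F z / exp (G z)) (a := a)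
      (hF.div hG.cexp fun _ _ => exp_ne_zero _) (fun z hz => ?_) ?_ ?_
    · rw [norm_div, norm_exp, hre z hz, hPsub a z hz, div_le_iff₀ (Real.exp_pos _),
        ← Real.exp_add, add_sub_cancel]
      by_cases h0 : F z = 0
      · rw [h0, norm_zero]; exact (Real.exp_pos _).le
      · exact (Real.log_le_iff_le_exp (norm_pos_iff.2 h0)).1 (hFk z hz h0)
    · filter_upwards [hlim, hglim, hg0] with ζ h1 h2 h3 A hA
      exact (h1 A hA).div (h2 A hA) h3
    · filter_upwards [hgn, hf0] with ζ h1 h2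
      rw [norm_div, h1, Real.exp_sub, hkdef, Real.exp_log (norm_pos_iff.2 h2)]
      have := norm_ne_zero_iff.2 h2
      field_simp
  · refine ⟨fun z => exp (G z), hG.cexp, ⟨_, MCDomain.isHarmonicOn_P hexp, fun z hz => ?_⟩, hglim⟩
    rw [norm_exp, hre z hz]
    exact MCDomain.exp_P_le hl hexp hz
  · refine ⟨fun z => exp (G z), hG.cexp, hglim, fun z hz => ?_⟩
    rw [norm_exp, Real.log_exp, hre z hz]
    refine MCDomain.P_congr ?_ hz
    filter_upwards [hgn] with ζ h
    rw [h, Real.log_exp]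
  · filter_upwards [hg0] with ζ h
    rw [div_mul_cancel₀ _ h]
  · rintro φ' g' ⟨-, hφ'⟩ - ⟨G', hG', hglim', hlog'⟩ hfac
    choose c hc using hφ'
    have hg0' : ∀ᵐ ζ ∂D.ω, g' ζ ≠ 0 := by
      filter_upwards [hf0, hfac] with ζ h1 h2 h3
      exact h1 (by rw [h2, h3, mul_zero])
    set b : Fin (n+1) → ℝ := fun j => Real.log (c j)
    have hgn' : ∀ᵐ ζ ∂D.ω, ‖g' ζ‖ = Real.exp (k ζ - D.step b ζ) := by
      filter_upwards [hf0, hfac, ae_all_iff.2 hc, MCDomain.ae_exists_mem_Γ] with ζ h1 h2 h3 ⟨j, hj⟩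
      have hφ0 : 0 < ‖φ' ζ‖ := norm_pos_iff.2 fun h => h1 (by rw [h2, h, zero_mul])
      rw [MCDomain.step_of_mem b hj, show b j = Real.log ‖φ' ζ‖ by rw [h3 j hj], Real.exp_sub, Real.exp_log hφ0, hkdef,
        Real.exp_log (norm_pos_iff.2 h1), h2, norm_mul, mul_div_cancel_left₀ _ hφ0.ne']
    have hl' : Integrable (fun ζ => k ζ - D.step b ζ) D.ω := hk.sub (MCDomain.integrable_step b)
    have hlogP : ∀ z ∈ D.Ω, Real.log ‖G' z‖ = D.P (fun ζ => k ζ - D.step b ζ) z := fun z hz => by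
      rw [hlog' z hz]
      refine MCDomain.P_congr ?_ hz
      filter_upwards [hgn'] with ζ h
      rw [h, Real.log_exp]
    have hG0 : ∀ z ∈ D.Ω, G' z ≠ 0 := fun z hz =>
      MCDomain.ne_zero_of_log_eq hG' hglim' hl' hlogP hg0' hz
    have hGn : ∀ z ∈ D.Ω, ‖G' z‖ = Real.exp (D.P k z - D.P (D.step b) z) := fun z hz => by
      rw [← hPsub b z hz, ← hlogP z hz, Real.exp_log (norm_pos_iff.2 (hG0 z hz))]
    refine ⟨fun ζ => g ζ / g' ζ, fun ζ => g' ζ / g ζ, ?_, ?_, ?_, ?_, ?_⟩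
    · refine MCDomain.isInner_of_log (U := fun z => exp (G z) / G' z) (a := b - a)
        (hG.cexp.div hG' hG0) (fun z hz => ?_) ?_ ?_
      · rw [norm_div, norm_exp, hre z hz, hGn z hz, hPsub a z hz, ← Real.exp_sub, hstep b z hz]
        exact (by ring_nf : _ = _).le
      · filter_upwards [hglim, hglim', hg0'] with ζ h1 h2 h3 A hA
        exact (h1 A hA).div (h2 A hA) h3
      · filter_upwards [hgn, hgn'] with ζ h1 h2
        rw [norm_div, h1, h2, ← Real.exp_sub, MCDomain.step_sub]
        ring_nf
    · refine MCDomain.isInner_of_log (U := fun z => G' z / exp (G z)) (a := a - b)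
        (hG'.div hG.cexp fun _ _ => exp_ne_zero _) (fun z hz => ?_) ?_ ?_
      · rw [norm_div, norm_exp, hre z hz, hGn z hz, hPsub a z hz, ← Real.exp_sub, hstep' b z hz]
        exact (by ring_nf : _ = _).le
      · filter_upwards [hglim, hglim', hg0] with ζ h1 h2 h3 A hA
        exact (h2 A hA).div (h1 A hA) h3
      · filter_upwards [hgn, hgn'] with ζ h1 h2
        rw [norm_div, h1, h2, ← Real.exp_sub, MCDomain.step_sub]
        ring_nf
    · filter_upwards [hg0, hg0'] with ζ h1 h2
      field_simp
    · filter_upwards [hg0, hg0', hfac] with ζ h1 h2 h3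
      rw [h3]; field_simp
    · filter_upwards [hg0'] with ζ h2
      field_simp
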